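/- arXiv:2111.10122 — 10 statements merged into one kernel-verified Lean document; each statement's English description precedes it below -/
import Mathlib

section
/- The closed unit ball of the Banach space Z = ℓ₁ ⊕₂ ℝ is a plastic metric space; that is, every non-expansive bijection from the closed unit ball of Z onto itself is an isometry. -/
/-- The real sequence space ℓ₁. -/
noncomputable abbrev Ell1 : Type := lp (fun _ : ℕ => ℝ) 1

/-- The space Z = ℓ₁ ⊕₂ ℝ, with norm ‖(x,t)‖ = √(‖x‖₁² + t²). -/
noncomputable abbrev Z : Type := WithLp 2 (Ell1 × ℝ)

namespace PlasticAux

noncomputable def sg (k : ℕ) (a : ℝ) : Ell1 := lp.single 1 k a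

noncomputable def mk (x : Ell1) (s : ℝ) : Z := WithLp.toLp 2 (x, s)

theorem l1_hasSum (x : Ell1) : HasSum (fun k => |x k|) ‖x‖ := by
  have h := lp.hasSum_norm (p := 1) (by simp) x
  simpa using h

theorem sg_self (k : ℕ) (a : ℝ) : sg k a k = a := by simp [sg]

theorem sg_ne {k j : ℕ} (a : ℝ) (h : j ≠ k) : sg k a j = 0 := by
  simp [sg, h]

theorem sub_ap (x y : Ell1) (k : ℕ) : (x - y) k = x k - y k := rfl
theorem add_ap (x y : Ell1) (k : ℕ) : (x + y) k = x k + y k := rfl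
theorem smul_ap (c : ℝ) (y : Ell1) (k : ℕ) : (c • y) k = c * y k := rfl

theorem sg_add (k : ℕ) (a b : ℝ) : sg k (a + b) = sg k a + sg k b := lp.single_add _ _ _ _
theorem sg_sub (k : ℕ) (a b : ℝ) : sg k (a - b) = sg k a - sg k b := lp.single_sub _ _ _ _
theorem sg_neg (k : ℕ) (a : ℝ) : sg k (-a) = - sg k a := lp.single_neg _ _ _
theorem sg_zero (k : ℕ) : sg k 0 = 0 := lp.single_zero _ _
theorem sg_smul (k : ℕ) (c a : ℝ) : sg k (c * a) = c • sg k a := lp.single_smul (E := fun _ : ℕ => ℝ) 1 k c a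

theorem norm_sg (k : ℕ) (a : ℝ) : ‖sg k a‖ = |a| := by
  simp [sg, lp.norm_single]

theorem norm_sub_sg (x : Ell1) (k : ℕ) (a : ℝ) : ‖x - sg k a‖ = ‖x‖ - |x k| + |x k - a| := by
  have h := (l1_hasSum x).update k (|x k - a|)
  have h2 := l1_hasSum (x - sg k a)
  have e : (fun j => |(x - sg k a) j|) = Function.update (fun k => |x k|) k (|x k - a|) := by
    funext j
    by_cases hj : j = k
    · subst hj; simp [sub_ap, sg_self]
    · simp [sub_ap, sg_ne a hj, hj]
  rw [e] at h2
  rw [h2.unique h]; ring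

theorem norm_add_sg (x : Ell1) (k : ℕ) (a : ℝ) : ‖x + sg k a‖ = ‖x‖ - |x k| + |x k + a| := by
  have := norm_sub_sg x k (-a)
  rw [sg_neg, sub_neg_eq_add, sub_neg_eq_add] at this
  exact this

theorem ap_le (x : Ell1) (k : ℕ) : |x k| ≤ ‖x‖ := by
  have := norm_sub_sg x k (x k)
  have h := norm_nonneg (x - sg k (x k))
  simp at this
  linarith

theorem ap_le2 (x : Ell1) {i j : ℕ} (h : i ≠ j) : |x i| + |x j| ≤ ‖x‖ := by
  have h1 := ap_le (x - sg i (x i)) j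
  rw [norm_sub_sg, sub_ap, sg_ne _ h.symm] at h1
  simp at h1
  linarith

theorem ap_le3 (x : Ell1) {i j k : ℕ} (h : i ≠ j) (h2 : i ≠ k) (h3 : j ≠ k) :
    |x i| + |x j| + |x k| ≤ ‖x‖ := by
  have h1 := ap_le2 (x - sg i (x i)) h3
  rw [norm_sub_sg, sub_ap, sub_ap, sg_ne _ h.symm, sg_ne _ h2.symm] at h1
  simp at h1
  linarith

theorem box {w z : Ell1} (h : ‖w‖ + ‖z - w‖ ≤ ‖z‖) (k : ℕ) : |w k| + |z k - w k| ≤ |z k| := by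
  have h1 := norm_sub_sg w k (w k)
  have h2 := norm_sub_sg (z - w) k (z k - w k)
  have h3 := norm_sub_sg z k (z k)
  have h4 := norm_add_le (w - sg k (w k)) (z - w - sg k (z k - w k))
  have e : (w - sg k (w k)) + (z - w - sg k (z k - w k)) = z - sg k (z k) := by
    rw [sg_sub]; abel
  rw [e] at h4
  simp [sub_ap] at h1 h2 h3
  linarith

theorem l1_ext {x y : Ell1} (h : ∀ k, x k = y k) : x = y := by
  ext k; exact h k

theorem exists_T (σ : ℕ → ℕ) (hσ : Function.Injective σ) (ε : ℕ → ℝ) (hε : ∀ m, |ε m| = 1) :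
    ∃ T : Ell1 →ₗ[ℝ] Ell1, (∀ x, ‖T x‖ = ‖x‖) ∧ ∀ m a, T (sg m a) = sg (σ m) (ε m * a) := by
  classical
  let g : Ell1 → ℕ → ℝ := fun x => Function.extend σ (fun m => ε m * x m) 0
  have hab : ∀ x : Ell1, (fun k => |g x k|) = Function.extend σ (fun m => |x m|) 0 := by
    intro x
    funext k
    by_cases hk : ∃ m, σ m = k
    · obtain ⟨m, rfl⟩ := hk
      simp only [g, hσ.extend_apply, abs_mul, hε, one_mul]
    · simp only [g, Function.extend_apply' _ _ _ hk]; simp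
  have hs : ∀ x : Ell1, HasSum (fun k => |g x k|) ‖x‖ := by
    intro x
    rw [hab x, hasSum_extend_zero hσ]
    exact l1_hasSum x
  have hm : ∀ x : Ell1, Memℓp (g x) 1 := by
    intro x
    apply memℓp_gen
    simpa using (hs x).summable
  refine ⟨{ toFun := fun x => ⟨g x, hm x⟩, map_add' := ?_, map_smul' := ?_ }, ?_, ?_⟩
  · intro x y
    apply l1_ext
    intro k
    rw [add_ap]
    change g (x + y) k = g x k + g y k
    by_cases hk : ∃ m, σ m = k
    · obtain ⟨m, rfl⟩ := hk
      simp only [g, hσ.extend_apply, add_ap]; ring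
    · simp only [g, Function.extend_apply' _ _ _ hk]; simp
  · intro c x
    apply l1_ext
    intro k
    simp only [RingHom.id_apply]
    rw [smul_ap]
    change g (c • x) k = c * g x k
    by_cases hk : ∃ m, σ m = k
    · obtain ⟨m, rfl⟩ := hk
      simp only [g, hσ.extend_apply, smul_ap]; ring
    · simp only [g, Function.extend_apply' _ _ _ hk]; simp
  · intro x
    exact (l1_hasSum ⟨g x, hm x⟩).unique (hs x)
  · intro m a
    apply l1_ext
    intro k
    change g (sg m a) k = _
    by_cases hk : ∃ m, σ m = k
    · obtain ⟨j, rfl⟩ := hk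
      simp only [g, hσ.extend_apply]
      by_cases hj : j = m
      · subst hj; rw [sg_self, sg_self]
      · rw [sg_ne _ hj, sg_ne _ (fun h => hj (hσ h)), mul_zero]
    · simp only [g, Function.extend_apply' _ _ _ hk]
      rw [sg_ne _ (fun h => hk ⟨m, h.symm⟩)]; rfl

theorem mk_norm (x : Ell1) (s : ℝ) : ‖mk x s‖ ^ 2 = ‖x‖ ^ 2 + s ^ 2 := by
  rw [WithLp.prod_norm_sq_eq_of_L2]; simp [mk]

theorem mk_sub (x y : Ell1) (s t : ℝ) : mk x s - mk y t = mk (x - y) (s - t) := rfl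
theorem mk_add (x y : Ell1) (s t : ℝ) : mk x s + mk y t = mk (x + y) (s + t) := rfl
theorem mk_neg (x : Ell1) (s : ℝ) : - mk x s = mk (-x) (-s) := rfl
theorem mk_smul (c : ℝ) (x : Ell1) (s : ℝ) : c • mk x s = mk (c • x) (c * s) := rfl
theorem mk_eta (p : Z) : p = mk p.fst p.snd := rfl
theorem mk_zero : mk 0 0 = 0 := rfl
theorem mk_inj {x y : Ell1} {s t : ℝ} (h : mk x s = mk y t) : x = y ∧ s = t := by
  constructor
  · exact congrArg (fun p : Z => p.fst) h
  · exact congrArg (fun p : Z => p.snd) h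

theorem mk_norm_le {x : Ell1} {s r : ℝ} (hr : 0 ≤ r) : ‖mk x s‖ ≤ r ↔ ‖x‖ ^ 2 + s ^ 2 ≤ r ^ 2 := by
  rw [← mk_norm]
  exact (sq_le_sq₀ (norm_nonneg _) hr).symm

theorem mk_norm_le_one {x : Ell1} {s : ℝ} : ‖mk x s‖ ≤ 1 ↔ ‖x‖ ^ 2 + s ^ 2 ≤ 1 := by
  rw [mk_norm_le zero_le_one, one_pow]

theorem mk_norm_le_norm {x y : Ell1} {s t : ℝ} :
    ‖mk x s‖ ≤ ‖mk y t‖ ↔ ‖x‖ ^ 2 + s ^ 2 ≤ ‖y‖ ^ 2 + t ^ 2 := by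
  rw [mk_norm_le (norm_nonneg _), mk_norm]

theorem mk_cont {X : Type*} [TopologicalSpace X] {f : X → Ell1} {g : X → ℝ} (hf : Continuous f)
    (hg : Continuous g) : Continuous (fun x => mk (f x) (g x)) := by
  unfold mk
  exact (WithLp.prod_continuous_toLp 2 Ell1 ℝ).comp (hf.prodMk hg)

theorem sg_cont (k : ℕ) : Continuous (sg k) := by
  unfold sg
  exact (lp.isometry_single (E := fun _ : ℕ => ℝ) (p := 1) k).continuous

structure Hyp (F : Z → Z) : Prop where
  maps : ∀ p, ‖p‖ ≤ 1 → ‖F p‖ ≤ 1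
  inj : ∀ p q, ‖p‖ ≤ 1 → ‖q‖ ≤ 1 → F p = F q → p = q
  surj : ∀ q, ‖q‖ ≤ 1 → ∃ p, ‖p‖ ≤ 1 ∧ F p = q
  lip : ∀ p q, ‖p‖ ≤ 1 → ‖q‖ ≤ 1 → ‖F p - F q‖ ≤ ‖p - q‖

def Ext (e : Z) : Prop := ‖e‖ ≤ 1 ∧ ∀ h, ‖e + h‖ ≤ 1 → ‖e - h‖ ≤ 1 → h = 0

theorem F_zero {F : Z → Z} (H : Hyp F) : F 0 = 0 := by
  by_contra hz
  have hn : 0 < ‖F 0‖ := norm_pos_iff.mpr hz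
  obtain ⟨p, hp, hq⟩ := H.surj (-(‖F 0‖⁻¹ • F 0)) (by
    rw [norm_neg, norm_smul, norm_inv, norm_norm, inv_mul_cancel₀ hn.ne'])
  have h := H.lip p 0 hp (by simp)
  rw [hq, sub_zero] at h
  have e : -(‖F 0‖⁻¹ • F 0) - F 0 = (-(‖F 0‖⁻¹ + 1)) • F 0 := by module
  rw [e, norm_smul, norm_neg, Real.norm_of_nonneg (by positivity), add_mul,
    inv_mul_cancel₀ hn.ne'] at h
  linarith

theorem F_norm {F : Z → Z} (H : Hyp F) {p : Z} (hp : ‖p‖ ≤ 1) : ‖F p‖ ≤ ‖p‖ := by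
  have h := H.lip p 0 hp (by simp)
  rwa [F_zero H, sub_zero, sub_zero] at h

theorem F_ext_smul {F : Z → Z} (H : Hyp F) {u : Z} (hu : ‖u‖ ≤ 1) (he : Ext (F u)) {t : ℝ}
    (h0 : 0 ≤ t) (h1 : t ≤ 1) : F (t • u) = t • F u := by
  have hn : ‖t • u‖ ≤ t := by
    rw [norm_smul, Real.norm_of_nonneg h0]; nlinarith [norm_nonneg u]
  have hq : ‖F (t • u)‖ ≤ t := (F_norm H (hn.trans h1)).trans hn
  have hd : ‖F u - F (t • u)‖ ≤ 1 - t := by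
    refine (H.lip u (t • u) hu (hn.trans h1)).trans ?_
    have e : u - t • u = (1 - t) • u := by module
    rw [e, norm_smul, Real.norm_of_nonneg (by linarith)]
    nlinarith [norm_nonneg u]
  have hF := he.1
  have ht : ‖t • F u‖ ≤ t := by
    rw [norm_smul, Real.norm_of_nonneg h0]; nlinarith [norm_nonneg (F u)]
  have ht' : ‖(1 - t) • F u‖ ≤ 1 - t := by
    rw [norm_smul, Real.norm_of_nonneg (by linarith)]; nlinarith [norm_nonneg (F u)]
  have := he.2 (F (t • u) - t • F u) ?_ ?_
  · exact sub_eq_zero.mp this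
  · have e : F u + (F (t • u) - t • F u) = F (t • u) + (1 - t) • F u := by module
    rw [e]; exact (norm_add_le _ _).trans (by linarith)
  · have e : F u - (F (t • u) - t • F u) = (F u - F (t • u)) + t • F u := by module
    rw [e]; exact (norm_add_le _ _).trans (by linarith)

theorem Ext_neg {e : Z} (he : Ext e) : Ext (-e) := by
  refine ⟨by rw [norm_neg]; exact he.1, fun h h1 h2 => ?_⟩
  apply he.2
  · rw [← norm_neg]; rw [show -(e + h) = -e - h by abel]; exact h2
  · rw [← norm_neg]; rw [show -(e - h) = -e + h by abel]; exact h1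

theorem F_ext_neg {F : Z → Z} (H : Hyp F) {u : Z} (hu : ‖u‖ ≤ 1) (he : Ext (F u)) :
    F (-u) = - F u := by
  obtain ⟨y, hy, hFy⟩ := H.surj (-F u) (by rw [norm_neg]; exact he.1)
  have key : ∀ m : Z, ‖m‖ ≤ 1 → ‖m - u‖ ≤ 1 → ‖m - y‖ ≤ 1 → m = 0 := by
    intro m hm h1 h2
    apply H.inj _ _ hm (by simp)
    rw [F_zero H]
    apply he.2
    · have := (H.lip m y hm hy).trans h2
      rw [hFy] at this
      rwa [show F m - -F u = F u + F m by abel] at this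
    · have := (H.lip m u hm hu).trans h1
      rwa [norm_sub_rev] at this
  have h := key ((1 / 2 : ℝ) • (u + y)) ?_ ?_ ?_
  · have : u + y = 0 := by
      rcases smul_eq_zero.mp h with h | h
      · norm_num at h
      · exact h
    rw [neg_eq_of_add_eq_zero_right this, hFy]
  · rw [norm_smul]
    have := norm_add_le u y
    norm_num; linarith
  · rw [show (1 / 2 : ℝ) • (u + y) - u = (1 / 2 : ℝ) • (y - u) by module, norm_smul]
    have := norm_sub_le y u
    norm_num; linarith
  · rw [show (1 / 2 : ℝ) • (u + y) - y = (1 / 2 : ℝ) • (u - y) by module, norm_smul]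
    have := norm_sub_le u y
    norm_num; linarith

theorem F_ext_ext {F : Z → Z} (H : Hyp F) {u : Z} (hu : ‖u‖ ≤ 1) (he : Ext (F u)) : Ext u := by
  refine ⟨hu, fun h h1 h2 => ?_⟩
  have hh : ‖h‖ ≤ 1 := by
    rw [show h = (1 / 2 : ℝ) • ((u + h) - (u - h)) by module, norm_smul]
    have := norm_sub_le (u + h) (u - h)
    norm_num at this ⊢; linarith
  apply H.inj _ _ hh (by simp)
  rw [F_zero H]
  apply he.2
  · have := H.lip h (-u) hh (by rwa [norm_neg])
    rw [F_ext_neg H hu he, show h - -u = u + h by abel, show F h - -F u = F u + F h by abel] at this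
    exact this.trans h1
  · have := H.lip u h hu hh
    exact this.trans h2

noncomputable def cp (k : ℕ) (a s : ℝ) : Z := mk (sg k a) s

theorem cp_norm {k : ℕ} {a s r : ℝ} (h : a ^ 2 + s ^ 2 ≤ r ^ 2) (hr : 0 ≤ r) : ‖cp k a s‖ ≤ r := by
  rw [cp, mk_norm_le hr, norm_sg, sq_abs]; exact h

theorem cp_norm_one {k : ℕ} {a s : ℝ} (h : a ^ 2 + s ^ 2 = 1) : ‖cp k a s‖ ≤ 1 :=
  cp_norm (by rw [h]; norm_num) zero_le_one

theorem cp_neg (k : ℕ) (a s : ℝ) : - cp k a s = cp k (-a) (-s) := by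
  rw [cp, mk_neg, cp, sg_neg]

theorem cp_smul (c : ℝ) (k : ℕ) (a s : ℝ) : c • cp k a s = cp k (c * a) (c * s) := by
  rw [cp, mk_smul, cp, sg_smul]

theorem cp_ext {k : ℕ} {a s : ℝ} (h : a ^ 2 + s ^ 2 = 1) : Ext (cp k a s) := by
  refine ⟨cp_norm_one h, fun p h1 h2 => ?_⟩
  rw [mk_eta p] at h1 h2 ⊢
  generalize p.fst = y at *
  generalize p.snd = t at *
  rw [cp, mk_add, mk_norm_le_one, add_comm (sg k a) y, norm_add_sg] at h1
  rw [cp, mk_sub, mk_norm_le_one, norm_sub_rev, norm_sub_sg] at h2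
  have hy := ap_le y k
  have e1 := sq_abs (y k + a)
  have e2 := sq_abs (y k - a)
  have n1 := abs_nonneg (y k + a)
  have n2 := abs_nonneg (y k - a)
  set R := ‖y‖ - |y k| with hR
  have hR0 : 0 ≤ R := by linarith
  have m1 := mul_nonneg hR0 n1
  have m2 := mul_nonneg hR0 n2
  have hs : R ^ 2 + (y k) ^ 2 + t ^ 2 ≤ 0 := by nlinarith
  have hR1 : R = 0 := by nlinarith [sq_nonneg (y k), sq_nonneg t, sq_nonneg R]
  have hyk : y k = 0 := by nlinarith [sq_nonneg (y k), sq_nonneg t, sq_nonneg R]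
  have ht : t = 0 := by nlinarith [sq_nonneg (y k), sq_nonneg t, sq_nonneg R]
  have : y = 0 := by
    rw [← norm_eq_zero]
    rw [hyk, hR1] at hR; simp at hR; exact hR.symm
  rw [this, ht, mk_zero]

theorem ext_cp {u : Z} (he : Ext u) : ∃ k a s, a ^ 2 + s ^ 2 = 1 ∧ u = cp k a s := by
  have hn : ‖u‖ = 1 := by
    by_contra hne
    have hlt : ‖u‖ < 1 := lt_of_le_of_ne he.1 hne
    have hv : ‖mk 0 (1 - ‖u‖)‖ ≤ 1 - ‖u‖ := by
      rw [mk_norm_le (by linarith)]; simp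
    have := he.2 (mk 0 (1 - ‖u‖)) ((norm_add_le _ _).trans (by linarith))
      ((norm_sub_le _ _).trans (by linarith))
    rw [← mk_zero] at this
    have := (mk_inj this).2
    linarith
  rw [mk_eta u] at *
  generalize u.fst = x at *
  generalize u.snd = s at *
  have hsq : ‖x‖ ^ 2 + s ^ 2 = 1 := by rw [← mk_norm, hn, one_pow]
  have h2 : ∀ i j, i ≠ j → x i ≠ 0 → x j = 0 := by
    intro i j hij hi
    by_contra hj
    have main : ∀ a b : ℝ, x i ≠ 0 → x j ≠ 0 → ∃ c d : ℝ, c ≠ 0 ∧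
        |x i + c| + |x j + d| = |x i| + |x j| ∧ |x i - c| + |x j - d| = |x i| + |x j| := by
      intro _ _ hi hj
      have hδ : 0 < min |x i| |x j| := lt_min (abs_pos.mpr hi) (abs_pos.mpr hj)
      have l1 := min_le_left |x i| |x j|
      have l2 := min_le_right |x i| |x j|
      generalize min |x i| |x j| = δ at *
      rcases lt_or_gt_of_ne hi with hi | hi <;> rcases lt_or_gt_of_ne hj with hj | hj
      · rw [abs_of_neg hi, abs_of_neg hj] at *
        refine ⟨δ, -δ, hδ.ne', ?_, ?_⟩
        · rw [abs_of_nonpos (by linarith), abs_of_nonpos (by linarith)]; ring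
        · rw [abs_of_nonpos (by linarith), abs_of_nonpos (by linarith)]; ring
      · rw [abs_of_neg hi, abs_of_pos hj] at *
        refine ⟨δ, δ, hδ.ne', ?_, ?_⟩
        · rw [abs_of_nonpos (by linarith), abs_of_nonneg (by linarith)]; ring
        · rw [abs_of_nonpos (by linarith), abs_of_nonneg (by linarith)]; ring
      · rw [abs_of_pos hi, abs_of_neg hj] at *
        refine ⟨δ, δ, hδ.ne', ?_, ?_⟩
        · rw [abs_of_nonneg (by linarith), abs_of_nonpos (by linarith)]; ring
        · rw [abs_of_nonneg (by linarith), abs_of_nonpos (by linarith)]; ring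
      · rw [abs_of_pos hi, abs_of_pos hj] at *
        refine ⟨δ, -δ, hδ.ne', ?_, ?_⟩
        · rw [abs_of_nonneg (by linarith), abs_of_nonneg (by linarith)]; ring
        · rw [abs_of_nonneg (by linarith), abs_of_nonneg (by linarith)]; ring
    obtain ⟨c, d, hc, e1, e2⟩ := main 0 0 hi hj
    have := he.2 (mk (sg i c + sg j d) 0) ?_ ?_
    · rw [← mk_zero] at this
      have := congrArg (fun y : Ell1 => y i) (mk_inj this).1
      simp only [add_ap, sg_self, sg_ne _ hij] at this
      apply hc; simpa using this
    · rw [mk_add, mk_norm_le_one, ← add_assoc, norm_add_sg, norm_add_sg, add_ap,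
        sg_ne _ hij.symm, add_zero, add_zero]
      rw [show ‖x‖ - |x i| + |x i + c| - |x j| + |x j + d| = ‖x‖ by linarith]
      exact hsq.le
    · rw [mk_sub, mk_norm_le_one, ← sub_sub, norm_sub_sg, norm_sub_sg, sub_ap,
        sg_ne _ hij.symm, sub_zero, sub_zero]
      rw [show ‖x‖ - |x i| + |x i - c| - |x j| + |x j - d| = ‖x‖ by linarith]
      exact hsq.le
  have : ∃ k, x = sg k (x k) := by
    by_cases hx : ∃ k, x k ≠ 0
    · obtain ⟨k, hk⟩ := hx
      refine ⟨k, l1_ext fun j => ?_⟩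
      by_cases hj : j = k
      · subst hj; rw [sg_self]
      · rw [sg_ne _ hj]; exact h2 k j (Ne.symm hj) hk
    · push Not at hx
      refine ⟨0, l1_ext fun j => ?_⟩
      rw [hx 0, sg_zero, hx j]; rfl
  obtain ⟨k, hk⟩ := this
  refine ⟨k, x k, s, ?_, ?_⟩
  · rw [← hsq, hk, norm_sg, sg_self, sq_abs]
  · rw [cp, ← hk]

/-- distances between circle points -/
theorem cp_dist_same (k : ℕ) (a s b t : ℝ) : ‖cp k a s - cp k b t‖ ^ 2 = (a - b) ^ 2 + (s - t) ^ 2 := by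
  rw [cp, cp, mk_sub, mk_norm, ← sg_sub, norm_sg, sq_abs]

theorem cp_dist_ne {k l : ℕ} (h : k ≠ l) (a s b t : ℝ) :
    ‖cp k a s - cp l b t‖ ^ 2 = (|a| + |b|) ^ 2 + (s - t) ^ 2 := by
  rw [cp, cp, mk_sub, mk_norm, norm_sub_sg, norm_sg, sg_ne _ h.symm]; simp

theorem cp_inj {k l : ℕ} {a s b t : ℝ} (h : cp k a s = cp l b t) (ha : a ≠ 0) :
    k = l ∧ a = b ∧ s = t := by
  obtain ⟨h1, h2⟩ := mk_inj h
  have := congrArg (fun y : Ell1 => y k) h1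
  simp only [sg_self] at this
  by_cases hk : k = l
  · subst hk; rw [sg_self] at this; exact ⟨rfl, this, h2⟩
  · rw [sg_ne _ hk] at this; exact absurd this ha

theorem cp_pole (k l : ℕ) (s : ℝ) : cp k 0 s = cp l 0 s := by
  rw [cp, cp, sg_zero, sg_zero]

theorem sq1 {x : ℝ} (h : x ^ 2 = 1) : x = 1 ∨ x = -1 := by
  have : (x - 1) * (x + 1) = 0 := by nlinarith
  rcases mul_eq_zero.mp this with h | h
  · left; linarith
  · right; linarith

theorem sierp_step (A : ℕ → Set ℝ) (hc : ∀ k, IsClosed (A k))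
    (hcov : ∀ x, -1 < x → x < 1 → ∃ k, x ∈ A k)
    (hdis : ∀ x, -1 < x → x < 1 → ∀ k l, x ∈ A k → x ∈ A l → k = l)
    (c d : ℝ) (h1 : -1 < c) (h2 : d < 1) (hcd : c ≤ d)
    (hno : ∀ i, ¬ Set.Icc c d ⊆ A i) (j : ℕ) :
    ∃ c' d', c ≤ c' ∧ d' ≤ d ∧ c' ≤ d' ∧ (∀ i, ¬ Set.Icc c' d' ⊆ A i) ∧
      ∀ x ∈ Set.Icc c' d', x ∉ A j := by
  by_cases hj : ∃ y0 ∈ Set.Icc c d, y0 ∈ A j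
  swap
  · push Not at hj
    exact ⟨c, d, le_rfl, le_rfl, hcd, hno, hj⟩
  obtain ⟨y0, hy0, hy0A⟩ := hj
  obtain ⟨x, hx, hxA⟩ := Set.not_subset.mp (hno j)
  obtain ⟨i, hi⟩ := hcov x (by linarith [hx.1]) (by linarith [hx.2])
  have hij : i ≠ j := fun h => hxA (h ▸ hi)
  rcases lt_or_ge y0 x with hlt | hge
  · have hK : IsCompact (A j ∩ Set.Icc c x) := isCompact_Icc.inter_left (hc j)
    have hne : (A j ∩ Set.Icc c x).Nonempty := ⟨y0, hy0A, hy0.1, hlt.le⟩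
    obtain ⟨y, hy⟩ := hK.exists_isGreatest hne
    have hyx : y < x := lt_of_le_of_ne hy.1.2.2 (fun h => hxA (h ▸ hy.1.1))
    have hyi : y ∉ A i := fun h => hij (hdis y (by linarith [hy.1.2.1]) (by linarith [hx.2]) _ _ h hy.1.1)
    obtain ⟨ε, hε, hb⟩ := Metric.isOpen_iff.mp (hc i).isOpen_compl y hyi
    have hx' : min x (y + ε / 2) ∉ A i := by
      apply hb
      rw [Metric.mem_ball, Real.dist_eq, abs_of_nonneg]
      · linarith [min_le_right x (y + ε / 2)]
      · have : y ≤ min x (y + ε / 2) := le_min hyx.le (by linarith)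
        linarith
    have hyl : y < min x (y + ε / 2) := lt_min hyx (by linarith)
    have hle : min x (y + ε / 2) ≤ x := min_le_left _ _
    refine ⟨min x (y + ε / 2), x, by linarith [hy.1.2.1], hx.2, hle, ?_, ?_⟩
    · intro i' hs
      have h3 := hs ⟨hle, le_rfl⟩
      have : i' = i := hdis x (by linarith [hx.1]) (by linarith [hx.2]) _ _ h3 hi
      subst this
      exact hx' (hs ⟨le_rfl, hle⟩)
    · intro w hw hwA
      have := hy.2 ⟨hwA, by linarith [hw.1, hy.1.2.1], hw.2⟩
      linarith [hw.1]
  · have hlt : x < y0 := lt_of_le_of_ne hge (fun h => hxA (h ▸ hy0A))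
    have hK : IsCompact (A j ∩ Set.Icc x d) := isCompact_Icc.inter_left (hc j)
    have hne : (A j ∩ Set.Icc x d).Nonempty := ⟨y0, hy0A, hlt.le, hy0.2⟩
    obtain ⟨y, hy⟩ := hK.exists_isLeast hne
    have hyx : x < y := lt_of_le_of_ne hy.1.2.1 (fun h => hxA (h ▸ hy.1.1))
    have hyi : y ∉ A i := fun h => hij (hdis y (by linarith [hx.1]) (by linarith [hy.1.2.2]) _ _ h hy.1.1)
    obtain ⟨ε, hε, hb⟩ := Metric.isOpen_iff.mp (hc i).isOpen_compl y hyi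
    have hx' : max x (y - ε / 2) ∉ A i := by
      apply hb
      rw [Metric.mem_ball, Real.dist_eq, abs_of_nonpos]
      · linarith [le_max_right x (y - ε / 2)]
      · have : max x (y - ε / 2) ≤ y := max_le hyx.le (by linarith)
        linarith
    have hyl : max x (y - ε / 2) < y := max_lt hyx (by linarith)
    have hle : x ≤ max x (y - ε / 2) := le_max_left _ _
    refine ⟨x, max x (y - ε / 2), hx.1, by linarith [hy.1.2.2], hle, ?_, ?_⟩
    · intro i' hs
      have h3 := hs ⟨le_rfl, hle⟩
      have : i' = i := hdis x (by linarith [hx.1]) (by linarith [hx.2]) _ _ h3 hi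
      subst this
      exact hx' (hs ⟨hle, le_rfl⟩)
    · intro w hw hwA
      have := hy.2 ⟨hwA, hw.1, by linarith [hw.2, hy.1.2.2]⟩
      linarith [hw.2]

theorem sierp_Icc (A : ℕ → Set ℝ) (hc : ∀ k, IsClosed (A k))
    (hcov : ∀ x, -1 < x → x < 1 → ∃ k, x ∈ A k)
    (hdis : ∀ x, -1 < x → x < 1 → ∀ k l, x ∈ A k → x ∈ A l → k = l)
    (c d : ℝ) (h1 : -1 < c) (h2 : d < 1) (hcd : c ≤ d) : ∃ i, Set.Icc c d ⊆ A i := by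
  by_contra hno
  push Not at hno
  let P := {p : ℝ × ℝ // -1 < p.1 ∧ p.2 < 1 ∧ p.1 ≤ p.2 ∧ ∀ i, ¬ Set.Icc p.1 p.2 ⊆ A i}
  have step : ∀ (j : ℕ) (p : P), ∃ q : P, p.1.1 ≤ q.1.1 ∧ q.1.2 ≤ p.1.2 ∧
      ∀ x ∈ Set.Icc q.1.1 q.1.2, x ∉ A j := by
    rintro j ⟨⟨a, b⟩, ha, hb, hab, hn⟩
    obtain ⟨c', d', g1, g2, g3, g4, g5⟩ := sierp_step A hc hcov hdis a b ha hb hab hn j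
    exact ⟨⟨(c', d'), lt_of_lt_of_le ha g1, lt_of_le_of_lt g2 hb, g3, g4⟩, g1, g2, g5⟩
  choose nx hn1 hn2 hn3 using step
  let s : ℕ → P := fun n => Nat.rec ⟨(c, d), h1, h2, hcd, hno⟩ (fun j p => nx j p) n
  have hs : ∀ n, s (n + 1) = nx n (s n) := fun n => rfl
  have hne := IsCompact.nonempty_iInter_of_sequence_nonempty_isCompact_isClosed
    (fun n => Set.Icc (s n).1.1 (s n).1.2)
    (fun n => by
      show Set.Icc (s (n+1)).1.1 (s (n+1)).1.2 ⊆ _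
      rw [hs]; exact Set.Icc_subset_Icc (hn1 _ _) (hn2 _ _))
    (fun n => Set.nonempty_Icc.mpr (s n).2.2.2.1) isCompact_Icc (fun n => isClosed_Icc)
  obtain ⟨x, hx⟩ := hne
  rw [Set.mem_iInter] at hx
  have hx0 := hx 0
  obtain ⟨k, hk⟩ := hcov x (lt_of_lt_of_le (s 0).2.1 hx0.1) (lt_of_le_of_lt hx0.2 (s 0).2.2.1)
  have := hx (k + 1)
  exact hn3 k (s k) x this hk

theorem sierp (A : ℕ → Set ℝ) (hc : ∀ k, IsClosed (A k))
    (hcov : ∀ x, -1 < x → x < 1 → ∃ k, x ∈ A k)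
    (hdis : ∀ x, -1 < x → x < 1 → ∀ k l, x ∈ A k → x ∈ A l → k = l) :
    ∃ i, Set.Icc (-1) 1 ⊆ A i := by
  obtain ⟨i, hi⟩ := hcov 0 (by norm_num) (by norm_num)
  refine ⟨i, ?_⟩
  have : Set.Ioo (-1 : ℝ) 1 ⊆ A i := by
    intro x hx
    obtain ⟨j, hj⟩ := sierp_Icc A hc hcov hdis (min x 0) (max x 0) (lt_min hx.1 (by norm_num))
      (max_lt hx.2 (by norm_num)) (min_le_max)
    have h0 : (0 : ℝ) ∈ A j := hj ⟨min_le_right _ _, le_max_right _ _⟩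
    have hxj : x ∈ A j := hj ⟨min_le_left _ _, le_max_left _ _⟩
    rwa [hdis 0 (by norm_num) (by norm_num) _ _ hi h0]
  have h2 := closure_minimal this (hc i)
  rwa [closure_Ioo (by norm_num)] at h2

theorem same_circle_eq {F : Z → Z} (H : Hyp F) {k m : ℕ} {a s b t c r c' r' : ℝ}
    (h1 : a ^ 2 + s ^ 2 = 1) (h2 : b ^ 2 + t ^ 2 = 1) (h3 : c ^ 2 + r ^ 2 = 1)
    (h4 : c' ^ 2 + r' ^ 2 = 1) (hu : F (cp k a s) = cp m c r) (hv : F (cp k b t) = cp m c' r') :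
    c * c' + r * r' = a * b + s * t := by
  have n1 := cp_norm_one (k := k) h1
  have n2 := cp_norm_one (k := k) h2
  have d1 := H.lip _ _ n1 n2
  have hneg := F_ext_neg H n2 (by rw [hv]; exact cp_ext h4)
  have d2 := H.lip (cp k a s) (-cp k b t) n1 (by rwa [norm_neg])
  rw [hneg, hu, hv, cp_neg, cp_neg] at d2
  rw [hu, hv] at d1
  have d1 := pow_le_pow_left₀ (norm_nonneg _) d1 2
  have d2 := pow_le_pow_left₀ (norm_nonneg _) d2 2
  simp only [cp_dist_same] at d1 d2
  nlinarith

theorem same_circle_ne {F : Z → Z} (H : Hyp F) {k m m' : ℕ} {a s b t c r c' r' : ℝ}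
    (h1 : a ^ 2 + s ^ 2 = 1) (h2 : b ^ 2 + t ^ 2 = 1) (h3 : c ^ 2 + r ^ 2 = 1)
    (h4 : c' ^ 2 + r' ^ 2 = 1) (hu : F (cp k a s) = cp m c r) (hv : F (cp k b t) = cp m' c' r')
    (hm : m ≠ m') : c = 0 ∨ c' = 0 := by
  have n1 := cp_norm_one (k := k) h1
  have n2 := cp_norm_one (k := k) h2
  have d1 := H.lip _ _ n1 n2
  have hneg := F_ext_neg H n2 (by rw [hv]; exact cp_ext h4)
  have d2 := H.lip (cp k a s) (-cp k b t) n1 (by rwa [norm_neg])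
  rw [hneg, hu, hv, cp_neg, cp_neg] at d2
  rw [hu, hv] at d1
  have d1 := pow_le_pow_left₀ (norm_nonneg _) d1 2
  have d2 := pow_le_pow_left₀ (norm_nonneg _) d2 2
  simp only [cp_dist_same, cp_dist_ne hm, abs_neg] at d1 d2
  have e1 := sq_abs c
  have e2 := sq_abs c'
  have : |c| * |c'| ≤ 0 := by nlinarith
  have h5 := le_antisymm this (by positivity)
  rcases mul_eq_zero.mp h5 with h | h
  · left; exact abs_eq_zero.mp h
  · right; exact abs_eq_zero.mp h

theorem F_cont {F : Z → Z} (H : Hyp F) : ContinuousOn F {p | ‖p‖ ≤ 1} := by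
  have : LipschitzOnWith 1 F {p | ‖p‖ ≤ 1} := by
    apply LipschitzOnWith.of_dist_le_mul
    intro x hx y hy
    rw [dist_eq_norm, dist_eq_norm, NNReal.coe_one, one_mul]
    exact H.lip x y hx hy
  exact this.continuousOn

theorem circ_cont (k : ℕ) : Continuous (fun q : ℝ × ℝ => cp k q.1 q.2) := by
  unfold cp
  exact mk_cont ((sg_cont k).comp continuous_fst) continuous_snd

theorem circ_compact : IsCompact {q : ℝ × ℝ | q.1 ^ 2 + q.2 ^ 2 = 1} := by
  apply IsCompact.of_isClosed_subset (isCompact_Icc (a := ((-1 : ℝ), (-1 : ℝ))) (b := ((1 : ℝ), (1 : ℝ))))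
  · exact isClosed_eq (by fun_prop) (by fun_prop)
  · rintro ⟨a, b⟩ h
    simp only [Set.mem_ofPred_eq] at h
    refine ⟨⟨?_, ?_⟩, ⟨?_, ?_⟩⟩ <;> simp <;> nlinarith [sq_nonneg a, sq_nonneg b]

theorem good_circle {F : Z → Z} (H : Hyp F) (m : ℕ)
    (hg : ∀ a s, a ≠ 0 → a ^ 2 + s ^ 2 = 1 → F (cp 0 0 1) ≠ cp m a s) :
    ∃ k, ∀ a s, a ^ 2 + s ^ 2 = 1 → ∃ b t, b ^ 2 + t ^ 2 = 1 ∧ F (cp k b t) = cp m a s := by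
  have hun : ∀ x : ℝ, -1 ≤ x → x ≤ 1 → √(1 - x ^ 2) ^ 2 + x ^ 2 = 1 := by
    intro x h1 h2
    rw [Real.sq_sqrt (by nlinarith)]; ring
  have hsp : ∃ k, Set.Icc (-1 : ℝ) 1 ⊆ (fun x : ℝ => cp m (√(1 - x ^ 2)) x) ⁻¹'
      (F '' ((fun q : ℝ × ℝ => cp k q.1 q.2) '' {q : ℝ × ℝ | q.1 ^ 2 + q.2 ^ 2 = 1})) := by
    refine sierp (fun k => (fun x : ℝ => cp m (√(1 - x ^ 2)) x) ⁻¹'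
      (F '' ((fun q : ℝ × ℝ => cp k q.1 q.2) '' {q : ℝ × ℝ | q.1 ^ 2 + q.2 ^ 2 = 1}))) ?_ ?_ ?_
    · intro k
      apply IsClosed.preimage
      · have := circ_cont m
        exact this.comp (f := fun x : ℝ => (√(1 - x ^ 2), x)) (by fun_prop)
      · apply IsCompact.isClosed
        apply IsCompact.image_of_continuousOn
        · exact circ_compact.image (circ_cont k)
        · apply (F_cont H).mono
          rintro _ ⟨⟨b, t⟩, hbt, rfl⟩
          exact cp_norm_one hbt
    · intro x h1 h2
      have hx := hun x h1.le h2.le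
      obtain ⟨p, hp, hF⟩ := H.surj _ (cp_norm_one (k := m) hx)
      obtain ⟨k, b, t, hbt, rfl⟩ := ext_cp (F_ext_ext H hp (by rw [hF]; exact cp_ext hx))
      exact ⟨k, _, ⟨(b, t), hbt, rfl⟩, hF⟩
    · rintro x h1 h2 k l ⟨_, ⟨⟨b, t⟩, hbt, rfl⟩, hF⟩ ⟨_, ⟨⟨b', t'⟩, hbt', rfl⟩, hF'⟩
      have hx := hun x h1.le h2.le
      have hx0 : √(1 - x ^ 2) ≠ 0 := by
        apply (Real.sqrt_pos.mpr _).ne'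
        nlinarith
      simp only [Set.mem_ofPred_eq] at hbt hbt' hF hF'
      have heq := H.inj _ _ (cp_norm_one hbt) (cp_norm_one hbt') (hF.trans hF'.symm)
      by_contra hkl
      have hb : b = 0 := by
        by_contra hb
        exact hkl (cp_inj heq hb).1
      subst hb
      have ht : t = 1 ∨ t = -1 := by
        apply sq1; nlinarith
      rcases ht with rfl | rfl
      · rw [cp_pole k 0] at hF
        exact hg _ _ hx0 hx hF
      · have h3 := F_ext_neg H (cp_norm_one hbt) (by rw [hF]; exact cp_ext hx)
        rw [hF, cp_neg, cp_neg, neg_zero, neg_neg, cp_pole k 0] at h3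
        exact hg (-√(1 - x ^ 2)) (-x) (neg_ne_zero.mpr hx0) (by rw [neg_sq, neg_sq]; exact hx) h3
  obtain ⟨k, hk⟩ := hsp
  · refine ⟨k, ?_⟩
    have hpos : ∀ a s, 0 ≤ a → a ^ 2 + s ^ 2 = 1 → ∃ b t, b ^ 2 + t ^ 2 = 1 ∧ F (cp k b t) = cp m a s := by
      intro a s ha h
      obtain ⟨_, ⟨⟨b, t⟩, hbt, rfl⟩, hF⟩ := hk (show s ∈ Set.Icc (-1 : ℝ) 1 by constructor <;> nlinarith)
      have : √(1 - s ^ 2) = a := by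
        rw [show 1 - s ^ 2 = a ^ 2 by linarith, Real.sqrt_sq ha]
      simp only [this] at hF
      exact ⟨b, t, hbt, hF⟩
    intro a s h
    rcases le_total 0 a with ha | ha
    · exact hpos a s ha h
    · obtain ⟨b, t, hbt, hF⟩ := hpos (-a) (-s) (by linarith) (by nlinarith)
      refine ⟨-b, -t, by nlinarith, ?_⟩
      rw [← cp_neg, F_ext_neg H (cp_norm_one hbt), hF, cp_neg, neg_neg, neg_neg]
      rw [hF]; apply cp_ext; nlinarith

theorem F_pole {F : Z → Z} (H : Hyp F) : ∃ δ : ℝ, δ ^ 2 = 1 ∧ F (cp 0 0 δ) = cp 0 0 1 := by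
  have two : ∃ m m', m ≠ m' ∧ (∀ a s, a ≠ 0 → a ^ 2 + s ^ 2 = 1 → F (cp 0 0 1) ≠ cp m a s) ∧
      (∀ a s, a ≠ 0 → a ^ 2 + s ^ 2 = 1 → F (cp 0 0 1) ≠ cp m' a s) := by
    by_cases hb : ∃ n a s, a ≠ 0 ∧ F (cp 0 0 1) = cp n a s
    · obtain ⟨n, a, s, ha, h⟩ := hb
      refine ⟨n + 1, n + 2, by omega, ?_, ?_⟩
      · intro b t hb _ h'
        have := (cp_inj (h.symm.trans h') ha).1
        omega
      · intro b t hb _ h'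
        have := (cp_inj (h.symm.trans h') ha).1
        omega
    · push Not at hb
      exact ⟨0, 1, by omega, fun a s ha _ => hb 0 a s ha, fun a s ha _ => hb 1 a s ha⟩
  obtain ⟨m, m', hm, g1, g2⟩ := two
  obtain ⟨k, hk⟩ := good_circle H m g1
  obtain ⟨k', hk'⟩ := good_circle H m' g2
  have hkk : k ≠ k' := by
    rintro rfl
    obtain ⟨b, t, hbt, hF⟩ := hk 1 0 (by norm_num)
    obtain ⟨b', t', hbt', hF'⟩ := hk' 1 0 (by norm_num)
    have := same_circle_ne H hbt hbt' (by norm_num) (by norm_num) hF hF' hm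
    norm_num at this
  obtain ⟨b, t, hbt, hF⟩ := hk 0 1 (by norm_num)
  obtain ⟨b', t', hbt', hF'⟩ := hk' 0 1 (by norm_num)
  rw [cp_pole m 0] at hF
  rw [cp_pole m' 0] at hF'
  have heq := H.inj _ _ (cp_norm_one hbt) (cp_norm_one hbt') (hF.trans hF'.symm)
  have hb : b = 0 := by
    by_contra hb
    exact hkk (cp_inj heq hb).1
  subst hb
  rw [cp_pole k 0] at hF
  exact ⟨t, by nlinarith, hF⟩

theorem F_discs {F : Z → Z} (H : Hyp F) : ∃ (δ : ℝ) (σ : ℕ → ℕ) (ε : ℕ → ℝ), |δ| = 1 ∧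
    Function.Injective σ ∧ (∀ m, |ε m| = 1) ∧
    ∀ m a s, a ^ 2 + s ^ 2 ≤ 1 → F (cp (σ m) (ε m * a) (δ * s)) = cp m a s := by
  obtain ⟨δ, hδ, hpole⟩ := F_pole H
  have good : ∀ m a s, a ≠ 0 → a ^ 2 + s ^ 2 = 1 → F (cp 0 0 1) ≠ cp m a s := by
    intro m a s ha _ h
    rcases (sq1 hδ) with rfl | rfl
    · rw [hpole] at h
      exact ha (cp_inj h.symm ha).2.1
    · have h3 := F_ext_neg H (cp_norm_one (k := 0) (a := 0) (s := -1) (by norm_num))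
        (by rw [hpole]; apply cp_ext; norm_num)
      rw [hpole, cp_neg, cp_neg, neg_zero, neg_neg, h] at h3
      exact ha (cp_inj h3 ha).2.1
  have hex := fun m => good_circle H m (good m)
  choose σ hσ using hex
  have hδ2 : |δ| = 1 := by rw [← sq_eq_sq₀ (abs_nonneg _) zero_le_one, sq_abs, hδ, one_pow]
  have lat : ∀ m a s b t, a ^ 2 + s ^ 2 = 1 → b ^ 2 + t ^ 2 = 1 → F (cp (σ m) b t) = cp m a s →
      t = δ * s := by
    intro m a s b t h1 h2 h
    have hp := hpole
    rw [cp_pole 0 (σ m), cp_pole 0 m] at hp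
    have := same_circle_eq H (by nlinarith) h2 (by norm_num) h1 hp h
    have h3 : s = δ * t := by linarith
    rw [h3, ← mul_assoc, ← sq, hδ, one_mul]
  have he : ∀ m, ∃ e : ℝ, e ^ 2 = 1 ∧ F (cp (σ m) e 0) = cp m 1 0 := by
    intro m
    obtain ⟨b, t, hbt, hF⟩ := hσ m 1 0 (by norm_num)
    have ht := lat m 1 0 b t (by norm_num) hbt hF
    rw [mul_zero] at ht
    subst ht
    exact ⟨b, by nlinarith, hF⟩
  choose ε hε hεF using he
  have hcirc : ∀ m a s, a ^ 2 + s ^ 2 = 1 → F (cp (σ m) (ε m * a) (δ * s)) = cp m a s := by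
    intro m a s h
    obtain ⟨b, t, hbt, hF⟩ := hσ m a s h
    have ht := lat m a s b t h hbt hF
    have := same_circle_eq H (by rw [hε m]; norm_num) hbt (by norm_num) h (hεF m) hF
    have h3 : a = ε m * b := by linarith
    rw [h3, ← mul_assoc, ← sq, hε, one_mul, ← ht, hF, h3]
  refine ⟨δ, σ, ε, hδ2, ?_, ?_, ?_⟩
  · intro m m' h
    by_contra hm
    have h1 := hεF m
    have h2 := hεF m'
    rw [← h] at h2
    have := same_circle_ne H (by rw [hε m]; norm_num) (by rw [hε m']; norm_num)
      (by norm_num) (by norm_num) h1 h2 hm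
    norm_num at this
  · intro m
    rw [← sq_eq_sq₀ (abs_nonneg _) zero_le_one, sq_abs, hε, one_pow]
  · intro m a s h
    by_cases h0 : a ^ 2 + s ^ 2 = 0
    · have ha : a = 0 := by nlinarith [sq_nonneg a, sq_nonneg s]
      have hs : s = 0 := by nlinarith [sq_nonneg a, sq_nonneg s]
      subst ha hs
      simp only [mul_zero]
      rw [cp, sg_zero, mk_zero, F_zero H, cp, sg_zero, mk_zero]
    · have hpos : 0 < a ^ 2 + s ^ 2 := lt_of_le_of_ne (by positivity) (Ne.symm h0)
      set r := √(a ^ 2 + s ^ 2) with hr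
      have hr0 : 0 < r := Real.sqrt_pos.mpr hpos
      have hrsq : r ^ 2 = a ^ 2 + s ^ 2 := Real.sq_sqrt hpos.le
      have hr1 : r ≤ 1 := by nlinarith
      have hu : (a / r) ^ 2 + (s / r) ^ 2 = 1 := by
        rw [div_pow, div_pow, ← add_div, ← hrsq, div_self (by positivity)]
      have h3 := hcirc m (a / r) (s / r) hu
      have hn : (ε m * (a / r)) ^ 2 + (δ * (s / r)) ^ 2 = 1 := by
        rw [mul_pow, mul_pow, hε, hδ, one_mul, one_mul, hu]
      have h4 := F_ext_smul H (cp_norm_one hn) (by rw [h3]; exact cp_ext hu) hr0.le hr1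
      rw [h3, cp_smul, cp_smul] at h4
      rw [show r * (ε m * (a / r)) = ε m * a by field_simp, show r * (δ * (s / r)) = δ * s by field_simp,
        show r * (a / r) = a by field_simp, show r * (s / r) = s by field_simp] at h4
      exact h4

theorem le_sqX {a b : ℝ} (hb : 0 ≤ b) (h : a ^ 2 ≤ b ^ 2) : a ≤ b := by nlinarith

theorem exists_T2 {F : Z → Z} (H : Hyp F) : ∃ T : Z →ₗᵢ[ℝ] Z,
    ∀ m a s, a ^ 2 + s ^ 2 ≤ 1 → F (T (cp m a s)) = cp m a s := by
  obtain ⟨δ, σ, ε, hδ, hσ, hε, hF⟩ := F_discs H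
  obtain ⟨T, hT, hT2⟩ := exists_T σ hσ ε hε
  let L : Z →ₗ[ℝ] Z :=
    { toFun := fun p => mk (T p.fst) (δ * p.snd)
      map_add' := by
        intro p q
        rw [mk_add, WithLp.add_fst, WithLp.add_snd, map_add, mul_add]
      map_smul' := by
        intro c p
        rw [RingHom.id_apply, mk_smul, WithLp.smul_fst, WithLp.smul_snd, map_smul, smul_eq_mul]
        congr 1; ring }
  have hL : ∀ x s, L (mk x s) = mk (T x) (δ * s) := fun x s => rfl
  refine ⟨⟨L, ?_⟩, ?_⟩
  · intro p
    rw [mk_eta p, hL, ← sq_eq_sq₀ (norm_nonneg _) (norm_nonneg _), mk_norm, mk_norm, hT, mul_pow,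
      ← sq_abs δ, hδ]
    ring
  · intro m a s h
    have : L (cp m a s) = cp (σ m) (ε m * a) (δ * s) := by
      rw [cp, hL, hT2, cp]
    change F (L (cp m a s)) = _
    rw [this]
    exact hF m a s h

theorem coord_le (x y : Ell1) (s t : ℝ) (i : ℕ) : |x i - y i| ≤ ‖mk x s - mk y t‖ := by
  rw [mk_sub, ← sub_ap]
  refine (ap_le _ i).trans ?_
  refine le_sqX (by positivity) ?_
  rw [mk_norm]; nlinarith [sq_nonneg (s - t)]

theorem fix_one {F : Z → Z} (H : Hyp F) (T : Z →ₗᵢ[ℝ] Z) {x z : Ell1} {s r : ℝ}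
    (hn : ‖mk x s‖ ≤ 1) (hz : F (T (mk x s)) = mk z r) (m : ℕ)
    (hfix : F (T (mk (x - sg m (x m)) s)) = mk (x - sg m (x m)) s) :
    (‖z - x‖ - |z m - x m| + |z m|) ^ 2 + (r - s) ^ 2 ≤ |x m| ^ 2 := by
  have hn2 : ‖mk (x - sg m (x m)) s‖ ≤ 1 := by
    refine le_trans (mk_norm_le_norm.mpr ?_) hn
    have h1 := norm_sub_sg x m (x m)
    have h2 := norm_nonneg (x - sg m (x m))
    simp at h1
    nlinarith [abs_nonneg (x m)]
  have h := H.lip _ _ (by rw [T.norm_map]; exact hn) (by rw [T.norm_map]; exact hn2)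
  rw [hz, hfix, ← map_sub, T.norm_map, mk_sub, mk_sub, mk_norm_le_norm] at h
  have e1 : z - (x - sg m (x m)) = (z - x) + sg m (x m) := by abel
  have e2 : x - (x - sg m (x m)) = sg m (x m) := by abel
  rw [e1, e2, norm_add_sg, norm_sg, sub_ap] at h
  simpa using h

theorem fix_one' {F : Z → Z} (H : Hyp F) (T : Z →ₗᵢ[ℝ] Z) {x z : Ell1} {s r : ℝ}
    (hn : ‖mk x s‖ ≤ 1) (hz : F (T (mk x s)) = mk z r) (m : ℕ)
    (hfix : F (T (mk (x - sg m (x m)) s)) = mk (x - sg m (x m)) s) :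
    ‖z - x‖ - |z m - x m| + |z m| ≤ |x m| ∧ ‖z - x‖ ≤ 2 * |z m - x m| := by
  have h := fix_one H T hn hz m hfix
  have h1 : ‖z - x‖ - |z m - x m| + |z m| ≤ |x m| := by
    refine le_sqX (by positivity) ?_
    nlinarith [sq_nonneg (r - s)]
  refine ⟨h1, ?_⟩
  have h2 : |x m| ≤ |z m| + |z m - x m| := by
    have := abs_sub_abs_le_abs_sub (x m) (z m)
    rw [abs_sub_comm] at this
    linarith
  linarith

theorem fix_three {F : Z → Z} (H : Hyp F) (T : Z →ₗᵢ[ℝ] Z) {x : Ell1} {s : ℝ}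
    (hn : ‖mk x s‖ ≤ 1) {i j k : ℕ} (hij : i ≠ j) (hik : i ≠ k) (hjk : j ≠ k)
    (hfix : ∀ m, m = i ∨ m = j ∨ m = k →
      F (T (mk (x - sg m (x m)) s)) = mk (x - sg m (x m)) s) :
    F (T (mk x s)) = mk x s := by
  obtain ⟨z, r, hz⟩ : ∃ z r, F (T (mk x s)) = mk z r := ⟨_, _, mk_eta _⟩
  have h1 := (fix_one' H T hn hz i (hfix i (by simp))).2
  have h2 := (fix_one' H T hn hz j (hfix j (by simp))).2
  have h3 := (fix_one' H T hn hz k (hfix k (by simp))).2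
  have h4 := ap_le3 (z - x) hij hik hjk
  simp only [sub_ap] at h4
  have h5 : ‖z - x‖ = 0 := le_antisymm (by linarith) (norm_nonneg _)
  have h6 : z = x := sub_eq_zero.mp (norm_eq_zero.mp h5)
  subst h6
  have h7 := fix_one H T hn hz i (hfix i (by simp))
  simp at h7
  have h8 : r = s := by nlinarith
  rw [hz, h8]

noncomputable def Pt (e₁ e₂ : ℝ) (i j : ℕ) (α β s : ℝ) : Z := mk (sg i (e₁ * α) + sg j (e₂ * β)) s

theorem two_norm {i j : ℕ} (hij : i ≠ j) (a b : ℝ) : ‖sg i a + sg j b‖ = |a| + |b| := by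
  rw [norm_add_sg, norm_sg, sg_ne _ hij.symm]; simp

theorem Pt_norm {e₁ e₂ : ℝ} (h1 : |e₁| = 1) (h2 : |e₂| = 1) {i j : ℕ} (hij : i ≠ j) (α β s : ℝ) :
    ‖Pt e₁ e₂ i j α β s‖ ^ 2 = (|α| + |β|) ^ 2 + s ^ 2 := by
  rw [Pt, mk_norm, two_norm hij, abs_mul, abs_mul, h1, h2, one_mul, one_mul]

theorem Pt_norm_le {e₁ e₂ : ℝ} (h1 : |e₁| = 1) (h2 : |e₂| = 1) {i j : ℕ} (hij : i ≠ j) {α β s r : ℝ}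
    (hα : 0 ≤ α) (hβ : 0 ≤ β) (hr : 0 ≤ r) :
    ‖Pt e₁ e₂ i j α β s‖ ≤ r ↔ (α + β) ^ 2 + s ^ 2 ≤ r ^ 2 := by
  rw [← sq_le_sq₀ (norm_nonneg _) hr, Pt_norm h1 h2 hij, abs_of_nonneg hα, abs_of_nonneg hβ]

theorem Pt_sub (e₁ e₂ : ℝ) (i j : ℕ) (α β s α' β' s' : ℝ) :
    Pt e₁ e₂ i j α β s - Pt e₁ e₂ i j α' β' s' = Pt e₁ e₂ i j (α - α') (β - β') (s - s') := by
  rw [Pt, Pt, Pt, mk_sub, mul_sub, mul_sub, sg_sub, sg_sub]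
  congr 1; abel

theorem Pt_smul (e₁ e₂ : ℝ) (i j : ℕ) (c α β s : ℝ) :
    c • Pt e₁ e₂ i j α β s = Pt e₁ e₂ i j (c * α) (c * β) (c * s) := by
  rw [Pt, Pt, mk_smul, smul_add, ← sg_smul, ← sg_smul,
    show c * (e₁ * α) = e₁ * (c * α) by ring, show c * (e₂ * β) = e₂ * (c * β) by ring]

theorem Pt_zero (e₁ e₂ : ℝ) (i j : ℕ) : Pt e₁ e₂ i j 0 0 0 = 0 := by
  rw [Pt, mul_zero, mul_zero, sg_zero, sg_zero, add_zero, mk_zero]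

theorem Pt_fst_i {e₁ : ℝ} (e₂ : ℝ) (h1 : |e₁| = 1) {i j : ℕ} (hij : i ≠ j) (α β s : ℝ) :
    e₁ * (Pt e₁ e₂ i j α β s).fst i = α := by
  change e₁ * (sg i (e₁ * α) + sg j (e₂ * β)) i = α
  rw [add_ap, sg_self, sg_ne _ hij, add_zero, ← mul_assoc, ← sq, ← sq_abs, h1]; ring

theorem Pt_fst_j (e₁ : ℝ) {e₂ : ℝ} (h2 : |e₂| = 1) {i j : ℕ} (hij : i ≠ j) (α β s : ℝ) :
    e₂ * (Pt e₁ e₂ i j α β s).fst j = β := by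
  change e₂ * (sg i (e₁ * α) + sg j (e₂ * β)) j = β
  rw [add_ap, sg_self, sg_ne _ hij.symm, zero_add, ← mul_assoc, ← sq, ← sq_abs, h2]; ring

theorem Pt_inj {e₁ e₂ : ℝ} (h1 : |e₁| = 1) (h2 : |e₂| = 1) {i j : ℕ} (hij : i ≠ j)
    {α β s α' β' s' : ℝ} (h : Pt e₁ e₂ i j α β s = Pt e₁ e₂ i j α' β' s') :
    α = α' ∧ β = β' ∧ s = s' := by
  refine ⟨?_, ?_, (mk_inj h).2⟩
  · rw [← Pt_fst_i e₂ h1 hij α β s, h, Pt_fst_i e₂ h1 hij]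
  · rw [← Pt_fst_j e₁ h2 hij α β s, h, Pt_fst_j e₁ h2 hij]

theorem sgn_aux {e α u z : ℝ} (he : |e| = 1) (h1 : |z| ≤ α - u) (h2 : |z - e * α| = u) :
    z = e * (α - u) := by
  rcases sq1 (by rw [← sq_abs, he, one_pow] : e ^ 2 = 1) with rfl | rfl
  · have := abs_le.mp h1
    have := neg_abs_le (z - 1 * α)
    linarith
  · have := abs_le.mp h1
    have := le_abs_self (z - -1 * α)
    linarith

theorem two_form {F : Z → Z} (H : Hyp F) (T : Z →ₗᵢ[ℝ] Z)
    (hT : ∀ m a s, a ^ 2 + s ^ 2 ≤ 1 → F (T (cp m a s)) = cp m a s)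
    {e₁ e₂ : ℝ} (h1 : |e₁| = 1) (h2 : |e₂| = 1) {i j : ℕ} (hij : i ≠ j) {α β s : ℝ}
    (hα : 0 ≤ α) (hβ : 0 ≤ β) (hn : (α + β) ^ 2 + s ^ 2 ≤ 1) :
    ∃ u, 0 ≤ u ∧ u ≤ α ∧ u ≤ β ∧
      F (T (Pt e₁ e₂ i j α β s)) = Pt e₁ e₂ i j (α - u) (β - u) s := by
  have s1 : e₁ ^ 2 = 1 := by rw [← sq_abs, h1, one_pow]
  have s2 : e₂ ^ 2 = 1 := by rw [← sq_abs, h2, one_pow]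
  have hN : ‖Pt e₁ e₂ i j α β s‖ ≤ 1 :=
    (Pt_norm_le h1 h2 hij hα hβ zero_le_one).mpr (by rw [one_pow]; exact hn)
  obtain ⟨z, r, hz⟩ : ∃ z r, F (T (Pt e₁ e₂ i j α β s)) = mk z r := ⟨_, _, mk_eta _⟩
  rw [Pt] at hN hz ⊢
  set x := sg i (e₁ * α) + sg j (e₂ * β) with hx
  have xi : x i = e₁ * α := by rw [hx, add_ap, sg_self, sg_ne _ hij, add_zero]
  have xj : x j = e₂ * β := by rw [hx, add_ap, sg_self, sg_ne _ hij.symm, zero_add]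
  have fi : F (T (mk (x - sg i (x i)) s)) = mk (x - sg i (x i)) s := by
    rw [xi, hx, add_sub_cancel_left]
    apply hT
    rw [mul_pow, s2]; nlinarith
  have fj : F (T (mk (x - sg j (x j)) s)) = mk (x - sg j (x j)) s := by
    rw [xj, hx, add_sub_cancel_right]
    apply hT
    rw [mul_pow, s1]; nlinarith
  obtain ⟨i1, i2⟩ := fix_one' H T hN hz i fi
  obtain ⟨j1, j2⟩ := fix_one' H T hN hz j fj
  have i3 := fix_one H T hN hz i fi
  have hs := ap_le2 (z - x) hij
  simp only [sub_ap] at hs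
  rw [xi] at i1 i2 i3 hs
  rw [xj] at j1 j2 hs
  rw [abs_mul, h1, one_mul, abs_of_nonneg hα] at i1 i3
  rw [abs_mul, h2, one_mul, abs_of_nonneg hβ] at j1
  set D := ‖z - x‖ with hD
  have ui : |z i - e₁ * α| = D / 2 := by linarith
  have uj : |z j - e₂ * β| = D / 2 := by linarith
  rw [ui] at i1 i3
  rw [uj] at j1
  have zi := sgn_aux h1 (show |z i| ≤ α - D / 2 by linarith) ui
  have zj := sgn_aux h2 (show |z j| ≤ β - D / 2 by linarith) uj
  have hD0 : 0 ≤ D := norm_nonneg _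
  have hα' : D / 2 ≤ α := by linarith [abs_nonneg (z i)]
  have hβ' : D / 2 ≤ β := by linarith [abs_nonneg (z j)]
  refine ⟨D / 2, by linarith, hα', hβ', ?_⟩
  have hzi : |z i| = α - D / 2 := by
    rw [zi, abs_mul, h1, one_mul, abs_of_nonneg (by linarith)]
  rw [hzi] at i3
  have hr : r = s := by nlinarith
  have hzz : z = sg i (e₁ * (α - D / 2)) + sg j (e₂ * (β - D / 2)) := by
    apply l1_ext
    intro k
    rw [add_ap]
    by_cases hki : k = i
    · subst hki; rw [sg_self, sg_ne _ hij, zi, add_zero]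
    by_cases hkj : k = j
    · subst hkj; rw [sg_self, sg_ne _ hij.symm, zj, zero_add]
    have h3 := ap_le3 (z - x) hij (Ne.symm hki) (Ne.symm hkj)
    simp only [sub_ap] at h3
    rw [xi, xj, ui, uj] at h3
    have xk : x k = 0 := by rw [hx, add_ap, sg_ne _ hki, sg_ne _ hkj, add_zero]
    rw [xk] at h3
    have h4 : |z k - 0| = 0 := le_antisymm (by linarith) (abs_nonneg _)
    rw [sub_zero, abs_eq_zero] at h4
    rw [h4, sg_ne _ hki, sg_ne _ hkj, add_zero]
  rw [hz, hr, Pt, hzz]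

theorem box_sgn {e α w : ℝ} (he : |e| = 1) (hα : 0 ≤ α) (h : |w| + |e * α - w| ≤ |e * α|) :
    0 ≤ e * w := by
  rw [abs_mul, he, one_mul, abs_of_nonneg hα] at h
  rcases sq1 (by rw [← sq_abs, he, one_pow] : e ^ 2 = 1) with rfl | rfl
  · have := le_abs_self (1 * α - w)
    have := abs_nonneg w
    linarith
  · have := neg_abs_le (-1 * α - w)
    have := abs_nonneg w
    linarith

theorem two_geod {e₁ e₂ : ℝ} (h1 : |e₁| = 1) (h2 : |e₂| = 1) {i j : ℕ} (hij : i ≠ j) {α β s l : ℝ}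
    (hα : 0 ≤ α) (hβ : 0 ≤ β) (hn : (α + β) ^ 2 + s ^ 2 = 1) (hl0 : 0 ≤ l) (hl1 : l ≤ 1) (q : Z)
    (hq : ‖q‖ ≤ l) (hq2 : ‖Pt e₁ e₂ i j α β s - q‖ ≤ 1 - l) :
    ∃ α' β' r, 0 ≤ α' ∧ 0 ≤ β' ∧ q = Pt e₁ e₂ i j α' β' r := by
  have s1 : e₁ ^ 2 = 1 := by rw [← sq_abs, h1, one_pow]
  have s2 : e₂ ^ 2 = 1 := by rw [← sq_abs, h2, one_pow]
  rw [mk_eta q] at hq hq2 ⊢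
  generalize q.fst = w at *
  generalize q.snd = r at *
  rw [Pt] at hq2
  set z := sg i (e₁ * α) + sg j (e₂ * β) with hz
  have hzn : ‖z‖ = α + β := by
    rw [hz, two_norm hij, abs_mul, abs_mul, h1, h2, abs_of_nonneg hα, abs_of_nonneg hβ]; ring
  rw [mk_norm_le hl0] at hq
  rw [mk_sub, mk_norm_le (by linarith)] at hq2
  have t1 := cp_norm (k := 0) hq hl0
  have t2 := cp_norm (k := 0) hq2 (by linarith)
  have t3 := norm_add_le (cp 0 ‖w‖ r) (cp 0 ‖z - w‖ (s - r))
  have t4 : ‖cp 0 ‖w‖ r + cp 0 ‖z - w‖ (s - r)‖ ≤ 1 := by linarith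
  rw [cp, cp, mk_add, ← sg_add, mk_norm_le_one, norm_sg, sq_abs] at t4
  have t5 : ‖w‖ + ‖z - w‖ ≤ ‖z‖ := by
    rw [hzn]
    refine le_sqX (by positivity) ?_
    · nlinarith
  have hb := box t5
  have zi : z i = e₁ * α := by rw [hz, add_ap, sg_self, sg_ne _ hij, add_zero]
  have zj : z j = e₂ * β := by rw [hz, add_ap, sg_self, sg_ne _ hij.symm, zero_add]
  refine ⟨e₁ * w i, e₂ * w j, r, box_sgn h1 hα (by rw [← zi]; exact hb i),
    box_sgn h2 hβ (by rw [← zj]; exact hb j), ?_⟩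
  rw [Pt]
  congr 1
  apply l1_ext
  intro k
  rw [add_ap, ← mul_assoc, ← sq, s1, ← mul_assoc, ← sq, s2, one_mul, one_mul]
  by_cases hki : k = i
  · subst hki; rw [sg_self, sg_ne _ hij, add_zero]
  by_cases hkj : k = j
  · subst hkj; rw [sg_self, sg_ne _ hij.symm, zero_add]
  have h3 := hb k
  have zk : z k = 0 := by rw [hz, add_ap, sg_ne _ hki, sg_ne _ hkj, add_zero]
  rw [zk, abs_zero] at h3
  have h4 : |w k| = 0 := le_antisymm (by linarith [abs_nonneg (0 - w k)]) (abs_nonneg _)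
  rw [abs_eq_zero.mp h4, sg_ne _ hki, sg_ne _ hkj, add_zero]

theorem ar_v {α β v s : ℝ} (hα : 0 ≤ α) (hβ : 0 ≤ β) (hv : 0 ≤ v)
    (h : (α + β + 2 * v) ^ 2 + s ^ 2 ≤ 1) (hn : (α + β) ^ 2 + s ^ 2 = 1) : v = 0 := by
  have h1 : 0 ≤ (α + β) * v := mul_nonneg (by linarith) hv
  have h2 : v ^ 2 = 0 := le_antisymm (by nlinarith) (sq_nonneg v)
  exact pow_eq_zero_iff (two_ne_zero) |>.mp h2

theorem ar_b {S r l : ℝ} (h0 : 0 ≤ S) (h1 : S ≤ 9 / 16) (hr : r ^ 2 ≤ l ^ 2) (hl0 : 0 < l)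
    (hl : l ≤ 1 / 16) : S ^ 2 + r ^ 2 ≤ 1 := by
  nlinarith

theorem ar_c {a b μ r l : ℝ} (h0 : μ ≤ a) (h1 : μ ≤ b) (hμ : 0 ≤ μ)
    (h : (a + b) ^ 2 + r ^ 2 ≤ l ^ 2) : (a - μ + (b - μ)) ^ 2 + r ^ 2 ≤ l ^ 2 := by
  have : (a - μ + (b - μ)) ^ 2 ≤ (a + b) ^ 2 := by
    apply pow_le_pow_left₀ <;> linarith
  linarith

set_option maxHeartbeats 2000000 in
theorem two_sphere {F : Z → Z} (H : Hyp F) (T : Z →ₗᵢ[ℝ] Z)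
    (hT : ∀ m a s, a ^ 2 + s ^ 2 ≤ 1 → F (T (cp m a s)) = cp m a s)
    {e₁ e₂ : ℝ} (h1 : |e₁| = 1) (h2 : |e₂| = 1) {i j : ℕ} (hij : i ≠ j) {α β s : ℝ}
    (hα : 0 ≤ α) (hβ : 0 ≤ β) (hn : (α + β) ^ 2 + s ^ 2 = 1) :
    F (T (Pt e₁ e₂ i j α β s)) = Pt e₁ e₂ i j α β s := by
  obtain ⟨Y, hY, hFY⟩ := H.surj (Pt e₁ e₂ i j α β s)
    ((Pt_norm_le h1 h2 hij hα hβ zero_le_one).mpr (by rw [hn]; norm_num))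
  obtain ⟨u0, hu0, hu1, -, hFu⟩ := two_form H T hT h1 h2 hij (α := 1 / 4) (β := 1 / 4) (s := 0)
    (by norm_num) (by norm_num) (by norm_num)
  have hQ0 : ‖Pt e₁ e₂ i j (1 / 4) (1 / 4) 0‖ ≤ 1 :=
    (Pt_norm_le h1 h2 hij (by norm_num) (by norm_num) zero_le_one).mpr (by norm_num)
  have hu2 : u0 ≠ 1 / 4 := by
    rintro rfl
    rw [sub_self, Pt_zero] at hFu
    have h3 := H.inj _ 0 (by rw [T.norm_map]; exact hQ0) (by simp) (hFu.trans (F_zero H).symm)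
    have h4 : ‖Pt e₁ e₂ i j (1 / 4) (1 / 4) 0‖ = 0 := by rw [← T.norm_map, h3, norm_zero]
    have h5 := Pt_norm h1 h2 hij (1 / 4) (1 / 4) 0
    rw [h4] at h5
    norm_num at h5
  have hu3 : u0 < 1 / 4 := lt_of_le_of_ne hu1 hu2
  obtain ⟨l, hl⟩ : ∃ l, l = (1 / 4 - u0) / 4 := ⟨_, rfl⟩
  have hl0 : 0 < l := by rw [hl]; linarith
  have hl1 : l ≤ 1 / 16 := by rw [hl]; linarith
  have hlY : ‖l • Y‖ ≤ l := by
    rw [norm_smul, Real.norm_of_nonneg hl0.le]; nlinarith [norm_nonneg Y]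
  have hlY1 : ‖l • Y‖ ≤ 1 := by linarith
  obtain ⟨α', β', r, hα', hβ', hq⟩ := two_geod h1 h2 hij hα hβ hn hl0.le (by linarith) (F (l • Y))
    ((F_norm H hlY1).trans hlY) (by
      rw [← hFY]
      refine (H.lip _ _ hY hlY1).trans ?_
      rw [show Y - l • Y = (1 - l) • Y by module, norm_smul, Real.norm_of_nonneg (by linarith)]
      nlinarith [norm_nonneg Y])
  have hqn : (α' + β') ^ 2 + r ^ 2 ≤ l ^ 2 := by
    rw [← Pt_norm_le h1 h2 hij hα' hβ' hl0.le, ← hq]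
    exact (F_norm H hlY1).trans hlY
  have hab : α' + β' ≤ l := by nlinarith [sq_nonneg r]
  have hr2 : r ^ 2 ≤ l ^ 2 := by nlinarith [sq_nonneg (α' + β')]
  obtain ⟨μ, hμ⟩ : ∃ μ, μ = min α' β' := ⟨_, rfl⟩
  have hμ0 : 0 ≤ μ := by rw [hμ]; exact le_min hα' hβ'
  have hμ1 : μ ≤ α' := by rw [hμ]; exact min_le_left _ _
  have hμ2 : μ ≤ β' := by rw [hμ]; exact min_le_right _ _
  have hball : ∀ x, 0 ≤ x → x ≤ 1 / 4 → (α' - μ + x + (β' - μ + x)) ^ 2 + r ^ 2 ≤ 1 := by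
    intro x hx0 hx1
    have : α' - μ + x + (β' - μ + x) ≤ 9 / 16 := by linarith
    exact ar_b (by linarith) this hr2 hl0 hl1
  have hform : ∀ x, 0 ≤ x → x ≤ 1 / 4 → ∃ u, 0 ≤ u ∧ u ≤ α' - μ + x ∧ u ≤ β' - μ + x ∧
      F (T (Pt e₁ e₂ i j (α' - μ + x) (β' - μ + x) r)) =
        Pt e₁ e₂ i j (α' - μ + x - u) (β' - μ + x - u) r := fun x hx0 hx1 =>
    two_form H T hT h1 h2 hij (by linarith) (by linarith) (hball x hx0 hx1)
  have hQn : ∀ x, 0 ≤ x → x ≤ 1 / 4 →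
      ‖T (Pt e₁ e₂ i j (α' - μ + x) (β' - μ + x) r)‖ ≤ 1 := fun x hx0 hx1 => by
    rw [T.norm_map]
    exact (Pt_norm_le h1 h2 hij (by linarith) (by linarith) zero_le_one).mpr
      (by rw [one_pow]; exact hball x hx0 hx1)
  let h : ℝ → ℝ := fun x =>
    e₁ * (F (T (Pt e₁ e₂ i j (α' - μ + x) (β' - μ + x) r))).fst i - (α' - μ)
  have hcoord : ∀ p q : Z, |e₁ * p.fst i - e₁ * q.fst i| ≤ ‖p - q‖ := by
    intro p q
    rw [← mul_sub, abs_mul, h1, one_mul]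
    exact coord_le p.fst q.fst p.snd q.snd i
  have hcont : ContinuousOn h (Set.Icc 0 (1 / 4)) := by
    have : LipschitzOnWith 2 h (Set.Icc 0 (1 / 4)) := by
      apply LipschitzOnWith.of_dist_le_mul
      intro x hx y hy
      rw [Real.dist_eq, Real.dist_eq]
      simp only [h]
      rw [sub_sub_sub_cancel_right]
      refine (hcoord _ _).trans ((H.lip _ _ (hQn x hx.1 hx.2) (hQn y hy.1 hy.2)).trans ?_)
      rw [← map_sub, T.norm_map, Pt_sub]
      refine le_sqX (by positivity) ?_
      rw [Pt_norm h1 h2 hij, sub_self, add_sub_add_left_eq_sub, add_sub_add_left_eq_sub]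
      apply le_of_eq
      simp only [NNReal.coe_ofNat]
      ring
    exact this.continuousOn
  have hh0 : h 0 ≤ μ := by
    obtain ⟨u, g1, g2, g3, g4⟩ := hform 0 le_rfl (by norm_num)
    simp only [h]
    rw [g4, Pt_fst_i e₂ h1 hij]
    linarith
  have hh1 : μ ≤ h (1 / 4) := by
    obtain ⟨u, g1, g2, g3, g4⟩ := hform (1 / 4) (by norm_num) le_rfl
    have g5 := hcoord (F (T (Pt e₁ e₂ i j (1 / 4) (1 / 4) 0)))
      (F (T (Pt e₁ e₂ i j (α' - μ + 1 / 4) (β' - μ + 1 / 4) r)))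
    have g6 := H.lip _ _ (by rw [T.norm_map]; exact hQ0) (hQn (1 / 4) (by norm_num) le_rfl)
    rw [← map_sub, T.norm_map, norm_sub_rev (Pt _ _ _ _ _ _ _), Pt_sub, sub_zero,
      add_sub_cancel_right, add_sub_cancel_right] at g6
    have g7 : ‖Pt e₁ e₂ i j (α' - μ) (β' - μ) r‖ ≤ l := by
      rw [Pt_norm_le h1 h2 hij (by linarith) (by linarith) hl0.le]
      exact ar_c hμ1 hμ2 hμ0 hqn
    have g8 := (le_abs_self _).trans (g5.trans (g6.trans g7))
    rw [hFu, Pt_fst_i e₂ h1 hij] at g8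
    simp only [h]
    linarith
  obtain ⟨x, ⟨hx0, hx1⟩, hx⟩ := intermediate_value_Icc (by norm_num) hcont ⟨hh0, hh1⟩
  obtain ⟨u, g1, g2, g3, g4⟩ := hform x hx0 hx1
  simp only [h] at hx
  rw [g4, Pt_fst_i e₂ h1 hij] at hx
  have hxu : x - u = μ := by linarith
  rw [show α' - μ + x - u = α' by linarith, show β' - μ + x - u = β' by linarith, ← hq] at g4
  have g5 := H.inj _ _ (hQn x hx0 hx1) hlY1 g4
  have g6 : Y = T (Pt e₁ e₂ i j (l⁻¹ * (α' - μ + x)) (l⁻¹ * (β' - μ + x)) (l⁻¹ * r)) := by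
    rw [← Pt_smul, map_smul, g5, smul_smul, inv_mul_cancel₀ hl0.ne', one_smul]
  have ha0 : 0 ≤ l⁻¹ * (α' - μ + x) := mul_nonneg (by positivity) (by linarith)
  have hb0 : 0 ≤ l⁻¹ * (β' - μ + x) := mul_nonneg (by positivity) (by linarith)
  generalize l⁻¹ * (α' - μ + x) = a at *
  generalize l⁻¹ * (β' - μ + x) = b at *
  generalize l⁻¹ * r = c at *
  have hYn := hY
  rw [g6, T.norm_map, Pt_norm_le h1 h2 hij ha0 hb0 zero_le_one, one_pow] at hYn
  obtain ⟨v, v0, -, -, hv⟩ := two_form H T hT h1 h2 hij ha0 hb0 hYn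
  rw [← g6, hFY] at hv
  obtain ⟨w1, w2, w3⟩ := Pt_inj h1 h2 hij hv
  have hv0 : v = 0 := by
    have : a + b = α + β + 2 * v := by linarith
    rw [this, ← w3] at hYn
    exact ar_v hα hβ v0 hYn hn
  rw [hv0, sub_zero] at w1 w2
  rw [w1, w2, w3, ← g6, hFY, w1, w2, w3]

theorem two_all {F : Z → Z} (H : Hyp F) (T : Z →ₗᵢ[ℝ] Z)
    (hT : ∀ m a s, a ^ 2 + s ^ 2 ≤ 1 → F (T (cp m a s)) = cp m a s)
    {e₁ e₂ : ℝ} (h1 : |e₁| = 1) (h2 : |e₂| = 1) {i j : ℕ} (hij : i ≠ j) {α β s : ℝ}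
    (hα : 0 ≤ α) (hβ : 0 ≤ β) (hn : (α + β) ^ 2 + s ^ 2 ≤ 1) :
    F (T (Pt e₁ e₂ i j α β s)) = Pt e₁ e₂ i j α β s := by
  obtain ⟨u, u0, u1, u2, hu⟩ := two_form H T hT h1 h2 hij hα hβ hn
  have hs : 0 ≤ 1 - s ^ 2 := by nlinarith [sq_nonneg (α + β)]
  obtain ⟨c, hc⟩ : ∃ c, c = √(1 - s ^ 2) := ⟨_, rfl⟩
  have hc0 : 0 ≤ c := by rw [hc]; exact Real.sqrt_nonneg _
  have hc2 : c ^ 2 = 1 - s ^ 2 := by rw [hc]; exact Real.sq_sqrt hs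
  have hcab : α + β ≤ c := by nlinarith
  obtain ⟨x, hx⟩ : ∃ x, x = (c - α - β) / 2 := ⟨_, rfl⟩
  have hx0 : 0 ≤ x := by rw [hx]; linarith
  have hsum : (α + x + (β + x)) ^ 2 + s ^ 2 = 1 := by
    rw [show α + x + (β + x) = c by rw [hx]; ring, hc2]; ring
  have hfix := two_sphere H T hT h1 h2 hij (by linarith) (by linarith) hsum
  have hl := H.lip (T (Pt e₁ e₂ i j (α + x) (β + x) s)) (T (Pt e₁ e₂ i j α β s))
    (by rw [T.norm_map, Pt_norm_le h1 h2 hij (by linarith) (by linarith) zero_le_one, one_pow]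
        exact hsum.le)
    (by rw [T.norm_map, Pt_norm_le h1 h2 hij hα hβ zero_le_one, one_pow]; exact hn)
  rw [hfix, hu, ← map_sub, T.norm_map, Pt_sub, Pt_sub] at hl
  have hl := pow_le_pow_left₀ (norm_nonneg _) hl 2
  rw [Pt_norm h1 h2 hij, Pt_norm h1 h2 hij, show α + x - (α - u) = x + u by ring,
    show β + x - (β - u) = x + u by ring, add_sub_cancel_left, add_sub_cancel_left,
    abs_of_nonneg hx0, abs_of_nonneg (by linarith : 0 ≤ x + u)] at hl
  have : u = 0 := by nlinarith
  rw [hu, this, sub_zero, sub_zero]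

theorem exists_sgn (a : ℝ) : ∃ e α : ℝ, |e| = 1 ∧ 0 ≤ α ∧ a = e * α := by
  rcases le_total 0 a with h | h
  · exact ⟨1, a, by norm_num, h, by ring⟩
  · exact ⟨-1, -a, by norm_num, by linarith, by ring⟩

theorem fin_fix {F : Z → Z} (H : Hyp F) (T : Z →ₗᵢ[ℝ] Z)
    (hT : ∀ m a s, a ^ 2 + s ^ 2 ≤ 1 → F (T (cp m a s)) = cp m a s) (n : ℕ) :
    ∀ S : Finset ℕ, S.card ≤ n → ∀ x : Ell1, (∀ k, k ∉ S → x k = 0) → ∀ s, ‖mk x s‖ ≤ 1 →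
      F (T (mk x s)) = mk x s := by
  have base : ∀ i j, i ≠ j → ∀ x : Ell1, (∀ k, k ≠ i → k ≠ j → x k = 0) → ∀ s, ‖mk x s‖ ≤ 1 →
      F (T (mk x s)) = mk x s := by
    intro i j hij x hx s hn
    obtain ⟨e₁, α, h1, hα, ha⟩ := exists_sgn (x i)
    obtain ⟨e₂, β, h2, hβ, hb⟩ := exists_sgn (x j)
    have hx' : mk x s = Pt e₁ e₂ i j α β s := by
      rw [Pt]
      congr 1
      apply l1_ext
      intro k
      rw [add_ap, ← ha, ← hb]
      by_cases hki : k = i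
      · subst hki; rw [sg_self, sg_ne _ hij, add_zero]
      by_cases hkj : k = j
      · subst hkj; rw [sg_self, sg_ne _ hij.symm, zero_add]
      rw [hx k hki hkj, sg_ne _ hki, sg_ne _ hkj, add_zero]
    rw [hx'] at hn ⊢
    rw [Pt_norm_le h1 h2 hij hα hβ zero_le_one, one_pow] at hn
    exact two_all H T hT h1 h2 hij hα hβ hn
  induction n with
  | zero =>
    intro S hS x hx s hn
    have : S = ∅ := Finset.card_eq_zero.mp (Nat.le_zero.mp hS)
    subst this
    exact base 0 1 (by norm_num) x (fun k _ _ => hx k (by simp)) s hn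
  | succ n ih =>
    intro S hS x hx s hn
    by_cases h3 : 2 < S.card
    · obtain ⟨i, j, k, hi, hj, hk, hij, hik, hjk⟩ := Finset.two_lt_card_iff.mp h3
      apply fix_three H T hn hij hik hjk
      intro m hm
      have hmS : m ∈ S := by rcases hm with rfl | rfl | rfl <;> assumption
      apply ih (S.erase m)
      · rw [Finset.card_erase_of_mem hmS]; omega
      · intro k hk
        rw [sub_ap]
        by_cases hkm : k = m
        · subst hkm; rw [sg_self, sub_self]
        · rw [sg_ne _ hkm, sub_zero]
          apply hx
          intro hkS
          exact hk (Finset.mem_erase.mpr ⟨hkm, hkS⟩)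
      · refine le_trans (mk_norm_le_norm.mpr ?_) hn
        have h1 := norm_sub_sg x m (x m)
        have h2 := norm_nonneg (x - sg m (x m))
        simp at h1
        nlinarith [abs_nonneg (x m)]
    · have hc : S.card = 0 ∨ S.card = 1 ∨ S.card = 2 := by omega
      rcases hc with hc | hc | hc
      · have : S = ∅ := Finset.card_eq_zero.mp hc
        subst this
        exact base 0 1 (by norm_num) x (fun k _ _ => hx k (by simp)) s hn
      · obtain ⟨a, rfl⟩ := Finset.card_eq_one.mp hc
        exact base a (a + 1) (by omega) x (fun k hk _ => hx k (by simpa using hk)) s hn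
      · obtain ⟨a, b, hab, rfl⟩ := Finset.card_eq_two.mp hc
        exact base a b hab x (fun k hk hk' => hx k (by simp [hk, hk'])) s hn

theorem all_fix {F : Z → Z} (H : Hyp F) (T : Z →ₗᵢ[ℝ] Z)
    (hT : ∀ m a s, a ^ 2 + s ^ 2 ≤ 1 → F (T (cp m a s)) = cp m a s) (p : Z) (hp : ‖p‖ ≤ 1) :
    F (T p) = p := by
  rw [mk_eta p] at *
  generalize p.fst = x at *
  generalize p.snd = s at *
  have hsum : HasSum (fun k => sg k (x k)) x := lp.hasSum_single (by simp) x
  rw [← sub_eq_zero, ← norm_eq_zero]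
  apply le_antisymm _ (norm_nonneg _)
  apply le_of_forall_pos_le_add
  intro ε hε
  have hev := (Metric.tendsto_nhds.mp hsum) (ε / 2) (by linarith)
  obtain ⟨S, hS⟩ := hev.exists
  rw [dist_eq_norm] at hS
  set y := ∑ k ∈ S, sg k (x k) with hy
  have hyn : ‖y‖ ≤ ‖x‖ := by
    refine (norm_sum_le _ _).trans ?_
    simp only [norm_sg]
    exact sum_le_hasSum S (fun _ _ => abs_nonneg _) (l1_hasSum x)
  have hn : ‖mk y s‖ ≤ 1 := by
    refine le_trans (mk_norm_le_norm.mpr ?_) hp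
    nlinarith [norm_nonneg y]
  have hfix := fin_fix H T hT S.card S le_rfl y (by
    intro k hk
    rw [hy, lp.coeFn_sum, Finset.sum_apply]
    apply Finset.sum_eq_zero
    intro j hj
    exact sg_ne _ (fun h => hk (h ▸ hj))) s hn
  have hl := H.lip (T (mk x s)) (T (mk y s)) (by rw [T.norm_map]; exact hp)
    (by rw [T.norm_map]; exact hn)
  rw [hfix, ← map_sub, T.norm_map] at hl
  have hd : ‖mk x s - mk y s‖ ≤ ε / 2 := by
    rw [mk_sub, mk_norm_le (by linarith), norm_sub_rev]
    nlinarith [norm_nonneg (y - x)]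
  have := norm_sub_le_norm_sub_add_norm_sub (F (T (mk x s))) (mk y s) (mk x s)
  rw [norm_sub_rev (mk y s)] at this
  linarith

end PlasticAux

open PlasticAux in
/-- The closed unit ball of Z = ℓ₁ ⊕₂ ℝ is plastic: every non-expansive
bijection of the ball onto itself is an isometry. -/
theorem plastic_ball_ell1_sum2_real
    (B : Set Z) (hB : B = Metric.closedBall (0 : Z) 1)
    (F : Z → Z) (hbij : Set.BijOn F B B) (hne : LipschitzOnWith 1 F B) :
    ∀ x ∈ B, ∀ y ∈ B, dist (F x) (F y) = dist x y := by
  have hmem : ∀ p, p ∈ B ↔ ‖p‖ ≤ 1 := by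
    intro p; rw [hB, mem_closedBall_zero_iff]
  have H : Hyp F :=
    { maps := fun p hp => (hmem _).mp (hbij.mapsTo ((hmem p).mpr hp))
      inj := fun p q hp hq h => hbij.injOn ((hmem p).mpr hp) ((hmem q).mpr hq) h
      surj := fun q hq => by
        obtain ⟨p, hp, h⟩ := hbij.surjOn ((hmem q).mpr hq)
        exact ⟨p, (hmem p).mp hp, h⟩
      lip := fun p q hp hq => by
        have := hne.dist_le_mul p ((hmem p).mpr hp) q ((hmem q).mpr hq)
        rwa [dist_eq_norm, dist_eq_norm, NNReal.coe_one, one_mul] at this }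
  obtain ⟨T, hT⟩ := exists_T2 H
  have key : ∀ p ∈ B, T (F p) = p := by
    intro p hp
    have hp := (hmem p).mp hp
    have hFp := H.maps p hp
    exact H.inj _ _ (by rw [T.norm_map]; exact hFp) hp (all_fix H T hT (F p) hFp)
  intro x hx y hy
  rw [← T.dist_map (F x) (F y), key x hx, key y hy]
end

section
/- Let X and Y be strictly convex real Banach spaces. Then the closed unit ball of Z = X ⊕_∞ Y is a plastic metric space; that is, every non-expansive bijection from the closed unit ball of Z onto itself is an isometry. -/
open Metric Set Filter Topology

structure NE {E₁ E₂ : Type*} [NormedAddCommGroup E₁] [NormedAddCommGroup E₂]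
    (F : E₁ → E₂) (G : E₂ → E₁) : Prop where
  mF : ∀ p, ‖p‖ ≤ 1 → ‖F p‖ ≤ 1
  mG : ∀ q, ‖q‖ ≤ 1 → ‖G q‖ ≤ 1
  FG : ∀ q, ‖q‖ ≤ 1 → F (G q) = q
  GF : ∀ p, ‖p‖ ≤ 1 → G (F p) = p
  lip : ∀ p q, ‖p‖ ≤ 1 → ‖q‖ ≤ 1 → ‖F p - F q‖ ≤ ‖p - q‖

lemma exists_unit {E : Type*} [NormedAddCommGroup E] [NormedSpace ℝ E] [Nontrivial E] (x : E) :
    ∃ u : E, ‖u‖ = 1 ∧ x = ‖x‖ • u := by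
  by_cases hx : x = 0
  · obtain ⟨u, hu⟩ := exists_norm_eq E (zero_le_one (α := ℝ))
    exact ⟨u, hu, by simp [hx]⟩
  · have : ‖x‖ ≠ 0 := norm_ne_zero_iff.mpr hx
    refine ⟨‖x‖⁻¹ • x, ?_, ?_⟩
    · rw [norm_smul, norm_inv, norm_norm, inv_mul_cancel₀ this]
    · rw [smul_smul, mul_inv_cancel₀ this, one_smul]

lemma sc1 {E : Type*} [NormedAddCommGroup E] [NormedSpace ℝ E] [StrictConvexSpace ℝ E]
    (e q : E) (s t : ℝ) (he : ‖e‖ = 1) (hs : 0 ≤ s)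
    (h1 : ‖q - s • e‖ ≤ s - t) (h2 : ‖q + s • e‖ ≤ s + t) : q = t • e := by
  rcases hs.eq_or_lt with rfl | hs
  · simp only [zero_smul, sub_zero, add_zero, zero_sub, zero_add] at h1 h2
    have := norm_nonneg q
    have ht : t = 0 := by linarith
    subst ht
    have : q = 0 := norm_le_zero_iff.mp h2
    simp [this]
  have hd : dist (-(s • e)) (s • e) = 2 * s := by
    rw [dist_eq_norm, show -(s • e) - s • e = (-(2 * s)) • e by module, norm_smul, he]
    simp [abs_of_pos hs]
  have d1 : dist (-(s • e)) q ≤ s + t := by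
    rw [dist_comm, dist_eq_norm, sub_neg_eq_add]; exact h2
  have d2 : dist q (s • e) ≤ s - t := by rw [dist_eq_norm]; exact h1
  have tri := dist_triangle (-(s • e)) q (s • e)
  have := eq_lineMap_of_dist_eq_mul_of_dist_eq_mul (x := -(s • e)) (y := q) (z := s • e)
    (r := (s + t) / (2 * s)) (by rw [hd]; field_simp; linarith) (by rw [hd]; field_simp; linarith)
  rw [this, AffineMap.lineMap_apply]
  simp only [vsub_eq_sub, vadd_eq_add]
  rw [show s • e - -(s • e) = (2 * s) • e by module, smul_smul, div_mul_cancel₀ _ (by positivity)]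
  module

lemma sc2 {E : Type*} [NormedAddCommGroup E] [NormedSpace ℝ E] [StrictConvexSpace ℝ E]
    (x y : E) (hx : ‖x‖ ≤ 1) (hy : ‖y‖ ≤ 1) (h : 2 ≤ ‖x - y‖) : y = -x ∧ ‖x‖ = 1 := by
  have h3 := norm_sub_le x y
  have hx1 : ‖x‖ = 1 := by linarith
  have hy1 : ‖y‖ = 1 := by linarith
  refine ⟨?_, hx1⟩
  have hr : SameRay ℝ x (-y) := by
    rw [sameRay_iff_norm_add, ← sub_eq_add_neg, norm_neg]; linarith
  have := (sameRay_iff_of_norm_eq (by rw [norm_neg, hx1, hy1])).mp hr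
  rw [this, neg_neg]

lemma isom_half {E H : Type*} [NormedAddCommGroup E] [NormedSpace ℝ E]
    [NormedAddCommGroup H] [NormedSpace ℝ H] (f : E → H)
    (hn : ∀ u, ‖u‖ ≤ 1 → ‖f u‖ = ‖u‖)
    (hh : ∀ u (r : ℝ), ‖u‖ ≤ 1 → |r| ≤ 1 → f (r • u) = r • f u)
    (hl : ∀ u v, ‖u‖ ≤ 1 → ‖v‖ ≤ 1 → ‖f u - f v‖ ≤ ‖u - v‖)
    (z z' : E) (hz : ‖z‖ ≤ 1/4) (hz' : ‖z'‖ ≤ 1/4) : ‖z - z'‖ ≤ ‖f z - f z'‖ := by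
  set ι : ℝ × ℝ →L[ℝ] E :=
    (ContinuousLinearMap.fst ℝ ℝ ℝ).smulRight z + (ContinuousLinearMap.snd ℝ ℝ ℝ).smulRight z' with hι
  have hιa : ∀ p, ι p = p.1 • z + p.2 • z' := fun p => by simp [hι]
  have hLip : LipschitzWith ‖ι‖₊ (fun p => ‖ι p‖) := by
    have := (lipschitzWith_one_norm (E := E)).comp ι.lipschitz
    rw [one_mul] at this
    exact this
  have hae := hLip.ae_differentiableAt (μ := MeasureTheory.volume)
  have hdense : Dense {p : ℝ × ℝ | DifferentiableAt ℝ (fun p => ‖ι p‖) p} :=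
    MeasureTheory.Measure.dense_of_ae hae
  have hzz : ι (1, -1) = z - z' := by rw [hιa]; simp [sub_eq_add_neg]
  have key : ∀ p : ℝ × ℝ, DifferentiableAt ℝ (fun p => ‖ι p‖) p → ‖ι p‖ ≤ 1 →
      ‖ι p‖ - ‖ι p - (z - z')‖ ≤ ‖f z - f z'‖ := by
    intro p hp hp1
    obtain ⟨φ, hφ, hφx⟩ := exists_dual_vector'' ℝ (f (ι p))
    have hφle : ∀ w, φ w ≤ ‖w‖ := fun w => by
      have := φ.le_of_opNorm_le hφ w
      rw [one_mul] at this
      exact (le_abs_self _).trans this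
    simp only [RCLike.ofReal_real_eq_id, id] at hφx
    rw [hn _ hp1] at hφx
    obtain ⟨L, hL⟩ := hp
    have dir : ∀ e : ℝ × ℝ, ‖ι e‖ ≤ 1 → L e = φ (f (ι e)) := by
      intro e he
      have hline : HasDerivAt (fun ε : ℝ => p + ε • e) e 0 := by
        simpa using ((hasDerivAt_id (0:ℝ)).smul_const e).const_add p
      have hL' : HasFDerivAt (fun p => ‖ι p‖) L (p + (0:ℝ) • e) := by simpa using hL
      have hd := (hL'.comp_hasDerivAt (0:ℝ) hline).sub
        ((hasDerivAt_id (0:ℝ)).mul_const (φ (f (ι e))))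
      have hmin : IsLocalMin (((fun p => ‖ι p‖) ∘ fun ε : ℝ => p + ε • e) -
          fun ε : ℝ => id ε * φ (f (ι e))) 0 := by
        have : ∀ᶠ ε : ℝ in 𝓝 0, |ε| < 1 := by
          have := Metric.ball_mem_nhds (0:ℝ) one_pos
          filter_upwards [this] with ε hε
          simpa using hε
        filter_upwards [this] with ε hε
        simp only [Pi.sub_apply, Function.comp, zero_smul, add_zero, id, zero_mul, sub_zero,
          map_add, map_smul]
        have h1 : f ((-ε) • ι e) = (-ε) • f (ι e) := hh _ _ he (by rw [abs_neg]; exact hε.le)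
        have h2 : ‖(-ε) • ι e‖ ≤ 1 := by
          rw [norm_smul, Real.norm_eq_abs, abs_neg]
          exact mul_le_one₀ hε.le (norm_nonneg _) he
        have h3 := hl (ι p) _ hp1 h2
        rw [h1] at h3
        have h4 := (hφle _).trans h3
        rw [map_sub, hφx, map_smul, neg_smul, sub_neg_eq_add, smul_eq_mul, neg_smul,
          sub_neg_eq_add] at h4
        linarith
      have := hmin.hasDerivAt_eq_zero hd
      simp at this
      linarith
    have l1 := dir (1, 0) (by rw [hιa]; simp; linarith)
    have l2 := dir (0, 1) (by rw [hιa]; simp; linarith)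
    have hz2 : ‖z - z'‖ ≤ 1 := (norm_sub_le _ _).trans (by linarith)
    have l3 := dir (1, -1) (by rw [hzz]; exact hz2)
    rw [hzz] at l3
    have e1 : ι (1, 0) = z := by rw [hιa]; simp
    have e2 : ι (0, 1) = z' := by rw [hιa]; simp
    rw [e1] at l1
    rw [e2] at l2
    have hsub : L (1, -1) = L (1, 0) - L (0, 1) := by rw [← map_sub]; simp
    have m1 := hφle (f z - f z')
    rw [map_sub, ← l1, ← l2, ← hsub, l3] at m1
    have m2 := (hφle (f (ι p) - f (z - z'))).trans (hl _ _ hp1 hz2)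
    rw [map_sub, hφx] at m2
    linarith
  refine le_of_forall_pos_le_add fun ε hε => ?_
  have hcont : Tendsto (fun p => ‖ι p - (z - z')‖) (𝓝 (1, -1)) (𝓝 0) := by
    have : Continuous fun p => ‖ι p - (z - z')‖ := by fun_prop
    have := this.tendsto (1, -1)
    simpa [hzz] using this
  have hev : ∀ᶠ p in 𝓝 ((1:ℝ), (-1:ℝ)), ‖ι p - (z - z')‖ < min (ε / 2) (1/2) :=
    hcont.eventually (gt_mem_nhds (by positivity))
  obtain ⟨p, hpd, hp⟩ := hdense.inter_nhds_nonempty hev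
  change DifferentiableAt ℝ (fun p => ‖ι p‖) p at hpd
  change ‖ι p - (z - z')‖ < min (ε / 2) (1/2) at hp
  rw [lt_min_iff] at hp
  have a1 : ‖z - z'‖ ≤ ‖ι p‖ + ‖ι p - (z - z')‖ := by
    have := norm_sub_le (ι p) (ι p - (z - z'))
    simpa using this
  have a2 : ‖ι p‖ ≤ ‖z - z'‖ + ‖ι p - (z - z')‖ := by
    have := norm_add_le (z - z') (ι p - (z - z'))
    simpa using this
  have hz2 : ‖z - z'‖ ≤ 1/2 := (norm_sub_le _ _).trans (by linarith)
  have := key p hpd (by linarith [hp.2])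
  linarith [hp.1]

lemma isom_ball {E H : Type*} [NormedAddCommGroup E] [NormedSpace ℝ E]
    [NormedAddCommGroup H] [NormedSpace ℝ H] (f : E → H)
    (hn : ∀ u, ‖u‖ ≤ 1 → ‖f u‖ = ‖u‖)
    (hh : ∀ u (r : ℝ), ‖u‖ ≤ 1 → |r| ≤ 1 → f (r • u) = r • f u)
    (hl : ∀ u v, ‖u‖ ≤ 1 → ‖v‖ ≤ 1 → ‖f u - f v‖ ≤ ‖u - v‖)
    (z z' : E) (hz : ‖z‖ ≤ 1) (hz' : ‖z'‖ ≤ 1) : ‖f z - f z'‖ = ‖z - z'‖ := by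
  refine le_antisymm (hl _ _ hz hz') ?_
  have := isom_half f hn hh hl ((1/4 : ℝ) • z) ((1/4 : ℝ) • z')
    (by rw [norm_smul]; norm_num; linarith) (by rw [norm_smul]; norm_num; linarith)
  rw [hh _ _ hz (by norm_num [abs_le]), hh _ _ hz' (by norm_num [abs_le]), ← smul_sub, ← smul_sub,
    norm_smul, norm_smul] at this
  norm_num at this
  exact this

set_option linter.unusedSectionVars false

namespace NE

section gen
variable {E₁ E₂ : Type*} [NormedAddCommGroup E₁] [NormedAddCommGroup E₂]
  [NormedSpace ℝ E₁] [NormedSpace ℝ E₂] {F : E₁ → E₂} {G : E₂ → E₁}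

lemma exp (h : NE F G) (p q : E₂) (hp : ‖p‖ ≤ 1) (hq : ‖q‖ ≤ 1) : ‖p - q‖ ≤ ‖G p - G q‖ := by
  have := h.lip _ _ (h.mG p hp) (h.mG q hq)
  rwa [h.FG p hp, h.FG q hq] at this

lemma injF (h : NE F G) {p q : E₁} (hp : ‖p‖ ≤ 1) (hq : ‖q‖ ≤ 1) (e : F p = F q) : p = q := by
  rw [← h.GF p hp, e, h.GF q hq]

lemma injG (h : NE F G) {p q : E₂} (hp : ‖p‖ ≤ 1) (hq : ‖q‖ ≤ 1) (e : G p = G q) : p = q := by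
  rw [← h.FG p hp, e, h.FG q hq]

lemma F0 (h : NE F G) : F 0 = 0 := by
  by_contra hne
  have : Nontrivial E₂ := ⟨_, _, hne⟩
  obtain ⟨u, hu, hq⟩ := exists_unit (F 0)
  have h1 := h.lip 0 (G (-u)) (by simp) (h.mG _ (by simp [hu]))
  rw [h.FG _ (by simp [hu]), zero_sub, norm_neg] at h1
  have h2 := h.mG (-u) (by simp [hu])
  rw [show F 0 - -u = (‖F 0‖ + 1) • u by rw [add_smul, ← hq]; simp, norm_smul, hu,
    Real.norm_of_nonneg (by positivity)] at h1
  have := norm_pos_iff.mpr hne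
  linarith

lemma F_le (h : NE F G) (p : E₁) (hp : ‖p‖ ≤ 1) : ‖F p‖ ≤ ‖p‖ := by
  have := h.lip p 0 hp (by simp)
  simpa [h.F0] using this

lemma le_G (h : NE F G) (p : E₂) (hp : ‖p‖ ≤ 1) : ‖p‖ ≤ ‖G p‖ := by
  have := h.F_le (G p) (h.mG p hp)
  rwa [h.FG p hp] at this

lemma strict [StrictConvexSpace ℝ E₁] [StrictConvexSpace ℝ E₂] (h : NE F G)
    (z z' : E₁) (hz : ‖z‖ ≤ 1) (hz' : ‖z'‖ ≤ 1) : ‖F z - F z'‖ = ‖z - z'‖ := by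
  have uG : ∀ e : E₂, ‖e‖ = 1 → ‖G e‖ = 1 := fun e he =>
    le_antisymm (h.mG e he.le) (he ▸ h.le_G e he.le)
  have oG : ∀ e : E₂, ‖e‖ = 1 → G (-e) = - G e := by
    intro e he
    have := h.exp e (-e) he.le (by simp [he])
    refine (sc2 (G e) (G (-e)) (h.mG _ he.le) (h.mG _ (by simp [he])) (le_trans ?_ this)).1
    rw [show e - -e = (2:ℝ) • e by module, norm_smul, he]; norm_num
  have tG : ∀ e : E₂, ‖e‖ = 1 → ∀ t : ℝ, |t| ≤ 1 → F (t • G e) = t • e := by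
    intro e he t ht
    have hb : ‖t • G e‖ ≤ 1 := by rw [norm_smul, uG e he]; simpa using ht
    have ht' := abs_le.mp ht
    have h1 := h.lip (t • G e) (G e) hb (uG e he).le
    have h2 := h.lip (t • G e) (G (-e)) hb (h.mG _ (by simp [he]))
    rw [h.FG e he.le, show t • G e - G e = (t - 1) • G e by module, norm_smul, uG e he,
      Real.norm_eq_abs, abs_of_nonpos (by linarith)] at h1
    rw [h.FG (-e) (by simp [he]), oG e he, show t • G e - -G e = (t + 1) • G e by module, norm_smul,
      uG e he, Real.norm_eq_abs, abs_of_nonneg (by linarith)] at h2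
    refine sc1 e _ 1 t he zero_le_one ?_ ?_
    · simpa using h1.trans (by linarith)
    · simpa using h2.trans (by linarith)
  have rep : ∀ u : E₁, ‖u‖ ≤ 1 → u ≠ 0 → ∃ e : E₂, ‖e‖ = 1 ∧ F u = ‖F u‖ • e ∧ u = ‖F u‖ • G e := by
    intro u hu hu0
    have hFu : F u ≠ 0 := fun h0 => hu0 (h.injF hu (by simp) (by rw [h0, h.F0]))
    have : Nontrivial E₂ := ⟨_, _, hFu⟩
    obtain ⟨e, he, h1⟩ := exists_unit (F u)
    refine ⟨e, he, h1, h.injF hu ?_ ?_⟩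
    · rw [norm_smul, uG e he]; simpa using h.mF u hu
    · rw [tG e he _ (by simpa using h.mF u hu), ← h1]
  refine isom_ball F ?_ ?_ h.lip z z' hz hz'
  · intro u hu
    by_cases hu0 : u = 0
    · simp [hu0, h.F0]
    obtain ⟨e, he, h1, h2⟩ := rep u hu hu0
    conv_rhs => rw [h2, norm_smul, uG e he]
    simp
  · intro u r hu hr
    by_cases hu0 : u = 0
    · simp [hu0, h.F0]
    obtain ⟨e, he, h1, h2⟩ := rep u hu hu0
    have hm := h.mF u hu
    have hrt : |r * ‖F u‖| ≤ 1 := by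
      rw [abs_mul, abs_norm]; exact mul_le_one₀ hr (norm_nonneg _) hm
    have h3 := tG e he _ hrt
    rw [mul_smul, ← h2, mul_smul, ← h1] at h3
    exact h3
end gen
end NE

lemma pn {X Y : Type*} [NormedAddCommGroup X] [NormedAddCommGroup Y] {r : ℝ} {u : X} {v : Y}
    (hu : ‖u‖ ≤ r) (hv : ‖v‖ ≤ r) : ‖(u, v)‖ ≤ r := max_le hu hv

lemma pn1 {X Y : Type*} [NormedAddCommGroup X] [NormedAddCommGroup Y] {r : ℝ} {p : X × Y}
    (h : ‖p‖ ≤ r) : ‖p.1‖ ≤ r := (le_max_left _ _).trans h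

lemma pn2 {X Y : Type*} [NormedAddCommGroup X] [NormedAddCommGroup Y] {r : ℝ} {p : X × Y}
    (h : ‖p‖ ≤ r) : ‖p.2‖ ≤ r := (le_max_right _ _).trans h

lemma swap_norm {X Y : Type*} [NormedAddCommGroup X] [NormedAddCommGroup Y] (p : X × Y) :
    ‖p.swap‖ = ‖p‖ := max_comm _ _

namespace NE

section prod
variable {X₁ Y₁ X₂ Y₂ : Type*}
  [NormedAddCommGroup X₁] [NormedSpace ℝ X₁] [StrictConvexSpace ℝ X₁]
  [NormedAddCommGroup Y₁] [NormedSpace ℝ Y₁] [StrictConvexSpace ℝ Y₁]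
  [NormedAddCommGroup X₂] [NormedSpace ℝ X₂] [StrictConvexSpace ℝ X₂]
  [NormedAddCommGroup Y₂] [NormedSpace ℝ Y₂] [StrictConvexSpace ℝ Y₂]
  {F : X₁ × Y₁ → X₂ × Y₂} {G : X₂ × Y₂ → X₁ × Y₁}

/-- swap the domain of F -/
lemma swapD (h : NE F G) : NE (fun p : Y₁ × X₁ => F p.swap) (fun q => (G q).swap) where
  mF p hp := h.mF _ (by rwa [swap_norm])
  mG q hq := by rw [swap_norm]; exact h.mG q hq
  FG q hq := by simpa using h.FG q hq
  GF p hp := by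
    show (G (F p.swap)).swap = p
    rw [h.GF _ (by rwa [swap_norm])]; simp
  lip p q hp hq := by
    have := h.lip p.swap q.swap (by rwa [swap_norm]) (by rwa [swap_norm])
    rwa [show p.swap - q.swap = (p - q).swap from rfl, swap_norm] at this

/-- swap the codomain of F -/
lemma swapC (h : NE F G) : NE (fun p => (F p).swap) (fun q : Y₂ × X₂ => G q.swap) where
  mG p hp := h.mG _ (by rwa [swap_norm])
  mF q hq := by rw [swap_norm]; exact h.mF q hq
  GF q hq := by simpa using h.GF q hq
  FG p hp := by
    show (F (G p.swap)).swap = p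
    rw [h.FG _ (by rwa [swap_norm])]; simp
  lip p q hp hq := by
    have := h.lip p q hp hq
    rwa [show (F p).swap - (F q).swap = (F p - F q).swap from rfl, swap_norm]

lemma adj_of {p q : X₁ × Y₁} (hp : ‖p‖ ≤ 1) (hq : ‖q‖ ≤ 1) (h : 2 ≤ ‖p - q‖) :
    (q.1 = -p.1 ∧ ‖p.1‖ = 1) ∨ (q.2 = -p.2 ∧ ‖p.2‖ = 1) := by
  rcases le_max_iff.mp h with h | h
  · exact Or.inl (sc2 _ _ (pn1 hp) (pn1 hq) h)
  · exact Or.inr (sc2 _ _ (pn2 hp) (pn2 hq) h)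

lemma two_le {E : Type*} [NormedAddCommGroup E] [NormedSpace ℝ E] {a : E} (ha : ‖a‖ = 1) :
    2 ≤ ‖a - -a‖ := by
  rw [show a - -a = (2:ℝ) • a by module, norm_smul, ha]; norm_num

lemma adjL (h : NE F G) {a : X₂} {b b' : Y₂} (ha : ‖a‖ = 1) (hb : ‖b‖ ≤ 1) (hb' : ‖b'‖ ≤ 1) :
    ((G (-a, b')).1 = -(G (a, b)).1 ∧ ‖(G (a, b)).1‖ = 1) ∨
    ((G (-a, b')).2 = -(G (a, b)).2 ∧ ‖(G (a, b)).2‖ = 1) := by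
  have ha' : ‖-a‖ ≤ 1 := by simp [ha]
  refine adj_of (h.mG _ (pn ha.le hb)) (h.mG _ (pn ha' hb')) ?_
  refine le_trans ?_ (h.exp _ _ (pn ha.le hb) (pn ha' hb'))
  exact (two_le ha).trans (le_max_left _ _)

lemma adjR (h : NE F G) {a a' : X₂} {b : Y₂} (ha : ‖a‖ ≤ 1) (ha' : ‖a'‖ ≤ 1) (hb : ‖b‖ = 1) :
    ((G (a', -b)).1 = -(G (a, b)).1 ∧ ‖(G (a, b)).1‖ = 1) ∨
    ((G (a', -b)).2 = -(G (a, b)).2 ∧ ‖(G (a, b)).2‖ = 1) := by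
  have hb' : ‖-b‖ ≤ 1 := by simp [hb]
  refine adj_of (h.mG _ (pn ha hb.le)) (h.mG _ (pn ha' hb')) ?_
  refine le_trans ?_ (h.exp _ _ (pn ha hb.le) (pn ha' hb'))
  exact (two_le hb).trans (le_max_right _ _)

lemma ne_neg_of_unit {E : Type*} [NormedAddCommGroup E] [NormedSpace ℝ E] {x : E} (hx : ‖x‖ = 1) :
    x ≠ -x := by
  intro h0
  have := two_le hx
  rw [← h0, sub_self, norm_zero] at this
  norm_num at this

lemma ext2 (h : NE F G) {a : X₂} {b : Y₂} (ha : ‖a‖ = 1) (hb : ‖b‖ = 1) :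
    ‖(G (a, b)).2‖ = 1 := by
  by_contra hy
  have k1 := h.adjL (a := a) (b := b) (b' := b) ha hb.le hb.le
  have k2 := h.adjR (a := a) (a' := a) (b := b) ha.le ha.le hb
  have k3 := h.adjL (a := a) (b := b) (b' := 0) ha hb.le (by simp)
  have m1 := h.adjL (a := a) (b := -b) (b' := b) ha (by simp [hb]) hb.le
  have m3 := h.adjL (a := a) (b := -b) (b' := 0) ha (by simp [hb]) (by simp)
  simp only [hy, and_false, or_false] at k1 k2 k3
  have hx := ne_neg_of_unit k1.2
  rw [k1.1, k2.1, neg_neg] at m1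
  rw [k3.1, k2.1, neg_neg] at m3
  have n1 : (G (-a, b)).2 = -(G (a, -b)).2 := by
    rcases m1 with m | m
    · exact absurd m.1.symm hx
    · exact m.1
  have n3 : (G (-a, 0)).2 = -(G (a, -b)).2 := by
    rcases m3 with m | m
    · exact absurd m.1.symm hx
    · exact m.1
  have : G (-a, b) = G (-a, 0) := Prod.ext (k1.1.trans k3.1.symm) (n1.trans n3.symm)
  have := h.injG (pn (by simp [ha]) hb.le) (pn (by simp [ha]) (by simp)) this
  have := (Prod.ext_iff.mp this).2
  simp only at this
  rw [this] at hb; simp at hb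

lemma ext1 (h : NE F G) {a : X₂} {b : Y₂} (ha : ‖a‖ = 1) (hb : ‖b‖ = 1) :
    ‖(G (a, b)).1‖ = 1 := h.swapD.ext2 ha hb

/-- if `G (a,-b)` lies in the `x` face then all of `G (-a, ·)` is in the `y` face -/
lemma face1 (h : NE F G) {a : X₂} {b : Y₂} (ha : ‖a‖ = 1) (hb : ‖b‖ = 1)
    (hv : (G (a, -b)).1 = -(G (a, b)).1) :
    (G (a, -b)).2 = (G (a, b)).2 ∧ ∀ d, ‖d‖ ≤ 1 → (G (-a, d)).2 = -(G (a, b)).2 := by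
  have hx := h.ext1 ha hb
  have hxx := ne_neg_of_unit hx
  have main : ∀ d, ‖d‖ ≤ 1 → G (-a, d) = (-(G (a, b)).1, -(G (a, -b)).2) ∨
      G (-a, d) = ((G (a, b)).1, -(G (a, b)).2) ∨
      ((G (a, -b)).2 = (G (a, b)).2 ∧ (G (-a, d)).2 = -(G (a, b)).2) := by
    intro d hd
    have k := h.adjL (a := a) (b := b) (b' := d) ha hb.le hd
    have m := h.adjL (a := a) (b := -b) (b' := d) ha (by simp [hb]) hd
    rw [hv, neg_neg] at m
    rcases k with ⟨k, -⟩ | ⟨k, -⟩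
    · rcases m with ⟨m, -⟩ | ⟨m, -⟩
      · exact absurd (m.symm.trans k) hxx
      · exact Or.inl (Prod.ext k m)
    · rcases m with ⟨m, -⟩ | ⟨m, -⟩
      · exact Or.inr (Or.inl (Prod.ext m k))
      · exact Or.inr (Or.inr ⟨neg_injective (m.symm.trans k), k⟩)
  have hw : (G (a, -b)).2 = (G (a, b)).2 := by
    by_contra hw
    have main' : ∀ d, ‖d‖ ≤ 1 → G (-a, d) = (-(G (a, b)).1, -(G (a, -b)).2) ∨
      G (-a, d) = ((G (a, b)).1, -(G (a, b)).2) := by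
      intro d hd
      rcases main d hd with m | m | m
      · exact Or.inl m
      · exact Or.inr m
      · exact absurd m.1 hw
    have inj : ∀ d d', ‖d‖ ≤ 1 → ‖d'‖ ≤ 1 → G (-a, d) = G (-a, d') → d = d' := by
      intro d d' hd hd' e
      exact (Prod.ext_iff.mp (h.injG (pn (by simp [ha]) hd) (pn (by simp [ha]) hd') e)).2
    have hb0 : b ≠ 0 := by rintro rfl; simp at hb
    have n1 : b ≠ -b := ne_neg_of_unit hb
    have hnb : ‖-b‖ ≤ 1 := by simp [hb]
    have h0 : ‖(0 : Y₂)‖ ≤ 1 := by simp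
    have i1 := inj b (-b) hb.le hnb
    have i2 := inj b 0 hb.le h0
    have i3 := inj (-b) 0 hnb h0
    have hb0' : -b ≠ 0 := neg_ne_zero.mpr hb0
    rcases main' b hb.le with e1 | e1 <;> rcases main' (-b) hnb with e2 | e2 <;>
      rcases main' 0 h0 with e3 | e3 <;> rw [e1, e2] at i1 <;> rw [e1, e3] at i2 <;>
      rw [e2, e3] at i3 <;> tauto
  refine ⟨hw, fun d hd => ?_⟩
  rcases main d hd with m | m | m
  · rw [m, hw]
  · rw [m]
  · exact m.2

lemma face2 (h : NE F G) {a : X₂} {b : Y₂} (ha : ‖a‖ = 1) (hb : ‖b‖ = 1)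
    (hv : (G (a, -b)).2 = -(G (a, b)).2) :
    (G (a, -b)).1 = (G (a, b)).1 ∧ ∀ d, ‖d‖ ≤ 1 → (G (-a, d)).1 = -(G (a, b)).1 :=
  h.swapD.face1 ha hb hv

def TA (G : X₂ × Y₂ → X₁ × Y₁) (a : X₂) (b : Y₂) : Prop :=
  (∀ d, ‖d‖ ≤ 1 → (G (-a, d)).1 = -(G (a, b)).1) ∧ (∀ c, ‖c‖ ≤ 1 → (G (c, -b)).2 = -(G (a, b)).2)

def TB (G : X₂ × Y₂ → X₁ × Y₁) (a : X₂) (b : Y₂) : Prop :=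
  (∀ d, ‖d‖ ≤ 1 → (G (-a, d)).2 = -(G (a, b)).2) ∧ (∀ c, ‖c‖ ≤ 1 → (G (c, -b)).1 = -(G (a, b)).1)

lemma types (h : NE F G) {a : X₂} {b : Y₂} (ha : ‖a‖ = 1) (hb : ‖b‖ = 1) : TA G a b ∨ TB G a b := by
  have hx := ne_neg_of_unit (h.ext1 ha hb)
  have hy := ne_neg_of_unit (h.ext2 ha hb)
  have k := h.adjR (a := a) (a' := a) (b := b) ha.le ha.le hb
  have l := h.adjL (a := a) (b := b) (b' := b) ha hb.le hb.le
  rcases k with ⟨k, -⟩ | ⟨k, -⟩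
  · have f := h.face1 ha hb k
    have f2 := h.swapC.face1 hb ha
    have f2' := h.swapC.face2 hb ha
    simp only [Prod.swap_prod_mk] at f2 f2'
    rcases l with ⟨l, -⟩ | ⟨l, -⟩
    · exact absurd ((f2 l).1.symm.trans (f.2 b hb.le)) hy
    · exact Or.inr ⟨f.2, (f2' l).2⟩
  · have f := h.face2 ha hb k
    have f2 := h.swapC.face1 hb ha
    have f2' := h.swapC.face2 hb ha
    simp only [Prod.swap_prod_mk] at f2 f2'
    rcases l with ⟨l, -⟩ | ⟨l, -⟩
    · exact Or.inl ⟨f.2, (f2 l).2⟩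
    · exact absurd ((f2' l).1.symm.trans (f.2 b hb.le)) hx

lemma global (h : NE F G) {a₀ : X₂} {b₀ : Y₂} (ha₀ : ‖a₀‖ = 1) (hb₀ : ‖b₀‖ = 1) (h0 : TA G a₀ b₀)
    {a : X₂} {b : Y₂} (ha : ‖a‖ = 1) (hb : ‖b‖ = 1) : TA G a b := by
  have h1 : TA G a₀ b := by
    rcases h.types ha₀ hb with t | t
    · exact t
    · exfalso
      have : G (-a₀, b) = G (-a₀, 0) :=
        Prod.ext ((h0.1 b hb.le).trans (h0.1 0 (by simp)).symm)
          ((t.1 b hb.le).trans (t.1 0 (by simp)).symm)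
      have := (Prod.ext_iff.mp (h.injG (pn (by simp [ha₀]) hb.le) (pn (by simp [ha₀]) (by simp)) this)).2
      simp only at this
      rw [this] at hb; simp at hb
  rcases h.types ha hb with t | t
  · exact t
  · exfalso
    have : G (a, -b) = G (0, -b) :=
      Prod.ext ((t.2 a ha.le).trans (t.2 0 (by simp)).symm)
        ((h1.2 a ha.le).trans (h1.2 0 (by simp)).symm)
    have := (Prod.ext_iff.mp (h.injG (pn ha.le (by simp [hb])) (pn (by simp) (by simp [hb])) this)).1
    simp only at this
    rw [this] at ha; simp at ha

end prod
end NE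

structure Core {X₁ Y₁ X₂ Y₂ : Type*} [NormedAddCommGroup X₁] [NormedAddCommGroup Y₁]
    [NormedAddCommGroup X₂] [NormedAddCommGroup Y₂]
    (F : X₁ × Y₁ → X₂ × Y₂) (G : X₂ × Y₂ → X₁ × Y₁) (α : X₂ → X₁) (β : Y₂ → Y₁) : Prop where
  ne : NE F G
  αn : ∀ a, ‖a‖ = 1 → ‖α a‖ = 1
  βn : ∀ a, ‖a‖ = 1 → ‖β a‖ = 1
  αo : ∀ a, ‖a‖ = 1 → α (-a) = -α a
  βo : ∀ a, ‖a‖ = 1 → β (-a) = -β a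
  αG : ∀ a d, ‖a‖ = 1 → ‖d‖ ≤ 1 → (G (a, d)).1 = α a
  βG : ∀ c b, ‖c‖ ≤ 1 → ‖b‖ = 1 → (G (c, b)).2 = β b

lemma ns {E : Type*} [NormedAddCommGroup E] [NormedSpace ℝ E] {x : E} (hx : ‖x‖ = 1) (t : ℝ) :
    ‖t • x‖ = |t| := by rw [norm_smul, hx, mul_one, Real.norm_eq_abs]

lemma dsub {E : Type*} [NormedAddCommGroup E] [NormedSpace ℝ E] {x : E} (hx : ‖x‖ = 1) {t : ℝ}
    (ht : |t| ≤ 1) : ‖t • x - x‖ ≤ 1 - t := by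
  rw [show t • x - x = (t - 1) • x by module, ns hx, abs_of_nonpos (by linarith [(abs_le.mp ht).2])]
  linarith

lemma dadd {E : Type*} [NormedAddCommGroup E] [NormedSpace ℝ E] {x : E} (hx : ‖x‖ = 1) {t : ℝ}
    (ht : |t| ≤ 1) : ‖t • x - -x‖ ≤ 1 + t := by
  rw [show t • x - -x = (t + 1) • x by module, ns hx, abs_of_nonneg (by linarith [(abs_le.mp ht).1])]
  linarith

namespace Core
section core
variable {X₁ Y₁ X₂ Y₂ : Type*}
  [NormedAddCommGroup X₁] [NormedSpace ℝ X₁] [StrictConvexSpace ℝ X₁]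
  [NormedAddCommGroup Y₁] [NormedSpace ℝ Y₁] [StrictConvexSpace ℝ Y₁]
  [NormedAddCommGroup X₂] [NormedSpace ℝ X₂] [StrictConvexSpace ℝ X₂]
  [NormedAddCommGroup Y₂] [NormedSpace ℝ Y₂] [StrictConvexSpace ℝ Y₂]
  [Nontrivial X₂] [Nontrivial Y₂]
  {F : X₁ × Y₁ → X₂ × Y₂} {G : X₂ × Y₂ → X₁ × Y₁} {α : X₂ → X₁} {β : Y₂ → Y₁}

lemma swap (h : Core F G α β) :
    Core (fun p : Y₁ × X₁ => (F p.swap).swap) (fun q : Y₂ × X₂ => (G q.swap).swap) β α where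
  ne := h.ne.swapD.swapC
  αn := h.βn
  βn := h.αn
  αo := h.βo
  βo := h.αo
  αG a d ha hd := h.βG d a hd ha
  βG c b hc hb := h.αG b c hb hc

lemma lip1 (h : Core F G α β) {p q : X₁ × Y₁} {r : ℝ} (hp : ‖p‖ ≤ 1) (hq : ‖q‖ ≤ 1)
    (hpq : ‖p - q‖ ≤ r) : ‖(F p).1 - (F q).1‖ ≤ r := pn1 ((h.ne.lip p q hp hq).trans hpq)

lemma lip2 (h : Core F G α β) {p q : X₁ × Y₁} {r : ℝ} (hp : ‖p‖ ≤ 1) (hq : ‖q‖ ≤ 1)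
    (hpq : ‖p - q‖ ≤ r) : ‖(F p).2 - (F q).2‖ ≤ r := pn2 ((h.ne.lip p q hp hq).trans hpq)

lemma c1 (h : Core F G α β) {a : X₂} {b : Y₂} (ha : ‖a‖ = 1) (hb : ‖b‖ = 1) :
    F (α a, β b) = (a, b) := by
  have : G (a, b) = (α a, β b) := Prod.ext (h.αG a b ha hb.le) (h.βG a b ha.le hb)
  rw [← this, h.ne.FG _ (pn ha.le hb.le)]

/-- second coordinate from endpoints -/
lemma sq2 (h : Core F G α β) {u : X₁} {a : X₂} {b : Y₂} (hu : ‖u‖ ≤ 1) (hb : ‖b‖ = 1)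
    {t : ℝ} (ht : |t| ≤ 1) (h1 : (F (u, β b)).2 = b) (h2 : (F (u, -β b)).2 = -b) :
    (F (u, t • β b)).2 = t • b := by
  have hbn := h.βn b hb
  have ht' := abs_le.mp ht
  have k1 := h.lip2 (p := (u, t • β b)) (q := (u, β b)) (r := 1 - t) (pn hu (by rw [ns hbn]; exact ht))
    (pn hu hbn.le) (by
      rw [Prod.mk_sub_mk, sub_self]
      exact pn (by simp; linarith) (dsub hbn ht))
  have k2 := h.lip2 (p := (u, t • β b)) (q := (u, -β b)) (r := 1 + t) (pn hu (by rw [ns hbn]; exact ht))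
    (pn hu (by simp [hbn])) (by
      rw [Prod.mk_sub_mk, sub_self]
      exact pn (by simp; linarith) (dadd hbn ht))
  rw [h1] at k1
  rw [h2, sub_neg_eq_add] at k2
  exact sc1 b _ 1 t hb zero_le_one (by simpa using k1) (by simpa using k2)

lemma c2 (h : Core F G α β) {a : X₂} {b : Y₂} (ha : ‖a‖ = 1) (hb : ‖b‖ = 1) {t : ℝ} (ht : |t| ≤ 1) :
    F (t • α a, t • β b) = (t • a, t • b) := by
  have han := h.αn a ha
  have hbn := h.βn b hb
  have hm : ‖(t • α a, t • β b)‖ ≤ 1 := pn (by rw [ns han]; exact ht) (by rw [ns hbn]; exact ht)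
  have e1 := h.c1 ha hb
  have e2 := h.c1 (a := -a) (b := -b) (by simpa) (by simpa)
  rw [h.αo a ha, h.βo b hb] at e2
  have d1 : ‖(t • α a, t • β b) - (α a, β b)‖ ≤ 1 - t := pn (dsub han ht) (dsub hbn ht)
  have d2 : ‖(t • α a, t • β b) - (-α a, -β b)‖ ≤ 1 + t := pn (dadd han ht) (dadd hbn ht)
  have m1 : ‖(α a, β b)‖ ≤ 1 := pn han.le hbn.le
  have m2 : ‖(-α a, -β b)‖ ≤ 1 := pn (by simp [han]) (by simp [hbn])
  have k1 := h.lip1 hm m1 d1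
  have k2 := h.lip1 hm m2 d2
  have l1 := h.lip2 hm m1 d1
  have l2 := h.lip2 hm m2 d2
  rw [e1] at k1 l1
  rw [e2, sub_neg_eq_add] at k2 l2
  exact Prod.ext (sc1 a _ 1 t ha zero_le_one (by simpa using k1) (by simpa using k2))
    (sc1 b _ 1 t hb zero_le_one (by simpa using l1) (by simpa using l2))

lemma c3 (h : Core F G α β) {a : X₂} {b : Y₂} (ha : ‖a‖ = 1) (hb : ‖b‖ = 1) {t : ℝ} (ht : |t| ≤ 1) :
    (F (α a, t • β b)).2 = t • b := by
  refine h.sq2 (a := a) (h.αn a ha).le hb ht (by rw [h.c1 ha hb]) ?_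
  rw [← h.βo b hb, h.c1 ha (by simpa)]

/-- points on the diagonal cone of the target come from the diagonal cone -/
lemma diag (h : Core F G α β) {u : X₁} {v : Y₁} (hu : ‖u‖ ≤ 1) (hv : ‖v‖ ≤ 1)
    (he : ‖(F (u, v)).1‖ = ‖(F (u, v)).2‖) :
    ∃ a b, ‖a‖ = 1 ∧ ‖b‖ = 1 ∧ (F (u, v)).1 = ‖(F (u, v)).1‖ • a ∧ 
      u = ‖(F (u, v)).1‖ • α a ∧ v = ‖(F (u, v)).1‖ • β b := by
  obtain ⟨a, ha, ha'⟩ := exists_unit (F (u, v)).1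
  obtain ⟨b, hb, hb'⟩ := exists_unit (F (u, v)).2
  rw [← he] at hb'
  have ht : |‖(F (u, v)).1‖| ≤ 1 := by simpa using pn1 (h.ne.mF _ (pn hu hv))
  have e := h.c2 ha hb ht
  rw [← ha', ← hb'] at e
  have := h.ne.injF (pn (by rw [ns (h.αn a ha)]; exact ht) (by rw [ns (h.βn b hb)]; exact ht))
    (pn hu hv) e
  rw [Prod.ext_iff] at this
  exact ⟨a, b, ha, hb, ha', this.1.symm, this.2.symm⟩

lemma cont (h : Core F G α β) : ContinuousOn F (closedBall 0 1) := by
  have : LipschitzOnWith 1 F (closedBall 0 1) := by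
    refine LipschitzOnWith.of_dist_le_mul fun p hp q hq => ?_
    rw [dist_eq_norm, dist_eq_norm, NNReal.coe_one, one_mul]
    exact h.ne.lip _ _ (by simpa using hp) (by simpa using hq)
  exact this.continuousOn

lemma c5 (h : Core F G α β) {a : X₂} {b : Y₂} (ha : ‖a‖ = 1) (hb : ‖b‖ = 1) {t : ℝ}
    (h0 : 0 ≤ t) (h1 : t < 1) : ‖(F (α a, t • β b)).1‖ ≠ t := by
  intro he
  have ht : |t| ≤ 1 := by rw [abs_of_nonneg h0]; exact h1.le
  have h2 := h.c3 ha hb ht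
  obtain ⟨a', b', ha', -, -, e, -⟩ := h.diag (u := α a) (v := t • β b) (h.αn a ha).le
    (by rw [ns (h.βn b hb)]; exact ht) (by rw [he, h2, ns hb, abs_of_nonneg h0])
  rw [he] at e
  have := congrArg norm e
  rw [h.αn a ha, ns (h.αn a' ha'), abs_of_nonneg h0] at this
  linarith

lemma c6 (h : Core F G α β) {a : X₂} {b : Y₂} (ha : ‖a‖ = 1) (hb : ‖b‖ = 1) {t : ℝ}
    (h0 : 0 ≤ t) (h1 : t < 1) : t < ‖(F (α a, t • β b)).1‖ := by
  by_contra hlt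
  rw [not_lt] at hlt
  have hc : ContinuousOn (fun s : ℝ => ‖(F (α a, s • β b)).1‖ - s) (Icc 0 t) := by
    refine ContinuousOn.sub ?_ continuousOn_id
    refine (continuous_fst.comp_continuousOn ?_).norm
    refine h.cont.comp (by fun_prop) ?_
    intro s hs
    rw [mem_closedBall_zero_iff]
    refine pn (h.αn a ha).le ?_
    rw [ns (h.βn b hb), abs_of_nonneg hs.1]; linarith [hs.2]
  obtain ⟨s, hs, e⟩ := intermediate_value_Icc' h0 hc (show (0:ℝ) ∈ _ from ⟨by simpa using hlt, by simp⟩)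
  exact h.c5 ha hb hs.1 (hs.2.trans_lt h1) (by simpa [sub_eq_zero] using e)

lemma c4 (h : Core F G α β) {b : Y₂} (hb : ‖b‖ = 1) {t : ℝ}
    (h0 : 0 ≤ t) (h1 : t ≤ 1) : (F (0, t • β b)).1 = 0 := by
  obtain ⟨a, ha⟩ := exists_norm_eq X₂ (zero_le_one (α := ℝ))
  have ht : |t| ≤ 1 := by rwa [abs_of_nonneg h0]
  have han := h.αn a ha
  have hbn := h.βn b hb
  have e1 := h.c2 ha hb ht
  have e2 := h.c2 (a := -a) (by simpa) hb ht
  rw [h.αo a ha] at e2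
  have hv : ‖t • β b‖ ≤ 1 := by rw [ns hbn]; exact ht
  have k1 := h.lip1 (p := (0, t • β b)) (q := (t • α a, t • β b)) (r := t) (pn (by simp) hv)
    (pn (by rw [ns han]; exact ht) hv) (by
      rw [Prod.mk_sub_mk, sub_self]
      exact pn (by rw [zero_sub, norm_neg, ns han, abs_of_nonneg h0]) (by simpa))
  have k2 := h.lip1 (p := (0, t • β b)) (q := (t • -α a, t • β b)) (r := t) (pn (by simp) hv)
    (pn (by rw [smul_neg, norm_neg, ns han]; exact ht) hv) (by
      rw [Prod.mk_sub_mk, sub_self]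
      exact pn (by rw [zero_sub, norm_neg, smul_neg, norm_neg, ns han, abs_of_nonneg h0]) (by simpa))
  rw [e1] at k1
  rw [e2] at k2
  have := sc1 a (F (0, t • β b)).1 t 0 ha h0 (by simpa using k1) (by simpa using k2)
  simpa using this

lemma c8 (h : Core F G α β) {v : Y₁} (hv : ‖v‖ ≤ 1) {u u' : X₁} (hu : ‖u‖ ≤ 1) (hu' : ‖u'‖ ≤ 1)
    (h1 : ‖(F (u, v)).1‖ < ‖(F (u, v)).2‖) (h2 : ‖(F (u', v)).2‖ < ‖(F (u', v)).1‖) :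
    ∃ b, ‖b‖ = 1 ∧ ∃ t : ℝ, 0 ≤ t ∧ v = t • β b := by
  have hc : ContinuousOn F (closedBall 0 1) := h.cont
  have hm : MapsTo (fun w : X₁ => (w, v)) (closedBall 0 1) (closedBall 0 1) := by
    intro w hw
    rw [mem_closedBall_zero_iff] at hw ⊢
    exact pn hw hv
  have hc2 : ContinuousOn (fun w : X₁ => F (w, v)) (closedBall 0 1) := hc.comp (by fun_prop) hm
  have hc3 : ContinuousOn (fun w : X₁ => ‖(F (w, v)).1‖ - ‖(F (w, v)).2‖) (closedBall 0 1) :=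
    (continuous_fst.comp_continuousOn hc2).norm.sub (continuous_snd.comp_continuousOn hc2).norm
  have hpc : IsPreconnected (closedBall (0 : X₁) 1) := (convex_closedBall 0 1).isPreconnected
  obtain ⟨w, hw, e⟩ := hpc.intermediate_value (by simpa using hu) (by simpa using hu') hc3
    (show (0:ℝ) ∈ _ from ⟨by simpa using h1.le, by simpa using h2.le⟩)
  obtain ⟨a, b, ha, hb, -, -, e2⟩ := h.diag (u := w) (by simpa using hw) hv
    (by simpa [sub_eq_zero] using e)
  exact ⟨b, hb, _, norm_nonneg _, e2⟩

lemma surj (h : Core F G α β) {v : Y₁} (hv : ‖v‖ = 1) : ∃ b, ‖b‖ = 1 ∧ v = β b := by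
  obtain ⟨a, ha⟩ := exists_norm_eq X₂ (zero_le_one (α := ℝ))
  obtain ⟨b₀, hb₀⟩ := exists_norm_eq Y₂ (zero_le_one (α := ℝ))
  have han := h.αn a ha
  have hF : ∀ u : X₁, ‖u‖ ≤ 1 → ContinuousOn (fun w : Y₁ => F (u, w)) (closedBall 0 1) := by
    intro u hu
    refine h.cont.comp (by fun_prop) ?_
    intro w hw
    rw [mem_closedBall_zero_iff] at hw ⊢
    exact pn hu hw
  set U : Set Y₁ := {w | w ≠ 0 ∧ ∃ b, ‖b‖ = 1 ∧ w = ‖w‖ • β b} with hU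
  have hUo : IsOpen U := by
    rw [isOpen_iff_mem_nhds]
    rintro w ⟨hw, b, hb, e⟩
    have hbn := h.βn b hb
    have hwn : ‖w‖ ≠ 0 := norm_ne_zero_iff.mpr hw
    have hψ : ContinuousAt (fun w : Y₁ => (2 * ‖w‖)⁻¹ • w) w := by
      refine ContinuousAt.smul (ContinuousAt.inv₀ (by fun_prop) (by simpa using hw)) continuousAt_id
    have hψw : (2 * ‖w‖)⁻¹ • w = (1/2 : ℝ) • β b := by
      conv_lhs => rw [e]
      rw [ns hbn, smul_smul, abs_norm]
      congr 1
      field_simp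
    have hnb : ‖(1/2 : ℝ) • β b‖ = 1/2 := by rw [ns hbn]; norm_num [abs_of_pos]
    have hint : closedBall (0 : Y₁) 1 ∈ 𝓝 ((1/2 : ℝ) • β b) := by
      refine mem_of_superset (isOpen_ball.mem_nhds ?_) (ball_subset_closedBall (x := (0:Y₁)) (ε := 1))
      rw [mem_ball_zero_iff, hnb]; norm_num
    have c0 := (hF 0 (by simp)).continuousAt hint
    have ca := (hF (α a) han.le).continuousAt hint
    have i0 : ‖(F (0, (1/2 : ℝ) • β b)).1‖ < ‖(F (0, (1/2 : ℝ) • β b)).2‖ := by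
      have e1 := h.c4 hb (t := 1/2) (by norm_num) (by norm_num)
      rw [e1, norm_zero, norm_pos_iff]
      intro e2
      have : F (0, (1/2 : ℝ) • β b) = F 0 := by rw [h.ne.F0]; exact Prod.ext e1 e2
      have := h.ne.injF (pn (by simp) (by rw [hnb]; norm_num)) (by simp) this
      have := congrArg norm (Prod.ext_iff.mp this).2
      simp only at this
      rw [hnb] at this
      norm_num at this
    have ia : ‖(F (α a, (1/2 : ℝ) • β b)).2‖ < ‖(F (α a, (1/2 : ℝ) • β b)).1‖ := by
      have := h.c6 ha hb (t := 1/2) (by norm_num) (by norm_num)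
      rw [h.c3 ha hb (t := 1/2) (by norm_num [abs_of_pos]), ns hb]
      rwa [abs_of_pos (by norm_num)]
    have v0 : ∀ᶠ y in 𝓝 ((1/2 : ℝ) • β b), ‖(F (0, y)).1‖ < ‖(F (0, y)).2‖ :=
      (c0.fst.norm).eventually_lt (c0.snd.norm) i0
    have va : ∀ᶠ y in 𝓝 ((1/2 : ℝ) • β b), ‖(F (α a, y)).2‖ < ‖(F (α a, y)).1‖ :=
      (ca.snd.norm).eventually_lt (ca.fst.norm) ia
    rw [← hψw] at v0 va
    have hne : ∀ᶠ y in 𝓝 w, y ≠ 0 := isOpen_ne.mem_nhds hw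
    filter_upwards [hψ.eventually v0, hψ.eventually va, hne] with y y0 ya hy
    refine ⟨hy, ?_⟩
    have hyn : ‖y‖ ≠ 0 := norm_ne_zero_iff.mpr hy
    have hyn2 : ‖(2 * ‖y‖)⁻¹ • y‖ = 1/2 := by
      rw [norm_smul, Real.norm_of_nonneg (by positivity)]; field_simp
    obtain ⟨b', hb', t, ht, et⟩ := h.c8 (by rw [hyn2]; norm_num) (by simp) han.le y0 ya
    have htt : t = 1/2 := by
      have := congrArg norm et
      rw [hyn2, ns (h.βn b' hb'), abs_of_nonneg ht] at this
      exact this.symm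
    refine ⟨b', hb', ?_⟩
    rw [htt] at et
    have := congrArg (fun z => (2 * ‖y‖) • z) et
    simp only [smul_smul] at this
    rw [mul_inv_cancel₀ (by positivity), one_smul] at this
    rw [this, ns (h.βn b' hb')]
    congr 1
    rw [abs_of_nonneg (by positivity)]
  have hchar : ∀ w : Y₁, w ≠ 0 → (w ∈ U ↔ ‖(F (α a, ‖w‖⁻¹ • w)).2‖ = 1) := by
    intro w hw
    have hwn : ‖w‖ ≠ 0 := norm_ne_zero_iff.mpr hw
    constructor
    · rintro ⟨-, b, hb, e⟩
      have : ‖w‖⁻¹ • w = β b := by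
        nth_rw 2 [e]; rw [smul_smul, inv_mul_cancel₀ hwn, one_smul]
      rw [this, h.c1 ha hb]; exact hb
    · intro e
      have hm : ‖(α a, ‖w‖⁻¹ • w)‖ ≤ 1 := pn han.le (by
        rw [norm_smul, norm_inv, norm_norm, inv_mul_cancel₀ hwn])
      refine ⟨hw, _, e, ?_⟩
      have := h.βG (F (α a, ‖w‖⁻¹ • w)).1 _ (pn1 (h.ne.mF _ hm)) e
      rw [Prod.mk.eta, h.ne.GF _ hm] at this
      rw [← this, smul_smul, mul_inv_cancel₀ hwn, one_smul]
  set V : Set Y₁ := {w | w ≠ 0 ∧ w ∉ U} with hV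
  have hVo : IsOpen V := by
    have hc : ContinuousOn (fun w : Y₁ => ‖(F (α a, ‖w‖⁻¹ • w)).2‖) {0}ᶜ := by
      refine (continuous_snd.comp_continuousOn ((hF _ han.le).comp ?_ ?_)).norm
      · exact ContinuousOn.smul (ContinuousOn.inv₀ (by fun_prop) (fun x hx => norm_ne_zero_iff.mpr hx))
          continuousOn_id
      · intro x hx
        have hxn : ‖x‖ ≠ 0 := norm_ne_zero_iff.mpr hx
        rw [mem_closedBall_zero_iff, norm_smul, norm_inv, norm_norm, inv_mul_cancel₀ hxn]
    have := hc.isOpen_inter_preimage isOpen_compl_singleton (isOpen_compl_singleton (x := (1:ℝ)))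
    convert this using 1
    ext w
    constructor
    · rintro ⟨h1, h2⟩
      exact ⟨h1, fun h3 => h2 ((hchar w h1).mpr h3)⟩
    · rintro ⟨h1, h2⟩
      exact ⟨h1, fun h3 => h2 ((hchar w h1).mp h3)⟩
  have hbn₀ := h.βn b₀ hb₀
  by_cases hanti : v = -β b₀
  · exact ⟨-b₀, by simpa, by rw [h.βo b₀ hb₀, hanti]⟩
  have hseg0 : ∀ w ∈ segment ℝ (β b₀) v, w ≠ 0 := by
    rintro w ⟨s, t, hs, ht, hst, rfl⟩ e0
    apply hanti
    have e1 : s • β b₀ = -(t • v) := eq_neg_of_add_eq_zero_left e0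
    have e2 := congrArg norm e1
    rw [norm_neg, ns hbn₀, ns hv, abs_of_nonneg hs, abs_of_nonneg ht] at e2
    have hs2 : s = 1/2 := by linarith
    have ht2 : t = 1/2 := by linarith
    rw [hs2, ht2] at e1
    have := congrArg (fun z => (2:ℝ) • z) e1
    simp only [smul_neg, smul_smul] at this
    norm_num at this
    rw [this, neg_neg]
  have hsub : segment ℝ (β b₀) v ⊆ U := by
    refine IsPreconnected.subset_left_of_subset_union hUo hVo ?_ ?_ ?_
      (convex_segment _ _).isPreconnected
    · rw [Set.disjoint_left]; intro w h1 h2; exact h2.2 h1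
    · intro w hw
      by_cases hwU : w ∈ U
      · exact Or.inl hwU
      · exact Or.inr ⟨hseg0 w hw, hwU⟩
    · refine ⟨β b₀, left_mem_segment _ _ _, hseg0 _ (left_mem_segment _ _ _), b₀, hb₀, ?_⟩
      rw [hbn₀, one_smul]
  obtain ⟨-, b, hb, e⟩ := hsub (right_mem_segment ℝ (β b₀) v)
  exact ⟨b, hb, by rwa [hv, one_smul] at e⟩

lemma rep2 [Nontrivial Y₁] (h : Core F G α β) (v : Y₁) : ∃ b, ‖b‖ = 1 ∧ v = ‖v‖ • β b := by
  obtain ⟨e, he, hve⟩ := exists_unit v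
  obtain ⟨b, hb, rfl⟩ := h.surj he
  exact ⟨b, hb, hve⟩

lemma c12 [Nontrivial Y₁] (h : Core F G α β) {a : X₂} {b : Y₂} (ha : ‖a‖ = 1) (hb : ‖b‖ = 1) {t : ℝ}
    (h0 : 0 ≤ t) (h1 : t ≤ 1) : F (α a, t • β b) = (a, t • b) := by
  have ht : |t| ≤ 1 := by rwa [abs_of_nonneg h0]
  have hm : ‖(a, t • b)‖ ≤ 1 := pn ha.le (by rwa [ns hb])
  have e1 := h.αG a (t • b) ha (by rwa [ns hb])
  have hv := pn2 (h.ne.mG _ hm)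
  obtain ⟨b', hb', e⟩ := h.rep2 (G (a, t • b)).2
  have e2 : G (a, t • b) = (α a, ‖(G (a, t • b)).2‖ • β b') := Prod.ext e1 e
  have e3 := h.ne.FG _ hm
  rw [e2] at e3
  have e4 := h.c3 ha hb' (t := ‖(G (a, t • b)).2‖) (by simpa using hv)
  rw [e3] at e4
  simp only at e4
  have e5 := congrArg norm e4
  rw [ns hb, ns hb', abs_of_nonneg h0, abs_norm] at e5
  rw [← e5] at e3 e4
  rcases h0.eq_or_lt with rfl | hpos
  · simpa using e3
  · have : b = b' := smul_right_injective _ hpos.ne' e4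
    rw [this]; rw [this] at e3; exact e3

lemma c13 [Nontrivial Y₁] [Nontrivial X₁] (h : Core F G α β) {a : X₂} {b : Y₂} (ha : ‖a‖ = 1)
    (hb : ‖b‖ = 1) {s t : ℝ} (hs : 0 ≤ s) (hs1 : s ≤ 1)
    (h0 : 0 ≤ t) (h1 : t ≤ 1) : (F (s • α a, t • β b)).2 = t • b := by
  have hsn : ‖s • α a‖ ≤ 1 := by rwa [ns (h.αn a ha), abs_of_nonneg hs]
  have k1 := h.swap.c12 hb ha hs hs1
  have k2 := h.swap.c12 (a := -b) (by simpa) ha hs hs1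
  simp only [Prod.swap_prod_mk] at k1 k2
  refine h.sq2 (a := a) hsn hb (by rwa [abs_of_nonneg h0]) ?_ ?_
  · exact (Prod.ext_iff.mp k1).1
  · rw [← h.βo b hb]; exact (Prod.ext_iff.mp k2).1

lemma c14 [Nontrivial Y₁] [Nontrivial X₁] (h : Core F G α β) {u : X₁} {v : Y₁} (hu : ‖u‖ ≤ 1)
    (hv : ‖v‖ ≤ 1) : (F (u, v)).2 = (F (0, v)).2 := by
  obtain ⟨a, ha, e⟩ := h.swap.rep2 u
  obtain ⟨b, hb, e'⟩ := h.rep2 v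
  have k1 := h.c13 ha hb (norm_nonneg u) hu (norm_nonneg v) hv
  have k2 := h.c13 ha hb le_rfl zero_le_one (norm_nonneg v) hv
  rw [← e, ← e'] at k1
  rw [zero_smul, ← e'] at k2
  rw [k1, k2]

lemma isom2 [Nontrivial Y₁] [Nontrivial X₁] (h : Core F G α β) {p q : X₁ × Y₁} (hp : ‖p‖ ≤ 1)
    (hq : ‖q‖ ≤ 1) : ‖(F p).2 - (F q).2‖ = ‖p.2 - q.2‖ := by
  have := isom_ball (fun v => (F (0, v)).2) ?_ ?_ ?_ p.2 q.2 (pn2 hp) (pn2 hq)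
  · rw [← h.c14 (pn1 hp) (pn2 hp), ← h.c14 (pn1 hq) (pn2 hq)] at this
    exact this
  · intro v hv
    obtain ⟨a, ha⟩ := exists_norm_eq X₂ (zero_le_one (α := ℝ))
    obtain ⟨b, hb, e'⟩ := h.rep2 v
    have k2 := h.c13 ha hb le_rfl zero_le_one (norm_nonneg v) hv
    rw [zero_smul, ← e'] at k2
    rw [k2, ns hb, abs_norm]
  · intro v r hv hr
    obtain ⟨a, ha⟩ := exists_norm_eq X₂ (zero_le_one (α := ℝ))
    obtain ⟨b, hb, e'⟩ := h.rep2 v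
    have k2 := h.c13 ha hb le_rfl zero_le_one (norm_nonneg v) hv
    rw [zero_smul, ← e'] at k2
    have hrv : |r| * ‖v‖ ≤ 1 := mul_le_one₀ hr (norm_nonneg _) hv
    rw [k2]
    rcases le_total 0 r with h0 | h0
    · rw [abs_of_nonneg h0] at hrv
      have k3 := h.c13 ha hb le_rfl zero_le_one (mul_nonneg h0 (norm_nonneg v)) hrv
      rw [zero_smul, mul_smul, ← e', mul_smul] at k3
      exact k3
    · rw [abs_of_nonpos h0] at hrv
      have k3 := h.c13 ha (b := -b) (by simpa) le_rfl zero_le_one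
        (mul_nonneg (neg_nonneg.mpr h0) (norm_nonneg v)) hrv
      rw [zero_smul, h.βo b hb, mul_smul, smul_neg, smul_neg, neg_smul, neg_neg, ← e', mul_smul,
        smul_neg, neg_smul, smul_neg, neg_neg] at k3
      exact k3
  · intro u v hu hv
    refine h.lip2 (pn (by simp) hu) (pn (by simp) hv) ?_
    rw [Prod.mk_sub_mk, sub_self]
    exact pn (by simp) le_rfl

lemma isom [Nontrivial Y₁] [Nontrivial X₁] (h : Core F G α β) {p q : X₁ × Y₁} (hp : ‖p‖ ≤ 1)
    (hq : ‖q‖ ≤ 1) : ‖F p - F q‖ = ‖p - q‖ := by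
  have k2 := h.isom2 hp hq
  have k1 := h.swap.isom2 (p := p.swap) (q := q.swap) (by rwa [swap_norm]) (by rwa [swap_norm])
  simp only [Prod.swap_swap, Prod.snd_swap] at k1
  rw [Prod.norm_def, Prod.norm_def, Prod.fst_sub, Prod.snd_sub, Prod.fst_sub, Prod.snd_sub, k1, k2]

end core
end Core

section fin
variable {X₁ Y₁ X₂ Y₂ : Type*}
  [NormedAddCommGroup X₁] [NormedSpace ℝ X₁] [StrictConvexSpace ℝ X₁]
  [NormedAddCommGroup Y₁] [NormedSpace ℝ Y₁] [StrictConvexSpace ℝ Y₁]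
  [NormedAddCommGroup X₂] [NormedSpace ℝ X₂] [StrictConvexSpace ℝ X₂]
  [NormedAddCommGroup Y₂] [NormedSpace ℝ Y₂] [StrictConvexSpace ℝ Y₂]
  [Nontrivial X₂] [Nontrivial Y₂] [Nontrivial X₁] [Nontrivial Y₁]
  {F : X₁ × Y₁ → X₂ × Y₂} {G : X₂ × Y₂ → X₁ × Y₁}

lemma NE.isomA (h : NE F G) {a₀ : X₂} {b₀ : Y₂} (ha₀ : ‖a₀‖ = 1) (hb₀ : ‖b₀‖ = 1)
    (h0 : NE.TA G a₀ b₀) {p q : X₁ × Y₁} (hp : ‖p‖ ≤ 1)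
    (hq : ‖q‖ ≤ 1) : ‖F p - F q‖ = ‖p - q‖ := by
  have hA : ∀ a b, ‖a‖ = 1 → ‖b‖ = 1 → NE.TA G a b := fun a b ha hb => h.global ha₀ hb₀ h0 ha hb
  have o1 : ∀ a d, ‖a‖ = 1 → ‖d‖ ≤ 1 → (G (-a, d)).1 = -(G (a, b₀)).1 := fun a d ha hd =>
    (hA a b₀ ha hb₀).1 d hd
  have o2 : ∀ c b, ‖c‖ ≤ 1 → ‖b‖ = 1 → (G (c, -b)).2 = -(G (a₀, b)).2 := fun c b hc hb =>
    (hA a₀ b ha₀ hb).2 c hc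
  have : Core F G (fun a => (G (a, b₀)).1) (fun b => (G (a₀, b)).2) :=
    { ne := h
      αn := fun a ha => h.ext1 ha hb₀
      βn := fun b hb => h.ext2 ha₀ hb
      αo := fun a ha => o1 a b₀ ha hb₀.le
      βo := fun b hb => o2 a₀ b ha₀.le hb
      αG := fun a d ha hd => by
        have k1 := o1 (-a) d (by simpa) hd
        have k2 := o1 (-a) b₀ (by simpa) hb₀.le
        rw [neg_neg] at k1 k2
        rw [k1, k2]
      βG := fun c b hc hb => by
        have k1 := o2 c (-b) hc (by simpa)
        have k2 := o2 a₀ (-b) ha₀.le (by simpa)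
        rw [neg_neg] at k1 k2
        rw [k1, k2] }
  exact this.isom hp hq

lemma NE.isomP (h : NE F G) {p q : X₁ × Y₁} (hp : ‖p‖ ≤ 1)
    (hq : ‖q‖ ≤ 1) : ‖F p - F q‖ = ‖p - q‖ := by
  obtain ⟨a, ha⟩ := exists_norm_eq X₂ (zero_le_one (α := ℝ))
  obtain ⟨b, hb⟩ := exists_norm_eq Y₂ (zero_le_one (α := ℝ))
  rcases h.types ha hb with t | t
  · exact h.isomA ha hb t hp hq
  · have k := h.swapD.isomA (p := p.swap) (q := q.swap) ha hb t (by rwa [swap_norm]) (by rwa [swap_norm])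
    rw [show p.swap - q.swap = (p - q).swap from rfl, swap_norm] at k
    simpa using k

end fin

lemma NE.isomT {X Y : Type*} [NormedAddCommGroup X]
    [NormedAddCommGroup Y] [NormedSpace ℝ Y] [StrictConvexSpace ℝ Y] [Subsingleton X]
    {F G : X × Y → X × Y} (h : NE F G) {p q : X × Y} (hp : ‖p‖ ≤ 1)
    (hq : ‖q‖ ≤ 1) : ‖F p - F q‖ = ‖p - q‖ := by
  have hn : ∀ z : X × Y, ‖z‖ = ‖z.2‖ := by
    intro z
    rw [Prod.norm_def, Subsingleton.elim z.1 0, norm_zero]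
    exact max_eq_right (norm_nonneg _)
  have he : ∀ z : X × Y, ((0 : X), z.2) = z := fun z => Prod.ext (Subsingleton.elim _ _) rfl
  have h' : NE (fun y : Y => (F (0, y)).2) (fun y : Y => (G (0, y)).2) :=
    { mF := fun y hy => by rw [← hn]; exact h.mF _ (by rwa [hn])
      mG := fun y hy => by rw [← hn]; exact h.mG _ (by rwa [hn])
      FG := fun y hy => by simp only [he]; rw [h.FG _ (by rwa [hn])]
      GF := fun y hy => by simp only [he]; rw [h.GF _ (by rwa [hn])]
      lip := fun y z hy hz => by
        have := h.lip (0, y) (0, z) (by rwa [hn]) (by rwa [hn])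
        rwa [hn, hn] at this }
  have := h'.strict p.2 q.2 (by rwa [← hn]) (by rwa [← hn])
  simp only [he] at this
  rw [hn, hn (p - q)]
  exact this


/-- Let X and Y be strictly convex real Banach spaces. Then the closed unit ball
of Z = X ⊕_∞ Y (the product with the max norm) is plastic: every non-expansive
bijection of the ball onto itself is an isometry. -/
theorem plastic_ball_linf_sum_strictly_convex
    (X Y : Type*) [NormedAddCommGroup X] [NormedSpace ℝ X] [CompleteSpace X]
    [NormedAddCommGroup Y] [NormedSpace ℝ Y] [CompleteSpace Y]
    [StrictConvexSpace ℝ X] [StrictConvexSpace ℝ Y]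
    (B : Set (X × Y)) (hB : B = Metric.closedBall (0 : X × Y) 1)
    (F : X × Y → X × Y) (hbij : Set.BijOn F B B) (hne : LipschitzOnWith 1 F B) :
    ∀ x ∈ B, ∀ y ∈ B, dist (F x) (F y) = dist x y := by
  subst hB
  have hm : ∀ p : X × Y, p ∈ closedBall (0 : X × Y) 1 ↔ ‖p‖ ≤ 1 := fun p => mem_closedBall_zero_iff
  have h : NE F (Function.invFunOn F (closedBall (0 : X × Y) 1)) :=
    { mF := fun p hp => (hm _).mp (hbij.mapsTo ((hm _).mpr hp))
      mG := fun q hq => (hm _).mp (hbij.surjOn.mapsTo_invFunOn ((hm _).mpr hq))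
      FG := fun q hq => hbij.surjOn.rightInvOn_invFunOn ((hm _).mpr hq)
      GF := fun p hp => hbij.injOn.leftInvOn_invFunOn ((hm _).mpr hp)
      lip := fun p q hp hq => by
        have := hne.dist_le_mul p ((hm _).mpr hp) q ((hm _).mpr hq)
        rwa [NNReal.coe_one, one_mul, dist_eq_norm, dist_eq_norm] at this }
  intro p hp q hq
  rw [hm] at hp hq
  rw [dist_eq_norm, dist_eq_norm]
  rcases subsingleton_or_nontrivial X with hX | hX
  · exact h.isomT hp hq
  rcases subsingleton_or_nontrivial Y with hY | hY
  · have k := h.swapD.swapC.isomT (p := p.swap) (q := q.swap) (by rwa [swap_norm]) (by rwa [swap_norm])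
    rw [show p.swap - q.swap = (p - q).swap from rfl, swap_norm] at k
    simp only [Prod.swap_swap] at k
    rwa [show (F p).swap - (F q).swap = (F p - F q).swap from rfl, swap_norm] at k
  exact h.isomP hp hq
end

section
/- Let X be a real Banach space and let F : B_X → B_X be a non-expansive bijection of the closed unit ball onto itself. Then F(0) = 0. -/
/-- A non-expansive bijection of the closed unit ball of a real Banach space
onto itself maps 0 to 0. -/
theorem nonexpansive_bijection_fixes_zero
    (X : Type*) [NormedAddCommGroup X] [NormedSpace ℝ X] [CompleteSpace X]
    (B : Set X) (hB : B = Metric.closedBall (0 : X) 1)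
    (F : X → X) (hbij : Set.BijOn F B B) (hne : LipschitzOnWith 1 F B) :
    F 0 = 0 := by
  subst hB
  by_contra h
  have hn : 0 < ‖F 0‖ := norm_pos_iff.mpr h
  have hy : -(‖F 0‖⁻¹ • F 0) ∈ Metric.closedBall (0 : X) 1 := by
    rw [mem_closedBall_zero_iff, norm_neg, norm_smul, norm_inv, norm_norm,
      inv_mul_cancel₀ hn.ne']
  obtain ⟨x, hx, hFx⟩ := hbij.surjOn hy
  have h0 : (0 : X) ∈ Metric.closedBall (0 : X) 1 := by simp
  have h1 := hne.dist_le_mul 0 h0 x hx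
  rw [hFx, dist_eq_norm, dist_zero_left, sub_neg_eq_add] at h1
  have h2 : F 0 + ‖F 0‖⁻¹ • F 0 = (1 + ‖F 0‖⁻¹) • F 0 := by
    rw [add_smul, one_smul]
  have h3 : (0 : ℝ) ≤ 1 + ‖F 0‖⁻¹ := by positivity
  rw [h2, norm_smul, Real.norm_of_nonneg h3, add_mul, inv_mul_cancel₀ hn.ne'] at h1
  have h4 := mem_closedBall_zero_iff.mp hx
  simp only [NNReal.coe_one, one_mul] at h1
  linarith
end

section
/- Let X be a real Banach space and let F : B_X → B_X be a non-expansive bijection of the closed unit ball onto itself. Then for every x ∈ B_X one has ‖F(x)‖ ≤ ‖x‖. -/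
/-- A non-expansive bijection of the closed unit ball of a real Banach space
onto itself satisfies ‖F(x)‖ ≤ ‖x‖ for every x in the ball. -/
theorem nonexpansive_bijection_norm_le
    (X : Type*) [NormedAddCommGroup X] [NormedSpace ℝ X] [CompleteSpace X]
    (B : Set X) (hB : B = Metric.closedBall (0 : X) 1)
    (F : X → X) (hbij : Set.BijOn F B B) (hne : LipschitzOnWith 1 F B) :
    ∀ x ∈ B, ‖F x‖ ≤ ‖x‖ := by
  have h0 : (0 : X) ∈ B := by simp [hB]
  have key : ∀ x ∈ B, ‖F x - F 0‖ ≤ ‖x‖ := by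
    intro x hx
    have h := hne.dist_le_mul x hx 0 h0
    simpa [dist_eq_norm] using h
  have hF0 : F 0 = 0 := by
    by_contra hc
    have hn : 0 < ‖F 0‖ := norm_pos_iff.mpr hc
    have hu : (-(‖F 0‖⁻¹)) • F 0 ∈ B := by
      rw [hB, mem_closedBall_zero_iff, norm_smul, norm_neg, norm_inv, norm_norm,
        inv_mul_cancel₀ hn.ne']
    obtain ⟨x, hx, hFx⟩ := hbij.surjOn hu
    have h1 := key x hx
    have hx1 : ‖x‖ ≤ 1 := by
      rw [hB, mem_closedBall_zero_iff] at hx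
      exact hx
    have e : F x - F 0 = (-(‖F 0‖⁻¹ + 1)) • F 0 := by
      rw [hFx]
      module
    have hp : 0 < ‖F 0‖⁻¹ + 1 := by positivity
    rw [e, norm_smul, norm_neg, Real.norm_of_nonneg hp.le, add_mul,
      inv_mul_cancel₀ hn.ne'] at h1
    linarith
  intro x hx
  simpa [hF0] using key x hx
end

section
/- Let X be a real Banach space and let F : B_X → B_X be a non-expansive bijection of the closed unit ball onto itself. If x lies on the unit sphere S_X, then F⁻¹(x) also lies on S_X. -/
/-- If F is a non-expansive bijection of the closed unit ball of a real Banach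
space onto itself and x lies on the unit sphere, then F⁻¹(x) lies on the unit
sphere as well (i.e., every preimage of x under F lying in the ball is on the
sphere). -/
theorem nonexpansive_bijection_preimage_of_sphere_mem_sphere
    (X : Type*) [NormedAddCommGroup X] [NormedSpace ℝ X] [CompleteSpace X]
    (B : Set X) (hB : B = Metric.closedBall (0 : X) 1)
    (F : X → X) (hbij : Set.BijOn F B B) (hne : LipschitzOnWith 1 F B)
    (x : X) (hx : x ∈ Metric.sphere (0 : X) 1) :
    ∀ y ∈ B, F y = x → y ∈ Metric.sphere (0 : X) 1 := by
  subst hB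
  intro y hy hFy
  have h0 : (0 : X) ∈ Metric.closedBall (0 : X) 1 := by simp
  have key : ∀ w ∈ Metric.closedBall (0 : X) 1, ‖F w - F 0‖ ≤ ‖w‖ := by
    intro w hw
    have h := hne.dist_le_mul w hw 0 h0
    simpa [dist_eq_norm] using h
  have hF0 : F 0 = 0 := by
    by_contra hv
    have hpos : 0 < ‖F 0‖ := norm_pos_iff.mpr hv
    have hu : -(‖F 0‖⁻¹ • F 0) ∈ Metric.closedBall (0 : X) 1 := by
      rw [mem_closedBall_zero_iff, norm_neg, norm_smul, norm_inv, norm_norm,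
        inv_mul_cancel₀ hpos.ne']
    obtain ⟨w, hw, hwu⟩ := hbij.surjOn hu
    have h1 := (key w hw).trans (mem_closedBall_zero_iff.mp hw)
    have h2 : F w - F 0 = -((‖F 0‖⁻¹ + 1) • F 0) := by
      rw [hwu, add_smul, one_smul]; abel
    rw [h2, norm_neg, norm_smul, Real.norm_of_nonneg (by positivity), add_mul,
      inv_mul_cancel₀ hpos.ne'] at h1
    linarith
  have h := key y hy
  rw [hF0, sub_zero, hFy, mem_sphere_zero_iff_norm.mp hx] at h
  exact mem_sphere_zero_iff_norm.mpr (le_antisymm (mem_closedBall_zero_iff.mp hy) h)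
end

section
/- Let X be a real Banach space and let F : B_X → B_X be a non-expansive bijection of the closed unit ball onto itself. If x is an extreme point of B_X, then F⁻¹(x) is an extreme point of B_X and, moreover, F⁻¹(αx) = αF⁻¹(x) for every α ∈ [-1,1]. -/
theorem ext_aux {X : Type*} [NormedAddCommGroup X] [NormedSpace ℝ X] {x p : X}
    (hx : x ∈ Set.extremePoints ℝ (Metric.closedBall (0 : X) 1)) {a b : ℝ} (ha : 0 < a) (hb : 0 < b)
    (hab : a + b = 1) (h1 : ‖p‖ ≤ a) (h2 : ‖x - p‖ ≤ b) : p = a • x := by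
  have h := hx.2 (x₁ := a⁻¹ • p) (x₂ := b⁻¹ • (x - p)) ?_ ?_ ⟨a, b, ha, hb, hab, ?_⟩
  · rw [← h, smul_inv_smul₀ ha.ne']
  · rw [mem_closedBall_zero_iff, norm_smul, norm_inv, Real.norm_of_nonneg ha.le]
    exact inv_mul_le_one_of_le₀ h1 ha.le
  · rw [mem_closedBall_zero_iff, norm_smul, norm_inv, Real.norm_of_nonneg hb.le]
    exact inv_mul_le_one_of_le₀ h2 hb.le
  · rw [smul_inv_smul₀ ha.ne', smul_inv_smul₀ hb.ne']; abel

/-- If F is a non-expansive bijection of the closed unit ball of a real Banach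
space onto itself and x is an extreme point of the ball, then F⁻¹(x) (i.e. the
unique preimage y ∈ B of x) is an extreme point of the ball, and moreover
F⁻¹(αx) = αF⁻¹(x) for every α ∈ [-1,1] (i.e. the unique preimage in B of α • x
is α • y). -/
theorem nonexpansive_bijection_preimage_extreme
    (X : Type*) [NormedAddCommGroup X] [NormedSpace ℝ X] [CompleteSpace X]
    (B : Set X) (hB : B = Metric.closedBall (0 : X) 1)
    (F : X → X) (hbij : Set.BijOn F B B) (hne : LipschitzOnWith 1 F B)
    (x : X) (hx : x ∈ Set.extremePoints ℝ B) :
    ∀ y ∈ B, F y = x →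
      y ∈ Set.extremePoints ℝ B ∧
        ∀ α ∈ Set.Icc (-1 : ℝ) 1, ∀ w ∈ B, F w = α • x → w = α • y := by
  subst hB
  have nb : ∀ {z : X}, z ∈ Metric.closedBall (0 : X) 1 ↔ ‖z‖ ≤ 1 := mem_closedBall_zero_iff
  have lip : ∀ u v : X, ‖u‖ ≤ 1 → ‖v‖ ≤ 1 → ‖F u - F v‖ ≤ ‖u - v‖ := by
    intro u v hu hv
    have := hne.dist_le_mul u (nb.2 hu) v (nb.2 hv)
    simpa [dist_eq_norm] using this
  have h00 : ‖(0 : X)‖ ≤ 1 := by simp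
  have F0 : F 0 = 0 := by
    by_contra h
    have hpos : 0 < ‖F 0‖ := norm_pos_iff.2 h
    have hn : ‖-(‖F 0‖⁻¹ • F 0)‖ ≤ 1 := by
      rw [norm_neg, norm_smul, norm_inv, norm_norm, inv_mul_cancel₀ hpos.ne']
    obtain ⟨u, hu, hFu⟩ := hbij.surjOn (nb.2 hn)
    have h1 := lip u 0 (nb.1 hu) h00
    have h2 := nb.1 hu
    have h3 : F u - F 0 = -((‖F 0‖⁻¹ + 1) • F 0) := by
      rw [hFu, add_smul, one_smul]; abel
    rw [h3, norm_neg, norm_smul, Real.norm_of_nonneg (by positivity), add_mul,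
      inv_mul_cancel₀ hpos.ne', sub_zero] at h1
    linarith
  have inj : ∀ u v : X, ‖u‖ ≤ 1 → ‖v‖ ≤ 1 → F u = F v → u = v :=
    fun u v hu hv h => hbij.injOn (nb.2 hu) (nb.2 hv) h
  -- key lemma
  have key : ∀ x' ∈ Set.extremePoints ℝ (Metric.closedBall (0 : X) 1), ∀ y : X, ‖y‖ ≤ 1 → F y = x' →
      ∀ (a b : ℝ), 0 < a → 0 < b → a + b = 1 → ∀ p : X, ‖p‖ ≤ a → ‖y - p‖ ≤ b →
        F p = a • x' := by
    intro x' hx' y hy hFy a b ha hb hab p hp hyp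
    have hp1 : ‖p‖ ≤ 1 := by linarith
    refine ext_aux hx' ha hb hab ?_ ?_
    · have := lip p 0 hp1 h00
      rw [F0, sub_zero, sub_zero] at this
      linarith
    · have := lip y p hy hp1
      rw [hFy] at this
      linarith
  have nsm : ∀ (a : ℝ) (u : X), 0 ≤ a → ‖u‖ ≤ 1 → ‖a • u‖ ≤ a := by
    intro a u ha hu
    rw [norm_smul, Real.norm_of_nonneg ha]
    exact mul_le_of_le_one_right ha hu
  have lin : ∀ x' ∈ Set.extremePoints ℝ (Metric.closedBall (0 : X) 1), ∀ y : X, ‖y‖ ≤ 1 → F y = x' →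
      ∀ a : ℝ, 0 ≤ a → a ≤ 1 → F (a • y) = a • x' := by
    intro x' hx' y hy hFy a ha ha1
    rcases ha.eq_or_lt with rfl | ha
    · simpa using F0
    rcases ha1.eq_or_lt with rfl | ha1
    · simpa using hFy
    refine key x' hx' y hy hFy a (1 - a) ha (by linarith) (by ring) _ (nsm a y ha.le hy) ?_
    have : y - a • y = (1 - a) • y := by rw [sub_smul, one_smul]
    rw [this]
    exact nsm _ _ (by linarith) hy
  intro y hyB hFy
  have hy := nb.1 hyB
  refine ⟨⟨hyB, ?_⟩, ?_⟩
  · rintro u hu v hv ⟨a, b, ha, hb, hab, huv⟩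
    have hu := nb.1 hu
    have hv := nb.1 hv
    have e1 : F (a • u) = a • x := by
      refine key x hx y hy hFy a b ha hb hab _ (nsm a u ha.le hu) ?_
      rw [← huv, add_sub_cancel_left]
      exact nsm b v hb.le hv
    have e2 := lin x hx y hy hFy a ha.le (by linarith)
    have e3 := inj _ _ ((nsm a u ha.le hu).trans (by linarith))
      ((nsm a y ha.le hy).trans (by linarith)) (e1.trans e2.symm)
    exact smul_right_injective X ha.ne' e3
  · have hx1 := nb.1 hx.1
    have hnx : -x ∈ Set.extremePoints ℝ (Metric.closedBall (0 : X) 1) := by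
      refine ⟨nb.2 (by rwa [norm_neg]), ?_⟩
      rintro u hu v hv ⟨a, b, ha, hb, hab, huv⟩
      have := hx.2 (x₁ := -u) (x₂ := -v) (nb.2 (by rw [norm_neg]; exact nb.1 hu))
        (nb.2 (by rw [norm_neg]; exact nb.1 hv))
        ⟨a, b, ha, hb, hab, by rw [smul_neg, smul_neg, ← neg_add, huv, neg_neg]⟩
      rw [← this, neg_neg]
    obtain ⟨z, hzB, hFz⟩ := hbij.surjOn hnx.1
    have hz := nb.1 hzB
    have hzy : z = -y := by
      set m : X := (1 / 2 : ℝ) • (y + z) with hm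
      have hyz : ‖y + z‖ ≤ 2 := (norm_add_le _ _).trans (by linarith)
      have hyz' : ‖y - z‖ ≤ 2 := (norm_sub_le _ _).trans (by linarith)
      have half : ∀ t : X, ‖t‖ ≤ 2 → ‖(1 / 2 : ℝ) • t‖ ≤ 1 := by
        intro t ht
        rw [norm_smul, Real.norm_of_nonneg (by norm_num)]
        linarith
      have hm1 : ‖m‖ ≤ 1 := half _ hyz
      have d1 : ‖x - F m‖ ≤ 1 := by
        have h := lip y m hy hm1
        have e : y - m = (1 / 2 : ℝ) • (y - z) := by rw [hm]; module
        rw [hFy, e] at h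
        exact h.trans (half _ hyz')
      have d2 : ‖x + F m‖ ≤ 1 := by
        have h := lip m z hm1 hz
        have e : m - z = (1 / 2 : ℝ) • (y - z) := by rw [hm]; module
        rw [hFz, e, sub_neg_eq_add, add_comm] at h
        exact h.trans (half _ hyz')
      have h := hx.2 (nb.2 d1) (nb.2 d2)
        ⟨1 / 2, 1 / 2, by norm_num, by norm_num, by norm_num, by module⟩
      have hF : F m = 0 := by simpa using h
      have m0 : m = 0 := inj m 0 hm1 h00 (hF.trans F0.symm)
      have : y + z = 0 := by
        rcases smul_eq_zero.1 m0 with h | h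
        · norm_num at h
        · exact h
      exact (neg_eq_of_add_eq_zero_right this).symm
    rintro α ⟨hα1, hα2⟩ w hw hFw
    have hαy : ‖α • y‖ ≤ 1 := by
      rw [norm_smul]
      exact mul_le_one₀ (abs_le.2 ⟨hα1, hα2⟩) (norm_nonneg _) hy
    refine inj w _ (nb.1 hw) hαy (hFw.trans ?_)
    rcases le_total 0 α with h | h
    · exact (lin x hx y hy hFy α h hα2).symm
    · have := lin (-x) hnx z hz hFz (-α) (by linarith) (by linarith)
      rw [hzy, smul_neg, smul_neg, neg_smul, neg_smul, neg_neg, neg_neg] at this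
      exact this.symm
end

section
/- Let X and Y be real normed spaces, let U ⊆ X and V ⊆ Y be convex sets with non-empty interior, and let F : U → V be an isometric bijection. Then F extends to an affine isometric bijection F̃ : X → Y. -/
theorem mk_center_fixed {S : Type*} [MetricSpace S] (C : ℝ) (hC : ∀ a b : S, dist a b ≤ C)
    (R : S ≃ᵢ S) (m : S) (hm : R m = m) (hR : ∀ w, dist (R w) w = 2 * dist w m)
    (g : S ≃ᵢ S) : g m = m := by
  have key : ∀ n : ℕ, ∀ g : S ≃ᵢ S, 2 ^ n * dist (g m) m ≤ C := by
    intro n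
    induction n with
    | zero => intro g; simpa using hC _ _
    | succ n ih =>
      intro g
      have h := ih (((g.trans R).trans g.symm).trans R)
      have h2 : dist ((((g.trans R).trans g.symm).trans R) m) m = 2 * dist (g m) m := by
        simp only [IsometryEquiv.trans_apply]
        conv_lhs => rw [← hm]
        rw [R.dist_eq, hm, ← g.dist_eq, g.apply_symm_apply, hR]
      rw [h2] at h
      rw [pow_succ]; linarith
  by_contra hne
  have hpos : 0 < dist (g m) m := dist_pos.2 hne
  obtain ⟨n, hn⟩ := pow_unbounded_of_one_lt (C / dist (g m) m) (one_lt_two)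
  rw [div_lt_iff₀ hpos] at hn
  linarith [key n g]

theorem mk_center_map {S T : Type*} [MetricSpace S] [MetricSpace T] (C : ℝ)
    (hC : ∀ a b : S, dist a b ≤ C)
    (R : S ≃ᵢ S) (m : S) (hm : R m = m) (hR : ∀ w, dist (R w) w = 2 * dist w m)
    (R' : T ≃ᵢ T) (m' : T) (hR' : ∀ w, dist (R' w) w = 2 * dist w m')
    (e : S ≃ᵢ T) : e m = m' := by
  have h := mk_center_fixed C hC R m hm hR (((e.trans R').trans e.symm).trans R)
  simp only [IsometryEquiv.trans_apply] at h
  have h1 : e.symm (R' (e m)) = m := R.injective (by rw [h, hm])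
  have h2 : R' (e m) = e m := e.symm_apply_eq.1 h1
  have h3 := hR' (e m)
  rw [h2, dist_self] at h3
  exact dist_le_zero.1 (by linarith)

/-- metric midpoints -/
def mkH {X : Type*} [NormedAddCommGroup X] (y z : X) : Set X :=
  {w | dist w y = dist y z / 2 ∧ dist w z = dist y z / 2}

theorem mkH_refl {X : Type*} [NormedAddCommGroup X] [NormedSpace ℝ X] (y z : X) :
    ∃ (R : mkH y z ≃ᵢ mkH y z) (m : mkH y z), (m : X) = midpoint ℝ y z ∧ R m = m ∧
      ∀ w, dist (R w) w = 2 * dist w m := by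
  have hmem : ∀ w ∈ mkH y z, AffineIsometryEquiv.pointReflection ℝ (midpoint ℝ y z) w ∈ mkH y z := by
    rintro w ⟨h1, h2⟩
    set P := AffineIsometryEquiv.pointReflection ℝ (midpoint ℝ y z) with hP
    have hy : P y = z := by simp [hP]
    have hz : P z = y := by simp [hP]
    constructor
    · calc dist (P w) y = dist (P w) (P z) := by rw [hz]
        _ = dist y z / 2 := by rw [P.dist_map, h2]
    · calc dist (P w) z = dist (P w) (P y) := by rw [hy]
        _ = dist y z / 2 := by rw [P.dist_map, h1]
  refine ⟨⟨⟨fun w => ⟨_, hmem w w.2⟩, fun w => ⟨_, hmem w w.2⟩, ?_, ?_⟩, ?_⟩,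
    ⟨midpoint ℝ y z, ?_, ?_⟩, rfl, ?_, ?_⟩
  · intro w; ext; exact AffineIsometryEquiv.pointReflection_involutive _ _
  · intro w; ext; exact AffineIsometryEquiv.pointReflection_involutive _ _
  · apply Isometry.of_dist_eq
    intro a b
    exact (AffineIsometryEquiv.pointReflection ℝ (midpoint ℝ y z)).dist_map a b
  · rw [dist_midpoint_left]; norm_num; ring
  · rw [dist_midpoint_right]; norm_num; ring
  · ext; simp
  · intro w
    change dist (AffineIsometryEquiv.pointReflection ℝ (midpoint ℝ y z) (w : X)) (w : X) =
      2 * dist (w : X) (midpoint ℝ y z)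
    rw [AffineIsometryEquiv.dist_pointReflection_self_real, dist_comm]

theorem mk_local {X Y : Type*} [NormedAddCommGroup X] [NormedSpace ℝ X]
    [NormedAddCommGroup Y] [NormedSpace ℝ Y] (O : Set X) (f : X → Y)
    (hf : ∀ x ∈ O, ∀ y ∈ O, dist (f x) (f y) = dist x y) (y z : X) (hy : y ∈ O) (hz : z ∈ O)
    (h1 : mkH y z ⊆ O) (h2 : mkH (f y) (f z) ⊆ f '' O) :
    f (midpoint ℝ y z) = midpoint ℝ (f y) (f z) := by
  obtain ⟨R, m, hmm, hRm, hR⟩ := mkH_refl y z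
  obtain ⟨R', m', hmm', hRm', hR'⟩ := mkH_refl (f y) (f z)
  have hmap : ∀ w : mkH y z, f w ∈ mkH (f y) (f z) := by
    rintro ⟨w, hw⟩
    refine ⟨?_, ?_⟩
    · rw [hf _ (h1 hw) _ hy, hf _ hy _ hz]; exact hw.1
    · rw [hf _ (h1 hw) _ hz, hf _ hy _ hz]; exact hw.2
  let e0 : mkH y z → mkH (f y) (f z) := fun w => ⟨f w, hmap w⟩
  have hiso : Isometry e0 := Isometry.of_dist_eq fun a b => hf _ (h1 a.2) _ (h1 b.2)
  have hsurj : Function.Surjective e0 := by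
    rintro ⟨w, hw⟩
    obtain ⟨u, hu, rfl⟩ := h2 hw
    refine ⟨⟨u, ?_, ?_⟩, rfl⟩
    · rw [← hf _ hu _ hy, ← hf _ hy _ hz]; exact hw.1
    · rw [← hf _ hu _ hz, ← hf _ hy _ hz]; exact hw.2
  let e : mkH y z ≃ᵢ mkH (f y) (f z) :=
    ⟨Equiv.ofBijective e0 ⟨hiso.injective, hsurj⟩, hiso⟩
  have := mk_center_map (dist y z) (fun a b => by
    have := dist_triangle_right (a : X) b y
    rw [a.2.1, b.2.1] at this
    change dist (a : X) b ≤ _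
    linarith) R m hRm hR R' m' hR' e
  have h3 : f m = m' := congrArg Subtype.val this
  rwa [hmm, hmm'] at h3

theorem mk_nbhd {X Y : Type*} [NormedAddCommGroup X] [NormedSpace ℝ X]
    [NormedAddCommGroup Y] [NormedSpace ℝ Y] (O : Set X) (f : X → Y)
    (hf : ∀ x ∈ O, ∀ y ∈ O, dist (f x) (f y) = dist x y) (hO : IsOpen O) (hfO : IsOpen (f '' O))
    (x : X) (hx : x ∈ O) : ∃ ε > 0, ∀ y ∈ Metric.ball x ε, ∀ z ∈ Metric.ball x ε,
      f (midpoint ℝ y z) = midpoint ℝ (f y) (f z) := by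
  obtain ⟨a, ha, hA⟩ := Metric.isOpen_iff.1 hO x hx
  obtain ⟨b, hb, hB⟩ := Metric.isOpen_iff.1 hfO (f x) ⟨x, hx, rfl⟩
  refine ⟨min a b / 4, by positivity, fun y hy z hz => ?_⟩
  rw [Metric.mem_ball] at hy hz
  have hma := min_le_left a b
  have hmb := min_le_right a b
  have hpos : 0 < min a b := by positivity
  have hyO : y ∈ O := hA (by rw [Metric.mem_ball]; linarith)
  have hzO : z ∈ O := hA (by rw [Metric.mem_ball]; linarith)
  have hyz := dist_triangle_right y z x
  apply mk_local O f hf y z hyO hzO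
  · intro w hw
    apply hA
    rw [Metric.mem_ball]
    have := dist_triangle w y x
    rw [hw.1] at this
    linarith
  · intro w hw
    apply hB
    rw [Metric.mem_ball]
    have := dist_triangle w (f y) (f x)
    rw [hw.1, hf _ hyO _ hzO, hf _ hyO _ hx] at this
    linarith

theorem mk_midpoint {X Y : Type*} [NormedAddCommGroup X] [NormedSpace ℝ X]
    [NormedAddCommGroup Y] [NormedSpace ℝ Y] (O : Set X) (f : X → Y)
    (hf : ∀ x ∈ O, ∀ y ∈ O, dist (f x) (f y) = dist x y) (hO : IsOpen O) (hfO : IsOpen (f '' O))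
    (hc : Convex ℝ O) (y z : X) (hy : y ∈ O) (hz : z ∈ O) :
      f (midpoint ℝ y z) = midpoint ℝ (f y) (f z) := by
  choose! ε hε hmid using mk_nbhd O f hf hO hfO
  have hcomp : IsCompact (segment ℝ y z) := by
    rw [← convexHull_pair (𝕜 := ℝ)]
    exact (Set.toFinite {y, z}).isCompact_convexHull ℝ
  have hsub : segment ℝ y z ⊆ O := hc.segment_subset hy hz
  obtain ⟨δ, hδ, hL⟩ := lebesgue_number_lemma_of_metric (c := fun i : O => Metric.ball (i : X) (ε i))
    hcomp (fun i => Metric.isOpen_ball)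
    (fun x hx => Set.mem_iUnion.2 ⟨⟨x, hsub hx⟩, Metric.mem_ball_self (hε x (hsub hx))⟩)
  obtain ⟨N, hN⟩ := exists_nat_gt (dist y z / δ)
  have hN0 : (0 : ℝ) < N := lt_of_le_of_lt (by positivity) hN
  rw [div_lt_iff₀ hδ] at hN
  let P : ℕ → X := fun k => AffineMap.lineMap y z ((k : ℝ) / (2 * N))
  have hP : ∀ k ≤ 2 * N, P k ∈ segment ℝ y z := by
    intro k hk
    rw [segment_eq_image_lineMap]
    refine ⟨_, ⟨by positivity, ?_⟩, rfl⟩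
    rw [div_le_one (by positivity)]
    exact_mod_cast hk
  have hdist : ∀ k l : ℕ, dist (P k) (P l) = |(k : ℝ) - l| / (2 * N) * dist y z := by
    intro k l
    simp only [P]
    rw [dist_lineMap_lineMap, Real.dist_eq, ← sub_div, abs_div, abs_of_pos (by positivity : (0:ℝ) < 2 * N)]
  have hstep : ∀ k, k + 2 ≤ 2 * N → f (P (k + 1)) = midpoint ℝ (f (P k)) (f (P (k + 2))) := by
    intro k hk
    obtain ⟨i, hi⟩ := hL (P (k + 1)) (hP _ (by omega))
    have hm : P (k + 1) = midpoint ℝ (P k) (P (k + 2)) := by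
      simp only [P]
      rw [← AffineMap.map_midpoint]
      congr 1
      rw [midpoint_eq_smul_add]
      push_cast
      simp only [smul_eq_mul, invOf_eq_inv]
      field_simp
      ring
    have hlt : 1 / (2 * (N : ℝ)) * dist y z < δ := by
      rw [div_mul_eq_mul_div, div_lt_iff₀ (by positivity)]
      nlinarith
    rw [hm]
    apply hmid i i.2
    · apply hi
      rw [Metric.mem_ball, hdist]
      push_cast
      rw [show (k : ℝ) - (k + 1) = -1 by ring, abs_neg, abs_one]
      exact hlt
    · apply hi
      rw [Metric.mem_ball, hdist]
      push_cast
      rw [show (k : ℝ) + 2 - (k + 1) = 1 by ring, abs_one]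
      exact hlt
  have hstep' : ∀ k, k + 2 ≤ 2 * N → f (P (k + 2)) = (2 : ℝ) • f (P (k + 1)) - f (P k) := by
    intro k hk
    rw [hstep k hk, midpoint_eq_smul_add, smul_smul]
    simp
  have hlin : ∀ k, k + 1 ≤ 2 * N → f (P k) = f (P 0) + (k : ℝ) • (f (P 1) - f (P 0)) ∧
      f (P (k + 1)) = f (P 0) + ((k : ℝ) + 1) • (f (P 1) - f (P 0)) := by
    intro k
    induction k with
    | zero => intro _; simp
    | succ k ih =>
      intro hk
      obtain ⟨h1, h2⟩ := ih (by omega)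
      refine ⟨by rw [h2]; push_cast; rfl, ?_⟩
      rw [hstep' k (by omega), h1, h2]
      push_cast
      module
  have hNpos : 0 < N := by exact_mod_cast hN0
  have e0 : P 0 = y := by simp [P]
  have e1 : P N = midpoint ℝ y z := by
    simp only [P, midpoint]
    congr 1
    simp only [invOf_eq_inv]
    field_simp
  have e2 : P (2 * N) = z := by
    simp only [P]
    push_cast
    rw [div_self (by positivity)]
    simp
  have hA := (hlin N (by omega)).1
  have hB := (hlin (2 * N - 1) (by omega)).2
  rw [show 2 * N - 1 + 1 = 2 * N by omega] at hB
  have hcast : (((2 * N - 1 : ℕ) : ℝ) + 1) = 2 * N := by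
    have : 2 * N - 1 + 1 = 2 * N := by omega
    exact_mod_cast this
  rw [hcast, e2, e0] at hB
  rw [e1, e0] at hA
  rw [hA, hB, midpoint_eq_smul_add]
  simp only [invOf_eq_inv]
  module

theorem mk_open {X Y : Type*} [NormedAddCommGroup X] [NormedSpace ℝ X]
    [NormedAddCommGroup Y] [NormedSpace ℝ Y] (O : Set X) (f : X → Y)
    (hf : ∀ x ∈ O, ∀ y ∈ O, dist (f x) (f y) = dist x y) (hO : IsOpen O) (hfO : IsOpen (f '' O))
    (hc : Convex ℝ O) (hne : O.Nonempty) : ∃ G : X ≃ᵃⁱ[ℝ] Y, ∀ x ∈ O, G x = f x := by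
  obtain ⟨p, hp⟩ := hne
  obtain ⟨a, ha, hA⟩ := Metric.isOpen_iff.1 hO p hp
  obtain ⟨b, hb, hB⟩ := Metric.isOpen_iff.1 hfO (f p) ⟨p, hp, rfl⟩
  let g : X → Y := fun v => f (p + v) - f p
  have hhalf : ∀ v, p + v ∈ O → p + (2⁻¹ : ℝ) • v ∈ O ∧ g ((2⁻¹ : ℝ) • v) = (2⁻¹ : ℝ) • g v := by
    intro v hv
    have hm : p + (2⁻¹ : ℝ) • v = midpoint ℝ p (p + v) := by
      rw [midpoint_eq_smul_add]; simp only [invOf_eq_inv]; module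
    refine ⟨?_, ?_⟩
    · rw [hm]; exact hc.midpoint_mem hp hv
    · simp only [g]
      rw [hm, mk_midpoint O f hf hO hfO hc _ _ hp hv, midpoint_eq_smul_add]
      simp only [invOf_eq_inv]; module
  have hadd : ∀ (v : X) (n k : ℕ), p + ((2 : ℝ) ^ n)⁻¹ • v ∈ O →
      p + ((2 : ℝ) ^ (n + k))⁻¹ • v ∈ O ∧
      (2 : ℝ) ^ (n + k) • g (((2 : ℝ) ^ (n + k))⁻¹ • v) = (2 : ℝ) ^ n • g (((2 : ℝ) ^ n)⁻¹ • v) := by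
    intro v n k hv
    induction k with
    | zero => exact ⟨hv, rfl⟩
    | succ k ih =>
      obtain ⟨h1, h2⟩ := ih
      obtain ⟨h3, h4⟩ := hhalf _ h1
      have : ((2 : ℝ) ^ (n + (k + 1)))⁻¹ • v = (2⁻¹ : ℝ) • ((2 : ℝ) ^ (n + k))⁻¹ • v := by
        rw [smul_smul, ← add_assoc, pow_succ, mul_inv, mul_comm]
      rw [this]
      refine ⟨h3, ?_⟩
      rw [h4, ← h2, smul_smul, ← add_assoc, pow_succ]
      simp
  have hex : ∀ v : X, ∃ n : ℕ, p + ((2 : ℝ) ^ n)⁻¹ • v ∈ O := by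
    intro v
    obtain ⟨n, hn⟩ := pow_unbounded_of_one_lt (‖v‖ / a) (one_lt_two)
    refine ⟨n, hA ?_⟩
    rw [div_lt_iff₀ ha] at hn
    rw [mem_ball_iff_norm, add_sub_cancel_left, norm_smul, norm_inv, norm_pow, Real.norm_ofNat,
      inv_mul_lt_iff₀ (by positivity)]
    exact hn
  choose n hn using hex
  let L : X → Y := fun v => (2 : ℝ) ^ (n v) • g (((2 : ℝ) ^ (n v))⁻¹ • v)
  have hL : ∀ v k, p + ((2 : ℝ) ^ k)⁻¹ • v ∈ O → L v = (2 : ℝ) ^ k • g (((2 : ℝ) ^ k)⁻¹ • v) := by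
    intro v k hk
    have h1 := (hadd v (n v) k (hn v)).2
    have h2 := (hadd v k (n v) hk).2
    rw [add_comm] at h2
    exact h1.symm.trans h2
  have hiso : Isometry L := by
    apply Isometry.of_dist_eq
    intro v w
    have h1 := (hadd v (n v) (n w) (hn v)).1
    have h2 := (hadd w (n w) (n v) (hn w)).1
    rw [add_comm (n w)] at h2
    rw [hL v _ h1, hL w _ h2, dist_smul₀]
    simp only [g]
    rw [dist_sub_right, hf _ h1 _ h2, dist_add_left, dist_smul₀, norm_inv, ← mul_assoc,
      mul_inv_cancel₀ (by simp), one_mul]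
  have hsurj : Function.Surjective L := by
    intro y
    obtain ⟨k, hk⟩ := pow_unbounded_of_one_lt (‖y‖ / b) (one_lt_two)
    rw [div_lt_iff₀ hb] at hk
    obtain ⟨u, hu, hue⟩ := @hB (f p + ((2 : ℝ) ^ k)⁻¹ • y) (by
      rw [mem_ball_iff_norm, add_sub_cancel_left, norm_smul, norm_inv, norm_pow, Real.norm_ofNat,
        inv_mul_lt_iff₀ (by positivity)]
      exact hk)
    have hs : ((2 : ℝ) ^ k)⁻¹ • (2 : ℝ) ^ k • (u - p) = u - p := by
      rw [smul_smul, inv_mul_cancel₀ (by positivity), one_smul]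
    refine ⟨(2 : ℝ) ^ k • (u - p), ?_⟩
    rw [hL _ k (by rw [hs]; simpa using hu), hs]
    simp only [g]
    rw [add_sub_cancel, hue, add_sub_cancel_left, smul_smul, mul_inv_cancel₀ (by positivity),
      one_smul]
  let e : X ≃ᵢ Y := ⟨Equiv.ofBijective L ⟨hiso.injective, hsurj⟩, hiso⟩
  have he : ∀ v, e v = L v := fun v => rfl
  let e' : X ≃ᵢ Y := ((IsometryEquiv.subRight p).trans e).trans (IsometryEquiv.addRight (f p))
  refine ⟨e'.toRealAffineIsometryEquiv, fun x hx => ?_⟩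
  rw [IsometryEquiv.coeFn_toRealAffineIsometryEquiv]
  change L (x - p) + f p = f x
  rw [hL _ 0 (by simpa using hx)]
  simp [g]

theorem mk_contOn {X Y : Type*} [MetricSpace X] [MetricSpace Y] (U : Set X) (F : X → Y)
    (hiso : ∀ x ∈ U, ∀ y ∈ U, dist (F x) (F y) = dist x y) : ContinuousOn F U := by
  rw [Metric.continuousOn_iff]
  intro x hx ε hε
  exact ⟨ε, hε, fun y hy h => by rwa [hiso y hy x hx]⟩

theorem mk_dense {X : Type*} [NormedAddCommGroup X] [NormedSpace ℝ X] (U : Set X)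
    (hU : Convex ℝ U) (h : (interior U).Nonempty) : U ⊆ closure (interior U) := by
  rw [hU.closure_interior_eq_closure_of_nonempty_interior h]
  exact subset_closure

theorem mk_interior {X Y : Type*} [NormedAddCommGroup X] [NormedSpace ℝ X]
    [NormedAddCommGroup Y] [NormedSpace ℝ Y]
    (U : Set X) (V : Set Y)
    (hV : Convex ℝ V) (hVint : (interior V).Nonempty)
    (F : X → Y) (H : Y → X) (hF : Set.MapsTo F U V) (hH : Set.MapsTo H V U)
    (hHF : ∀ x ∈ U, H (F x) = x) (hFH : ∀ y ∈ V, F (H y) = y)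
    (hiso : ∀ x ∈ U, ∀ y ∈ U, dist (F x) (F y) = dist x y) :
    Set.MapsTo F (interior U) (interior V) := by
  intro x hx
  have hxU := interior_subset hx
  have hisoH : ∀ x ∈ V, ∀ y ∈ V, dist (H x) (H y) = dist x y := by
    intro a ha b hb
    rw [← hiso _ (hH ha) _ (hH hb), hFH a ha, hFH b hb]
  obtain ⟨ρ, hρ, hball⟩ := Metric.isOpen_iff.1 isOpen_interior x hx
  replace hball : Metric.ball x ρ ⊆ U := hball.trans interior_subset
  set O : Set Y := interior V ∩ Metric.ball (F x) ρ with hOdef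
  have hOV : O ⊆ V := fun y hy => interior_subset hy.1
  have hOo : IsOpen O := isOpen_interior.inter Metric.isOpen_ball
  have hOc : Convex ℝ O := hV.interior.inter (convex_ball _ _)
  have hOd : V ∩ Metric.ball (F x) ρ ⊆ closure O := by
    rintro y ⟨hy, hyb⟩
    have := mk_dense V hV hVint hy
    rw [hOdef, Set.inter_comm]
    exact Metric.isOpen_ball.inter_closure ⟨hyb, this⟩
  have hxK : F x ∈ V ∩ Metric.ball (F x) ρ := ⟨hF hxU, Metric.mem_ball_self hρ⟩
  have hOne : O.Nonempty := closure_nonempty_iff.1 ⟨_, hOd hxK⟩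
  have himg : H '' O = Metric.ball x ρ ∩ F ⁻¹' O := by
    ext u
    constructor
    · rintro ⟨y, hy, rfl⟩
      refine ⟨?_, ?_⟩
      · rw [Metric.mem_ball, ← hiso _ (hH (hOV hy)) _ hxU, hFH _ (hOV hy)]
        exact hy.2
      · rw [Set.mem_preimage, hFH _ (hOV hy)]; exact hy
    · rintro ⟨h1, h2⟩
      exact ⟨F u, h2, hHF u (hball h1)⟩
  have hHO : IsOpen (H '' O) := by
    rw [himg]
    exact ((mk_contOn U F hiso).mono hball).isOpen_inter_preimage Metric.isOpen_ball hOo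
  obtain ⟨e, he⟩ := mk_open O H (fun a ha b hb => hisoH a (hOV ha) b (hOV hb)) hOo hHO hOc hOne
  have heK : Set.EqOn e H (V ∩ Metric.ball (F x) ρ) := by
    refine Set.EqOn.of_subset_closure (s := O) he e.continuous.continuousOn
      ((mk_contOn V H hisoH).mono Set.inter_subset_left) ?_ hOd
    exact fun y hy => ⟨hOV hy, hy.2⟩
  obtain ⟨k, hk⟩ := hOne
  have hkK : k ∈ V ∩ Metric.ball (F x) ρ := ⟨hOV hk, hk.2⟩
  have hu : H k ∈ Metric.ball x ρ := by
    have : H k ∈ H '' O := ⟨k, hk, rfl⟩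
    rw [himg] at this
    exact this.1
  set u' := AffineIsometryEquiv.pointReflection ℝ x (H k) with hu'
  have hu'b : u' ∈ Metric.ball x ρ := by
    rw [Metric.mem_ball, hu', AffineIsometryEquiv.dist_pointReflection_fixed]
    exact hu
  have hu'U := hball hu'b
  have hk'K : F u' ∈ V ∩ Metric.ball (F x) ρ := by
    refine ⟨hF hu'U, ?_⟩
    rw [Metric.mem_ball, hiso _ hu'U _ hxU]; exact hu'b
  have hmid : F x = midpoint ℝ k (F u') := by
    apply e.injective
    have : e (midpoint ℝ k (F u')) = midpoint ℝ (e k) (e (F u')) :=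
      e.toAffineEquiv.toAffineMap.map_midpoint k (F u')
    rw [this, heK hkK, heK hk'K, heK hxK, hHF _ hxU, hHF _ hu'U, hu']
    simp only [AffineIsometryEquiv.pointReflection_apply, midpoint_eq_smul_add, invOf_eq_inv,
      vsub_eq_sub, vadd_eq_add]
    module
  rw [hmid]
  apply hV.openSegment_interior_self_subset_interior hk.1 hk'K.1
  exact midpoint_mem_openSegment _ _

/-- Mankiewicz's theorem: if U and V are convex subsets with nonempty interior
of real normed spaces X and Y, and F : U → V is an isometric bijection, then F
extends to an affine isometric bijection from X onto Y. -/
theorem mankiewicz_extension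
    (X Y : Type*) [NormedAddCommGroup X] [NormedSpace ℝ X]
    [NormedAddCommGroup Y] [NormedSpace ℝ Y]
    (U : Set X) (V : Set Y)
    (hU : Convex ℝ U) (hUint : (interior U).Nonempty)
    (hV : Convex ℝ V) (hVint : (interior V).Nonempty)
    (F : X → Y) (hbij : Set.BijOn F U V)
    (hiso : ∀ x ∈ U, ∀ y ∈ U, dist (F x) (F y) = dist x y) :
    ∃ G : X ≃ᵃⁱ[ℝ] Y, ∀ x ∈ U, G x = F x := by
  let H := Function.invFunOn F U
  have hinv : Set.InvOn H F U V := hbij.invOn_invFunOn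
  have hHF : ∀ x ∈ U, H (F x) = x := fun x hx => hinv.1 hx
  have hFH : ∀ y ∈ V, F (H y) = y := fun y hy => hinv.2 hy
  have hH : Set.MapsTo H V U := hbij.surjOn.mapsTo_invFunOn
  have hisoH : ∀ x ∈ V, ∀ y ∈ V, dist (H x) (H y) = dist x y := by
    intro a ha b hb
    rw [← hiso _ (hH ha) _ (hH hb), hFH a ha, hFH b hb]
  have h1 := mk_interior U V hV hVint F H hbij.mapsTo hH hHF hFH hiso
  have h2 := mk_interior V U hU hUint H F hH hbij.mapsTo hFH hHF hisoH
  have himg : F '' interior U = interior V := by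
    apply Set.Subset.antisymm
    · rintro _ ⟨x, hx, rfl⟩; exact h1 hx
    · intro y hy
      exact ⟨H y, h2 hy, hFH y (interior_subset hy)⟩
  obtain ⟨G, hG⟩ := mk_open (interior U) F
    (fun a ha b hb => hiso a (interior_subset ha) b (interior_subset hb)) isOpen_interior
    (by rw [himg]; exact isOpen_interior) hU.interior hUint
  refine ⟨G, ?_⟩
  exact Set.EqOn.of_subset_closure (s := interior U) (t := U) hG G.continuous.continuousOn
    (mk_contOn U F hiso) interior_subset (mk_dense U hU hUint)
end

section
/- Let X be a real Banach space and let F : B_X → B_X be a non-expansive bijection of the closed unit ball onto itself. If F(S_X) = S_X and F(αx) = αF(x) for every x ∈ S_X and every α ∈ [-1,1], then F is an isometry. -/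
open MeasureTheory Filter Topology in
theorem aux_isometry {X : Type*} [NormedAddCommGroup X] [NormedSpace ℝ X]
    (G : X → X) (hG : ∀ x y, ‖G x - G y‖ ≤ ‖x - y‖)
    (hn : ∀ x, ‖G x‖ = ‖x‖) (hh : ∀ (a : ℝ) x, G (a • x) = a • G x) (x y : X) :
    ‖x - y‖ ≤ ‖G x - G y‖ := by
  let L : ℝ × ℝ →L[ℝ] X :=
    (ContinuousLinearMap.fst ℝ ℝ ℝ).smulRight x + (ContinuousLinearMap.snd ℝ ℝ ℝ).smulRight y
  have hL : ∀ p : ℝ × ℝ, L p = p.1 • x + p.2 • y := fun p => by simp [L]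
  let g : ℝ × ℝ → ℝ := fun p => ‖L p‖
  have hgc : Continuous g := L.continuous.norm
  have hlip : LipschitzWith (1 * ‖L‖₊) g := lipschitzWith_one_norm.comp L.lipschitz
  have hae : ∀ᵐ p ∂(volume : Measure (ℝ × ℝ)), DifferentiableAt ℝ g p :=
    hlip.ae_differentiableAt
  have hdense : Dense {p | DifferentiableAt ℝ g p} := Measure.dense_of_ae hae
  let e : ℝ × ℝ := (1, -1)
  have key : ∀ p ∈ {p | DifferentiableAt ℝ g p}, g p - g (p - e) ≤ ‖G x - G y‖ := by
    intro p hp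
    have hp : DifferentiableAt ℝ g p := hp
    have hd : ∀ v : ℝ × ℝ, HasDerivAt (fun t : ℝ => g (p + t • v)) (fderiv ℝ g p v) 0 := by
      intro v
      exact hp.hasFDerivAt.hasLineDerivAt v
    let ψ : ℝ → ℝ := fun t => g (p + t • (-e)) - g (p + t • ((-1, 0) : ℝ × ℝ))
      - g (p + t • ((0, 1) : ℝ × ℝ))
    have hψ : HasDerivAt ψ 0 0 := by
      have h := ((hd (-e)).sub (hd (-1, 0))).sub (hd (0, 1))
      have h0 : fderiv ℝ g p (-e) - fderiv ℝ g p (-1, 0) - fderiv ℝ g p (0, 1) = 0 := by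
        rw [← map_sub, ← map_sub]
        simp [e]
      rw [h0] at h
      exact h
    have hs := hψ.tendsto_slope_zero_right
    have hle : ∀ᶠ t in 𝓝[>] (0 : ℝ), t⁻¹ • (ψ (0 + t) - ψ 0)
        ≤ ‖G x - G y‖ - (g p - g (p - e)) := by
      filter_upwards [Ioo_mem_nhdsGT (zero_lt_one' ℝ)] with t ht
      obtain ⟨ht0, ht1⟩ := ht
      rw [smul_eq_mul, inv_mul_le_iff₀ ht0]
      have hψ0 : ψ 0 = - g p := by simp only [ψ, zero_smul, add_zero]; ring
      rw [hψ0, zero_add]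
      have h1 : g (p + t • (-e)) ≤ (1 - t) * g p + t * g (p - e) := by
        have : L (p + t • (-e)) = (1 - t) • L p + t • L (p - e) := by
          simp only [map_add, map_sub, map_smul, map_neg]; module
        simp only [g, this]
        refine (norm_add_le _ _).trans ?_
        rw [norm_smul, norm_smul, Real.norm_of_nonneg ht0.le,
          Real.norm_of_nonneg (by linarith)]
      have h2 : ∀ (s : ℝ) (z : X), ‖G (L p) + s • G z‖ ≤ ‖L p + s • z‖ := by
        intro s z
        have := hG (L p) ((-s) • z)
        rw [hh] at this
        simpa [sub_eq_add_neg] using this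
      have h3 : ‖G (L p) + (-t) • G x‖ ≤ g (p + t • ((-1, 0) : ℝ × ℝ)) := by
        refine (h2 (-t) x).trans (le_of_eq ?_)
        simp [g, hL (-t, 0)]
      have h4 : ‖G (L p) + t • G y‖ ≤ g (p + t • ((0, 1) : ℝ × ℝ)) := by
        refine (h2 t y).trans (le_of_eq ?_)
        simp [g, hL (0, t)]
      have h5 : 2 * g p ≤ ‖G (L p) + (-t) • G x‖ + ‖G (L p) + t • G y‖
          + t * ‖G x - G y‖ := by
        have : (2 : ℝ) • G (L p) = (G (L p) + (-t) • G x) + (G (L p) + t • G y)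
          + t • (G x - G y) := by module
        have h6 := congrArg norm this
        rw [norm_smul, hn] at h6
        have h7 := norm_add₃_le (a := G (L p) + (-t) • G x) (b := G (L p) + t • G y)
          (c := t • (G x - G y))
        rw [← h6, norm_smul, Real.norm_of_nonneg ht0.le] at h7
        simpa [g] using h7
      simp only [ψ]
      nlinarith
    have := le_of_tendsto hs hle
    linarith
  have hcl : IsClosed {p | g p - g (p - e) ≤ ‖G x - G y‖} :=
    isClosed_le (by fun_prop) continuous_const
  have := hcl.closure_subset_iff.2 key (hdense e)
  simpa [g, e, hL, sub_eq_add_neg] using this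

/-- Sufficient condition for a non-expansive bijection of the unit ball to be
an isometry: if F maps the unit sphere onto itself and F(αx) = αF(x) for every
x on the sphere and α ∈ [-1,1], then F is an isometry. -/
theorem nonexpansive_bijection_isometry_of_sphere_homogeneous
    (X : Type*) [NormedAddCommGroup X] [NormedSpace ℝ X] [CompleteSpace X]
    (B : Set X) (hB : B = Metric.closedBall (0 : X) 1)
    (F : X → X) (hbij : Set.BijOn F B B) (hne : LipschitzOnWith 1 F B)
    (hS : F '' Metric.sphere (0 : X) 1 = Metric.sphere (0 : X) 1)
    (hhom : ∀ x ∈ Metric.sphere (0 : X) 1, ∀ α ∈ Set.Icc (-1 : ℝ) 1,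
      F (α • x) = α • F x) :
    ∀ x ∈ B, ∀ y ∈ B, dist (F x) (F y) = dist x y := by
  have hu : ∀ x : X, x ≠ 0 → ‖x‖⁻¹ • x ∈ Metric.sphere (0 : X) 1 := by
    intro x hx
    simp [norm_smul, hx]
  have hF0 : F 0 = 0 := by
    by_cases h : ∃ x : X, x ≠ 0
    · obtain ⟨x, hx⟩ := h
      simpa using hhom _ (hu x hx) 0 (by simp)
    · push Not at h
      exact h _
  let G : X → X := fun x => ‖x‖ • F (‖x‖⁻¹ • x)
  have hGc : ∀ (c : ℝ) (x : X), 0 < c → ‖x‖ ≤ c → G x = c • F (c⁻¹ • x) := by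
    intro c x hc hx
    by_cases h : x = 0
    · simp [G, h, hF0]
    have hx0 : ‖x‖ ≠ 0 := by simpa using h
    have h1 : c⁻¹ • x = (c⁻¹ * ‖x‖) • (‖x‖⁻¹ • x) := by
      rw [smul_smul, mul_assoc, mul_inv_cancel₀ hx0, mul_one]
    have h2 : 0 ≤ c⁻¹ * ‖x‖ := by positivity
    rw [h1, hhom _ (hu x h) _ ⟨by linarith, by rw [inv_mul_le_iff₀ hc]; linarith⟩, smul_smul,
      ← mul_assoc, mul_inv_cancel₀ hc.ne', one_mul]
  have hGF : ∀ x ∈ B, G x = F x := by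
    intro x hx
    rw [hB, mem_closedBall_zero_iff] at hx
    simpa using hGc 1 x one_pos hx
  have hnS : ∀ x ∈ Metric.sphere (0 : X) 1, ‖F x‖ = 1 := by
    intro x hx
    have : F x ∈ Metric.sphere (0 : X) 1 := hS ▸ Set.mem_image_of_mem F hx
    simpa using this
  have hn : ∀ x, ‖G x‖ = ‖x‖ := by
    intro x
    by_cases h : x = 0
    · simp [G, h]
    · simp only [G]
      rw [norm_smul, hnS _ (hu x h)]; simp
  have hlip : ∀ x y, ‖G x - G y‖ ≤ ‖x - y‖ := by
    intro x y
    have hx := norm_nonneg x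
    have hy := norm_nonneg y
    obtain ⟨c, hc⟩ : ∃ c, c = ‖x‖ + ‖y‖ + 1 := ⟨_, rfl⟩
    have hc0 : 0 < c := by linarith
    have hm : ∀ z : X, ‖z‖ ≤ c → c⁻¹ • z ∈ B := by
      intro z hz
      rw [hB, mem_closedBall_zero_iff, norm_smul, Real.norm_of_nonneg (by positivity),
        inv_mul_le_iff₀ hc0]
      linarith
    rw [hGc c x hc0 (by linarith), hGc c y hc0 (by linarith), ← smul_sub, norm_smul,
      Real.norm_of_nonneg hc0.le]
    have := hne.dist_le_mul _ (hm x (by linarith)) _ (hm y (by linarith))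
    rw [dist_eq_norm, dist_eq_norm, ← smul_sub, norm_smul,
      Real.norm_of_nonneg (by positivity : 0 ≤ c⁻¹)] at this
    calc c * _ ≤ c * _ := mul_le_mul_of_nonneg_left this hc0.le
      _ = ‖x - y‖ := by simp [hc0.ne']
  have hh : ∀ (a : ℝ) x, G (a • x) = a • G x := by
    intro a x
    by_cases h : x = 0
    · simp [G, h]
    have hx0 : 0 < ‖x‖ := by simpa using h
    have ha := abs_nonneg a
    have ha1 : 0 < |a| + 1 := by linarith
    have hc0 : 0 < (|a| + 1) * ‖x‖ := by positivity
    rw [hGc ((|a| + 1) * ‖x‖) (a • x) hc0 (by rw [norm_smul, Real.norm_eq_abs]; nlinarith)]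
    have h1 : ((|a| + 1) * ‖x‖)⁻¹ • a • x = ((|a| + 1)⁻¹ * a) • (‖x‖⁻¹ • x) := by
      rw [smul_smul, smul_smul, mul_inv]; congr 1; ring
    have h2 : |(|a| + 1)⁻¹ * a| ≤ 1 := by
      rw [abs_mul, abs_of_pos (inv_pos.2 ha1), inv_mul_le_iff₀ ha1]; linarith
    rw [h1, hhom _ (hu x h) _ (abs_le.1 h2)]
    simp only [G, smul_smul]
    congr 1
    field_simp
  intro x hx y hy
  rw [← hGF x hx, ← hGF y hy, dist_eq_norm, dist_eq_norm]
  exact le_antisymm (hlip x y) (aux_isometry G hlip hn hh x y)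
end

section
/- In the Banach space Z = ℓ₁ ⊕₂ ℝ, the set of extreme points of the closed unit ball B_Z is exactly { (a·e_m, b) : a, b ∈ ℝ, a² + b² = 1, m ∈ ℕ }, where e_m denotes the m-th element of the canonical basis of ℓ₁. -/
/-- The m-th canonical basis vector of ℓ₁. -/
noncomputable def e (m : ℕ) : Ell1 := lp.single 1 m (1 : ℝ)

/-- The element (x, t) of Z = ℓ₁ ⊕₂ ℝ. -/
noncomputable def zmk (x : Ell1) (t : ℝ) : Z := (WithLp.equiv 2 (Ell1 × ℝ)).symm (x, t)

lemma ell1_norm_split (x : Ell1) (m : ℕ) : ‖x‖ = |x m| + ‖x - x m • e m‖ := by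
  have h := lp.norm_sub_norm_compl_sub_single (p := 1) (by norm_num) x {m}
  have he : x m • e m = lp.single 1 m (x m) := by
    rw [e, ← lp.single_smul]; simp
  simp at h
  rw [he]
  linarith

lemma z_mem_ball (z : Z) : z ∈ Metric.closedBall (0 : Z) 1 ↔ ‖z.fst‖ ^ 2 + z.snd ^ 2 ≤ 1 := by
  rw [mem_closedBall_zero_iff, ← sq_le_one_iff₀ (norm_nonneg _), WithLp.prod_norm_sq_eq_of_L2]
  simp

lemma not_ext (z w : Z) (hz : z ∈ Set.extremePoints ℝ (Metric.closedBall (0 : Z) 1))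
    (h1 : z + w ∈ Metric.closedBall (0 : Z) 1) (h2 : z - w ∈ Metric.closedBall (0 : Z) 1) :
    w = 0 := by
  have := (mem_extremePoints_iff_left.1 hz).2 _ h1 _ h2
    ⟨1/2, 1/2, by norm_num, by norm_num, by norm_num, by module⟩
  simpa using this

lemma disk_strict {s t u v u' v' : ℝ} (hs : 0 < s) (ht : 0 < t) (hst : s + t = 1)
    (h : u ^ 2 + v ^ 2 ≤ 1) (h' : u' ^ 2 + v' ^ 2 ≤ 1)
    (hab : (s * u + t * u') ^ 2 + (s * v + t * v') ^ 2 = 1) : u = u' ∧ v = v' := by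
  have key : s * t * ((u - u') ^ 2 + (v - v') ^ 2) ≤ 0 := by
    have h3 : s * t * ((u - u') ^ 2 + (v - v') ^ 2) =
        s * (u ^ 2 + v ^ 2) + t * (u' ^ 2 + v' ^ 2)
          - ((s * u + t * u') ^ 2 + (s * v + t * v') ^ 2) := by
      obtain rfl : t = 1 - s := by linarith
      ring
    rw [h3, hab]
    nlinarith
  have h4 : (u - u') ^ 2 + (v - v') ^ 2 ≤ 0 := by
    by_contra hc
    push Not at hc
    have := mul_pos (mul_pos hs ht) hc
    linarith
  have hu : (u - u') ^ 2 = 0 := by nlinarith [sq_nonneg (u - u'), sq_nonneg (v - v')]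
  have hv : (v - v') ^ 2 = 0 := by nlinarith [sq_nonneg (u - u'), sq_nonneg (v - v')]
  exact ⟨by linarith [pow_eq_zero_iff two_ne_zero |>.1 hu],
    by linarith [pow_eq_zero_iff two_ne_zero |>.1 hv]⟩

lemma coord_mem {y : Z} (hy : y ∈ Metric.closedBall (0 : Z) 1) (m : ℕ) :
    (y.fst m) ^ 2 + y.snd ^ 2 ≤ 1 := by
  rw [z_mem_ball] at hy
  have h := ell1_norm_split y.fst m
  have h1 : |y.fst m| ≤ ‖y.fst‖ := by linarith [norm_nonneg (y.fst - y.fst m • e m)]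
  have := pow_le_pow_left₀ (abs_nonneg _) h1 2
  rw [sq_abs] at this
  linarith

lemma e_self (m : ℕ) : (e m) m = 1 := by simp [e]

lemma zmk_ext (z : Z) (x : Ell1) (t : ℝ) (h1 : z.fst = x) (h2 : z.snd = t) : z = zmk x t := by
  subst h1 h2; rfl

lemma norm_e (m : ℕ) : ‖e m‖ = 1 := by
  rw [ell1_norm_split (e m) m, e_self]; simp

lemma perturb {X : Type*} [NormedAddCommGroup X] [NormedSpace ℝ X] (p q : X) (σ : ℝ)
    (hσ : |σ| * ‖p‖ ≤ 1) (hσ' : |σ| * ‖q‖ ≤ 1) :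
    ‖p + q + σ • (‖q‖ • p - ‖p‖ • q)‖ ≤ ‖p‖ + ‖q‖ := by
  have h : p + q + σ • (‖q‖ • p - ‖p‖ • q) = (1 + σ * ‖q‖) • p + (1 - σ * ‖p‖) • q := by
    module
  have hp := abs_le.1 ((abs_mul σ ‖p‖).trans_le (by simpa using hσ))
  have hq := abs_le.1 ((abs_mul σ ‖q‖).trans_le (by simpa using hσ'))
  rw [h]
  refine (norm_add_le _ _).trans ?_
  rw [norm_smul, norm_smul, Real.norm_of_nonneg (by linarith), Real.norm_of_nonneg (by linarith)]
  apply le_of_eq; ring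

/-- The extreme points of the closed unit ball of Z = ℓ₁ ⊕₂ ℝ are exactly the
points (a·e_m, b) with a² + b² = 1. -/
theorem extremePoints_ball_ell1_sum2_real :
    Set.extremePoints ℝ (Metric.closedBall (0 : Z) 1) =
      {z : Z | ∃ (a b : ℝ) (m : ℕ), a ^ 2 + b ^ 2 = 1 ∧ z = zmk (a • e m) b} := by
  ext z
  constructor
  · intro hz
    have hzb := extremePoints_subset hz
    have hnorm : ‖z.fst‖ ^ 2 + z.snd ^ 2 = 1 := by
      have h1 : ‖z‖ = 1 := by
        by_contra hne
        rw [mem_closedBall_zero_iff] at hzb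
        have hlt : ‖z‖ < 1 := lt_of_le_of_ne hzb hne
        have hw : ‖zmk 0 (1 - ‖z‖)‖ = 1 - ‖z‖ := by
          have : ‖zmk 0 (1 - ‖z‖)‖ = ‖1 - ‖z‖‖ := WithLp.norm_toLp_snd 2 Ell1 ℝ (1 - ‖z‖)
          rw [this, Real.norm_of_nonneg (by linarith)]
        have := not_ext z (zmk 0 (1 - ‖z‖)) hz
          (by rw [mem_closedBall_zero_iff]; refine (norm_add_le _ _).trans ?_; linarith)
          (by rw [mem_closedBall_zero_iff]; refine (norm_sub_le _ _).trans ?_; linarith)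
        rw [this, norm_zero] at hw
        linarith
      have h2 := WithLp.prod_norm_sq_eq_of_L2 z
      rw [h1] at h2
      simpa using h2.symm
    by_cases hx : z.fst = 0
    · refine ⟨0, z.snd, 0, ?_, zmk_ext _ _ _ (by simp [hx]) rfl⟩
      simpa [hx] using hnorm
    · have : ∃ m, z.fst m ≠ 0 := by
        by_contra hc
        push Not at hc
        exact hx (lp.ext (funext hc))
      obtain ⟨m, hm⟩ := this
      have hsp := ell1_norm_split z.fst m
      have hpn : ‖z.fst m • e m‖ = |z.fst m| := by rw [norm_smul, norm_e]; simp
      obtain ⟨p, hp⟩ : ∃ p, p = z.fst m • e m := ⟨_, rfl⟩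
      obtain ⟨q, hq⟩ : ∃ q, q = z.fst - p := ⟨_, rfl⟩
      have hpq : z.fst = p + q := by rw [hq]; abel
      rw [← hp] at hpn hsp
      rw [← hq, ← hpn] at hsp
      have hppos : 0 < ‖p‖ := by rw [hpn]; exact abs_pos.2 hm
      have hq0 : q = 0 := by
        by_contra hqne
        have hqpos : 0 < ‖q‖ := norm_pos_iff.2 hqne
        have hb : ∀ σ : ℝ, |σ| = 1 / (‖p‖ + ‖q‖) →
            z + zmk (σ • (‖q‖ • p - ‖p‖ • q)) 0 ∈ Metric.closedBall (0 : Z) 1 := by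
          intro σ hσ
          rw [z_mem_ball]
          have hn := perturb p q σ
            (by rw [hσ, one_div, inv_mul_le_iff₀ (by linarith)]; linarith)
            (by rw [hσ, one_div, inv_mul_le_iff₀ (by linarith)]; linarith)
          have e1 : (z + zmk (σ • (‖q‖ • p - ‖p‖ • q)) 0).fst
              = p + q + σ • (‖q‖ • p - ‖p‖ • q) := by rw [← hpq]; rfl
          have e2 : (z + zmk (σ • (‖q‖ • p - ‖p‖ • q)) 0).snd = z.snd := by
            change z.snd + 0 = _; simp
          rw [e1, e2, ← hnorm, hsp]
          gcongr
        set c := 1 / (‖p‖ + ‖q‖) with hc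
        have hcpos : 0 < c := by positivity
        have h0 := not_ext z (zmk (c • (‖q‖ • p - ‖p‖ • q)) 0) hz
          (hb c (abs_of_pos hcpos)) (by
            have := hb (-c) (by rw [abs_neg, abs_of_pos hcpos])
            convert this using 1
            rw [sub_eq_add_neg]
            congr 1
            refine zmk_ext _ _ _ ?_ ?_
            · change -(c • (‖q‖ • p - ‖p‖ • q)) = _
              module
            · change -(0:ℝ) = 0
              simp)
        have h1 : c • (‖q‖ • p - ‖p‖ • q) = 0 := congrArg WithLp.fst h0
        have h2 := (smul_eq_zero.1 h1).resolve_left hcpos.ne'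
        -- evaluate at m
        have hpm : p m = z.fst m := by rw [hp]; simp [e_self]
        have hqm : q m = 0 := by rw [hq]; simp [hpm]
        have h3 : ‖q‖ * p m - ‖p‖ * q m = 0 := congrArg (fun x : Ell1 => x m) h2
        rw [hqm, hpm, mul_zero, sub_zero] at h3
        exact (mul_ne_zero hqpos.ne' hm) h3
      refine ⟨z.fst m, z.snd, m, ?_, zmk_ext _ _ _ (by rw [← hp, hpq, hq0, add_zero]) rfl⟩
      rw [← hnorm, hsp, hq0, norm_zero, add_zero, hpn, sq_abs]
  · rintro ⟨a, b, m, hab, rfl⟩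
    rw [mem_extremePoints_iff_left]
    refine ⟨?_, ?_⟩
    · rw [z_mem_ball]
      change ‖a • e m‖ ^ 2 + b ^ 2 ≤ 1
      rw [norm_smul, norm_e, mul_one, Real.norm_eq_abs, sq_abs, hab]
    · rintro y hy y' hy' ⟨s, t, hs, ht, hst, h⟩
      have hf : s • y.fst + t • y'.fst = a • e m := congrArg WithLp.fst h
      have hsn : s * y.snd + t * y'.snd = b := congrArg WithLp.snd h
      have hfm : s * y.fst m + t * y'.fst m = a := by
        have : s * y.fst m + t * y'.fst m = a * e m m := congrArg (fun x : Ell1 => x m) hf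
        rw [this, e_self, mul_one]
      obtain ⟨hu, hv⟩ := disk_strict hs ht hst (coord_mem hy m) (coord_mem hy' m)
        (by rw [hfm, hsn, hab])
      have hya : y.fst m = a := by
        rw [← hu, ← add_mul, hst, one_mul] at hfm; exact hfm
      have hyb : y.snd = b := by
        rw [← hv, ← add_mul, hst, one_mul] at hsn; exact hsn
      refine zmk_ext _ _ _ ?_ hyb
      rw [z_mem_ball, hyb, ell1_norm_split y.fst m, hya] at hy
      have hn : ‖y.fst - a • e m‖ = 0 := by
        have h0 := norm_nonneg (y.fst - a • e m)
        have h1 := abs_nonneg a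
        have h2 := sq_abs a
        have : ‖y.fst - a • e m‖ ^ 2 ≤ 0 := by nlinarith [mul_nonneg h1 h0]
        exact pow_eq_zero_iff two_ne_zero |>.1 (le_antisymm this (sq_nonneg _))
      exact sub_eq_zero.1 (norm_eq_zero.1 hn)
end

section
/- In Z = ℓ₁ ⊕₂ ℝ, let (a·e_i, b) and (c·e_j, d) be two points with a² + b² = 1 and c² + d² = 1 (so both are extreme points of B_Z). Then the distance between them equals 2 if and only if either i = j, a = −c, and b = −d, or i ≠ j, |a| = |c|, and b = −d. In particular, if two extreme points of B_Z are at distance 2, then their second (real) coordinates are negatives of each other. -/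
/-- The projection of Z = ℓ₁ ⊕₂ ℝ onto the real coordinate. -/
noncomputable def h (z : Z) : ℝ := ((WithLp.equiv 2 (Ell1 × ℝ)) z).2

theorem aux_dist_sq (u v : Z) : dist u v ^ 2 = ‖u.fst - v.fst‖ ^ 2 + (u.snd - v.snd) ^ 2 := by
  rw [dist_eq_norm, WithLp.prod_norm_sq_eq_of_L2]
  simp

theorem aux_norm_sq (u : Z) : ‖u‖ ^ 2 = ‖u.fst‖ ^ 2 + u.snd ^ 2 := by
  rw [WithLp.prod_norm_sq_eq_of_L2]
  simp

theorem aux_smul_e (a : ℝ) (i : ℕ) : a • e i = (lp.single 1 i a : Ell1) := by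
  rw [e, ← lp.single_smul]
  simp

theorem aux_same (a c : ℝ) (i : ℕ) : ‖a • e i - c • e i‖ = |a - c| := by
  rw [← sub_smul, aux_smul_e, lp.norm_single (by norm_num), Real.norm_eq_abs]

theorem aux_diff (a c : ℝ) (i j : ℕ) (hij : i ≠ j) : ‖a • e i - c • e j‖ = |a| + |c| := by
  have key := lp.norm_sum_single (p := 1) (E := fun _ : ℕ => ℝ) (by norm_num)
    (fun k => if k = i then a else -c) {i, j}
  rw [Finset.sum_pair hij, Finset.sum_pair hij] at key
  simp only [if_true, if_neg hij.symm, ENNReal.toReal_one, Real.rpow_one, norm_neg,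
    Real.norm_eq_abs, abs_neg] at key
  rw [sub_eq_add_neg, ← neg_smul, aux_smul_e, aux_smul_e]
  exact key

/-- For extreme points (a·e_i, b) and (c·e_j, d) of the unit ball of
Z = ℓ₁ ⊕₂ ℝ, the distance between them is 2 iff either i = j, a = -c and
b = -d, or i ≠ j, |a| = |c| and b = -d. In particular, any two extreme points
of the unit ball at distance 2 have opposite real coordinates. -/
theorem dist_eq_two_iff_extremePoints_ell1_sum2_real
    (a b c d : ℝ) (i j : ℕ) (hab : a ^ 2 + b ^ 2 = 1) (hcd : c ^ 2 + d ^ 2 = 1) :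
    (dist (zmk (a • e i) b) (zmk (c • e j) d) = 2 ↔
      (i = j ∧ a = -c ∧ b = -d) ∨ (i ≠ j ∧ |a| = |c| ∧ b = -d)) ∧
    (∀ u v : Z, u ∈ Set.extremePoints ℝ (Metric.closedBall (0 : Z) 1) →
      v ∈ Set.extremePoints ℝ (Metric.closedBall (0 : Z) 1) →
      dist u v = 2 → h u = -h v) := by
  have hd : ∀ u v : Z, dist u v = 2 ↔ ‖u.fst - v.fst‖ ^ 2 + (u.snd - v.snd) ^ 2 = 4 := by
    intro u v
    rw [← aux_dist_sq]
    have := dist_nonneg (x := u) (y := v)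
    constructor
    · intro h1; rw [h1]; norm_num
    · intro h1; nlinarith
  refine ⟨?_, ?_⟩
  · rw [hd]
    change ‖a • e i - c • e j‖ ^ 2 + (b - d) ^ 2 = 4 ↔ _
    by_cases hij : i = j
    · subst hij
      rw [aux_same, sq_abs]
      simp only [true_and, ne_eq, not_true_eq_false, false_and, or_false]
      constructor
      · intro h1
        have h2 : (a + c) ^ 2 + (b + d) ^ 2 = 0 := by linarith
        constructor <;> nlinarith [sq_nonneg (a + c), sq_nonneg (b + d)]
      · rintro ⟨rfl, rfl⟩
        linarith
    · rw [aux_diff _ _ _ _ hij]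
      simp only [hij, false_and, ne_eq, not_false_eq_true, true_and, false_or]
      have ha := sq_abs a
      have hc := sq_abs c
      constructor
      · intro h1
        have h2 : (|a| - |c|) ^ 2 + (b + d) ^ 2 = 0 := by linarith
        constructor <;> nlinarith [sq_nonneg (|a| - |c|), sq_nonneg (b + d)]
      · rintro ⟨h1, rfl⟩
        rw [h1]
        linarith
  · intro u v hu hv huv
    have hu1 : ‖u‖ ≤ 1 := by simpa using hu.1
    have hv1 : ‖v‖ ≤ 1 := by simpa using hv.1
    have hu2 : ‖u‖ ^ 2 ≤ 1 := pow_le_one₀ (norm_nonneg _) hu1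
    have hv2 : ‖v‖ ^ 2 ≤ 1 := pow_le_one₀ (norm_nonneg _) hv1
    rw [aux_norm_sq] at hu2 hv2
    rw [hd] at huv
    have h3 : ‖u.fst - v.fst‖ ^ 2 ≤ (‖u.fst‖ + ‖v.fst‖) ^ 2 :=
      pow_le_pow_left₀ (norm_nonneg _) (norm_sub_le _ _) 2
    change u.snd = - v.snd
    have h4 : (u.snd + v.snd) ^ 2 ≤ 0 := by
      linarith [sq_nonneg (‖u.fst‖ - ‖v.fst‖)]
    have h5 : u.snd + v.snd = 0 := pow_eq_zero_iff (two_ne_zero) |>.1 (le_antisymm h4 (sq_nonneg _))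
    linarith
end
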